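/- arXiv:1107.1120 — 2 statements merged into one kernel-verified Lean document; each statement's English description precedes it below -/
import Mathlib

section
/- Let v ∈ μ_{q−1} and u = v^{1−p}. Then ψ_u(X) = X·(X+u·p)^{p−1} + p is the minimal polynomial of ω_u^{p−1} over K; the field K(ω_u^{p−1}) is the splitting field of ψ_u over K, so M_u = K(ω_u^{p−1}); [M_u : K] = p; and M_u is the unique intermediate field of L_u/K of degree p over K. -/
open Polynomial Filter IntermediateField

variable (p : ℕ) [Fact p.Prime]

/-- A fixed algebraic closure of `ℚ_p`. -/
noncomputable abbrev Qpbar := AlgebraicClosure ℚ_[p]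

/-- The unramified extension `K` of `ℚ_p` of degree `d` inside `ℚ̄_p`, realized as the
splitting field of `X^(p^d - 1) - 1`. -/
noncomputable def Kur (d : ℕ) : IntermediateField ℚ_[p] (Qpbar p) :=
  IntermediateField.adjoin ℚ_[p] {x : Qpbar p | x ^ (p ^ d - 1) = 1}

/-- `ψ_u(X) = X (X + u p)^{p-1} + p` as a polynomial over `ℚ̄_p`. -/
noncomputable def psiPoly (u : Qpbar p) : Polynomial (Qpbar p) :=
  X * (X + C (u * (p : Qpbar p))) ^ (p - 1) + C (p : Qpbar p)

/-- `M_u`: the splitting field of `ψ_u` over `K` inside `ℚ̄_p`, i.e. `K` with all roots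
of `ψ_u` adjoined. -/
noncomputable def Mfield (d : ℕ) (u : Qpbar p) : IntermediateField (Kur p d) (Qpbar p) :=
  IntermediateField.adjoin (Kur p d) {x : Qpbar p | (psiPoly p u).IsRoot x}


section AbvHelpers

variable {L : Type*} [Field L] (N : AbsoluteValue L ℝ)

/-- The closed unit ball of a nonarchimedean absolute value. -/
def abvBall (hN : IsNonarchimedean N) : Subring L where
  carrier := {x | N x ≤ 1}
  mul_mem' := by
    intro a b ha hb
    simp only [Set.mem_ofPred_eq, map_mul] at *
    exact mul_le_one₀ ha (N.nonneg b) hb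
  one_mem' := by simp
  add_mem' := by
    intro a b ha hb
    exact (hN a b).trans (max_le ha hb)
  zero_mem' := by simp
  neg_mem' := by
    intro a ha
    simpa using ha

theorem mem_abvBall (hN : IsNonarchimedean N) (x : L) : x ∈ abvBall N hN ↔ N x ≤ 1 := Iff.rfl

theorem abv_add_lt (hN : IsNonarchimedean N) {x y : L} {c : ℝ} (hx : N x < c) (hy : N y < c) :
    N (x + y) < c := lt_of_le_of_lt (hN x y) (max_lt hx hy)

theorem abv_add_eq_right (hN : IsNonarchimedean N) {x y : L} (h : N x < N y) :
    N (x + y) = N y := by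
  apply le_antisymm ((hN x y).trans (max_le h.le le_rfl))
  by_contra hc
  push Not at hc
  have := abv_add_lt N hN hc (show N (-x) < N y by simpa using h)
  simp at this

theorem abv_add_pow (hN : IsNonarchimedean N) {p : ℕ} (hp : p.Prime) {a b : L}
    (ha : N a ≤ 1) (hb : N b ≤ 1) :
    ∃ r, N r ≤ 1 ∧ (a + b) ^ p = a ^ p + b ^ p + p * a * b * r := by
  obtain ⟨r, hr⟩ := exists_add_pow_prime_eq hp (⟨a, ha⟩ : abvBall N hN) ⟨b, hb⟩
  exact ⟨r, r.2, by simpa using congrArg Subtype.val hr⟩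

theorem prod_sub_zmod (p : ℕ) [Fact p.Prime] :
    ∃ Q : ℤ[X], X ^ p - X = ∏ a ∈ Finset.range p, (X - C (a : ℤ)) + C (p : ℤ) * Q := by
  have hp : p.Prime := Fact.out
  have h : C (p : ℤ) ∣ (X ^ p - X - ∏ a ∈ Finset.range p, (X - C (a : ℤ)) : ℤ[X]) := by
    rw [C_dvd_iff_dvd_coeff]
    intro i
    rw [← ZMod.intCast_zmod_eq_zero_iff_dvd]
    have key : (X ^ p - X - ∏ a ∈ Finset.range p, (X - C (a : ℤ)) : ℤ[X]).map
        (Int.castRingHom (ZMod p)) = 0 := by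
      have h1 : (∏ a ∈ Finset.range p, (X - C (a : ZMod p))) = X ^ p - X := by
        have hr := FiniteField.roots_X_pow_card_sub_X (ZMod p)
        rw [ZMod.card] at hr
        have hm : (X ^ p - X : (ZMod p)[X]).Monic := by
          apply monic_X_pow_sub
          rw [degree_X]; exact_mod_cast hp.one_lt
        have h2 := prod_multiset_X_sub_C_of_monic_of_roots_card_eq hm (by
          rw [hr, FiniteField.X_pow_card_sub_X_natDegree_eq _ hp.one_lt]
          simp [ZMod.card])
        rw [hr] at h2
        rw [← h2]
        change _ = ∏ a : ZMod p, (X - C a)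
        refine Finset.prod_bij (fun a _ => (a : ZMod p)) (by simp) ?_ ?_ (by simp)
        · intro a ha b hb hab
          rw [ZMod.natCast_eq_natCast_iff] at hab
          exact Nat.ModEq.eq_of_lt_of_lt hab (by simpa using ha) (by simpa using hb)
        · intro b _
          exact ⟨b.val, by simpa using ZMod.val_lt b, by simp⟩
      simp only [Polynomial.map_sub, Polynomial.map_pow, map_X, Polynomial.map_prod, map_C]
      simp only [eq_intCast, Int.cast_natCast]
      rw [h1, sub_self]
    have := congrArg (fun f => f.coeff i) key
    simpa only [coeff_map, coeff_zero, eq_intCast] using this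
  obtain ⟨Q, hQ⟩ := h
  exact ⟨Q, by rw [← hQ]; ring⟩

theorem abv_near_nat (hN : IsNonarchimedean N) (p : ℕ) [Fact p.Prime] (hNp : N (p : L) < 1)
    {y : L} (hy : N y ≤ 1) (h : N (y ^ p - y) < 1) : ∃ a : ℕ, N (y - a) < 1 := by
  obtain ⟨Q, hQ⟩ := prod_sub_zmod p
  have h1 : y ^ p - y = ∏ a ∈ Finset.range p, (y - (a : L)) + p * aeval y Q := by
    have := congrArg (aeval y) hQ
    simpa [map_prod] using this
  have h2 : N (aeval y Q) ≤ 1 := by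
    have : aeval y Q = ((aeval (⟨y, hy⟩ : abvBall N hN) Q : abvBall N hN) : L) := by
      have := Polynomial.hom_eval₂ Q (algebraMap ℤ (abvBall N hN)) (abvBall N hN).subtype ⟨y, hy⟩
      rw [aeval_def, aeval_def]
      change _ = (abvBall N hN).subtype _
      rw [this]
      congr 1
    rw [this]
    exact (aeval (⟨y, hy⟩ : abvBall N hN) Q : abvBall N hN).2
  have h3 : N (∏ a ∈ Finset.range p, (y - (a : L))) < 1 := by
    have : ∏ a ∈ Finset.range p, (y - (a : L)) = (y ^ p - y) + -(p * aeval y Q) := by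
      rw [h1]; ring
    rw [this]
    apply abv_add_lt N hN h
    rw [N.map_neg, N.map_mul]
    exact lt_of_le_of_lt (mul_le_of_le_one_right (N.nonneg _) h2) hNp
  by_contra hc
  push Not at hc
  rw [map_prod] at h3
  have h4 := Finset.prod_le_prod (s := Finset.range p) (f := fun _ => (1 : ℝ))
    (g := fun a : ℕ => N (y - (a : L))) (fun _ _ => zero_le_one) (fun a _ => hc a)
  rw [Finset.prod_const_one] at h4
  exact absurd h3 (not_lt.mpr h4)

/-- Separation of the roots of the auxiliary equation. -/
theorem abv_sep (hN : IsNonarchimedean N) {p : ℕ} (hp : p.Prime) {u θ e f : L}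
    (hu : N u = 1) (hθ : N θ < 1) (hp0 : (p : L) ≠ 0)
    (hθp : N θ ^ p = N (p : L)) (he1 : N e ≤ 1) 
    (he : θ * ((1 + e) ^ p - 1) + u * p * e = 0) (hf : θ * ((1 + f) ^ p - 1) + u * p * f = 0)
    (hef : N (f - e) < N θ) : f = e := by
  by_contra hne
  have hη : f - e ≠ 0 := sub_ne_zero.mpr hne
  obtain ⟨r, hr, hpow⟩ := abv_add_pow N hN hp (a := 1 + e) (b := f - e)
    ((hN 1 e).trans (max_le (by simp) he1)) (hef.le.trans hθ.le)
  have h1 : (1 + e) + (f - e) = 1 + f := by ring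
  rw [h1] at hpow
  have hpp : (f - e) ^ p = (f - e) ^ (p - 1) * (f - e) := by
    rw [← pow_succ, Nat.sub_add_cancel hp.one_le]
  have h2 : (f - e) * (θ * (f - e) ^ (p - 1) + p * θ * ((1 + e) * r) + u * p) = 0 := by
    rw [hpow, hpp] at hf
    linear_combination hf - he
  have h3 := (mul_eq_zero.mp h2).resolve_left hη
  have hpos : 0 < N (p : L) := N.pos hp0
  have hθ0 : 0 < N θ := by
    rcases (N.nonneg θ).lt_or_eq with h | h
    · exact h
    · rw [← h, zero_pow hp.ne_zero] at hθp; exact absurd hθp hpos.ne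
  have h4 : N (θ * (f - e) ^ (p - 1)) < N (u * p) := by
    rw [N.map_mul, N.map_mul, hu, one_mul, N.map_pow, ← hθp]
    conv_rhs => rw [← Nat.sub_add_cancel hp.one_le, pow_succ, mul_comm]
    gcongr
    have := hp.two_le
    omega
  have h5 : N (p * θ * ((1 + e) * r)) < N (u * p) := by
    rw [N.map_mul, N.map_mul, N.map_mul u, hu, one_mul, N.map_mul]
    have : N (1 + e) * N r ≤ 1 :=
      mul_le_one₀ ((hN 1 e).trans (max_le (by simp) he1)) (N.nonneg _) hr
    calc N (p : L) * N θ * (N (1 + e) * N r) ≤ N (p : L) * N θ :=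
          mul_le_of_le_one_right (by positivity) this
      _ < N (p : L) := mul_lt_of_lt_one_right hpos hθ
  have h6 := abv_add_eq_right N hN (abv_add_lt N hN h4 h5)
  rw [h3, N.map_zero, N.map_mul, hu, one_mul] at h6
  exact hpos.ne h6

/-- Norm of a root of `ψ_u`. -/
theorem abv_root (hN : IsNonarchimedean N) {p : ℕ} (hp : p.Prime) {u θ : L}
    (hNp : N (p : L) < 1) (hu : N u = 1) (hp0 : (p : L) ≠ 0)
    (h : θ * (θ + u * p) ^ (p - 1) = -p) :
    N (u * p) < N θ ∧ N (θ + u * p) = N θ ∧ N θ ^ p = N (p : L) ∧ N θ < 1 := by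
  have hpos : 0 < N (p : L) := N.pos hp0
  have hup : N (u * p) = N (p : L) := by simp [hu]
  have h' : N θ * N (θ + u * p) ^ (p - 1) = N (p : L) := by
    rw [← N.map_pow, ← N.map_mul, h, N.map_neg]
  have hpe : p = (p - 1) + 1 := (Nat.sub_add_cancel hp.one_le).symm
  have h1 : N (p : L) < N θ := by
    by_contra hc
    push Not at hc
    have h2 : N (θ + u * p) ≤ N (p : L) := (hN _ _).trans (max_le hc hup.le)
    have h3 : N θ * N (θ + u * p) ^ (p - 1) ≤ N (p : L) * N (p : L) ^ (p - 1) := by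
      gcongr
    have h4 : N (p : L) ^ (p - 1) < 1 :=
      pow_lt_one₀ hpos.le hNp (by have := hp.two_le; omega)
    nlinarith
  have h2 : N (θ + u * p) = N θ := by
    rw [add_comm]; exact abv_add_eq_right N hN (by rw [hup]; exact h1)
  have h3 : N θ ^ p = N (p : L) := by
    rw [h2] at h'
    rw [← h']
    conv_lhs => rw [hpe, pow_succ, mul_comm]
  refine ⟨by rw [hup]; exact h1, h2, h3, ?_⟩
  by_contra hc
  push Not at hc
  have := one_le_pow₀ hc (n := p)
  linarith

end AbvHelpers

section Unramified

theorem exists_spectralAbv : ∃ N : AbsoluteValue (Qpbar p) ℝ, IsNonarchimedean N ∧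
    ∀ x, N x = spectralNorm ℚ_[p] (Qpbar p) x := by
  let f := spectralMulAlgNorm ℚ_[p] (Qpbar p)
  refine ⟨⟨⟨f, map_mul f⟩, fun x => apply_nonneg f x, fun x => map_eq_zero_iff_eq_zero f,
    fun x y => map_add_le_add f x y⟩, ?_, fun x => rfl⟩
  exact isNonarchimedean_spectralNorm

/-- The order `ℤ_p[μ_{q-1}]`. -/
noncomputable def Aring (d : ℕ) : Subring (Qpbar p) :=
  Subring.closure ((algebraMap ℚ_[p] (Qpbar p)) '' {c | ‖c‖ ≤ 1} ∪ {x | x ^ (p ^ d - 1) = 1})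

variable {p}

theorem algebraMap_mem_Aring (d : ℕ) {c : ℚ_[p]} (hc : ‖c‖ ≤ 1) :
    algebraMap ℚ_[p] (Qpbar p) c ∈ Aring p d :=
  Subring.subset_closure (Or.inl ⟨c, hc, rfl⟩)

theorem padic_dvd {c : ℚ_[p]} (hc : ‖c‖ < 1) : ∃ b : ℚ_[p], ‖b‖ ≤ 1 ∧ c = p * b := by
  have := (PadicInt.norm_lt_one_iff_dvd (⟨c, hc.le⟩ : ℤ_[p])).mp hc
  obtain ⟨b, hb⟩ := this
  exact ⟨b, b.2, by simpa using congrArg Subtype.val hb⟩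

theorem padic_frob (d : ℕ) {c : ℚ_[p]} (hc : ‖c‖ ≤ 1) :
    ∃ b : ℚ_[p], ‖b‖ ≤ 1 ∧ c ^ (p ^ d) = c + p * b := by
  let z : ℤ_[p] := ⟨c, hc⟩
  have h : z ^ (p ^ d) - z ∈ RingHom.ker (PadicInt.toZMod (p := p)) := by
    rw [RingHom.mem_ker, map_sub, map_pow, ZMod.pow_card_pow, sub_self]
  rw [PadicInt.ker_toZMod, PadicInt.maximalIdeal_eq_span_p, Ideal.mem_span_singleton] at h
  obtain ⟨b, hb⟩ := h
  refine ⟨b, b.2, ?_⟩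
  have := congrArg Subtype.val hb
  rw [PadicInt.coe_sub, PadicInt.coe_mul, PadicInt.coe_pow, PadicInt.coe_natCast] at this
  change c ^ (p ^ d) - c = p * (b : ℚ_[p]) at this
  linear_combination this

theorem Aring_frob (hp : Odd p) (d : ℕ) {x : Qpbar p} (hx : x ∈ Aring p d) :
    ∃ a ∈ Aring p d, x ^ (p ^ d) = x + p * a := by
  have hpp : p.Prime := Fact.out
  have hq : p ^ d = (p ^ d - 1) + 1 := (Nat.sub_add_cancel (Nat.one_le_pow _ _ hpp.pos)).symm
  refine Subring.closure_induction (p := fun x _ => ∃ a ∈ Aring p d, x ^ (p ^ d) = x + p * a)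
    ?_ ?_ ?_ ?_ ?_ ?_ hx
  · rintro x (⟨c, hc, rfl⟩ | hx)
    · obtain ⟨b, hb, h⟩ := padic_frob d hc
      refine ⟨_, algebraMap_mem_Aring d hb, ?_⟩
      rw [← map_pow, h]; simp
    · refine ⟨0, zero_mem _, ?_⟩
      have hx' : x ^ (p ^ d - 1) = 1 := hx
      rw [hq, pow_succ, hx']; simp
  · exact ⟨0, zero_mem _, by rw [hq, pow_succ]; simp⟩
  · exact ⟨0, zero_mem _, by simp⟩
  · rintro x y hx hy ⟨a, ha, hxa⟩ ⟨b, hb, hyb⟩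
    obtain ⟨r, hr⟩ := exists_add_pow_prime_pow_eq hpp (⟨x, hx⟩ : Aring p d) ⟨y, hy⟩ d
    have hr' := congrArg Subtype.val hr
    push_cast at hr'
    refine ⟨a + b + x * y * r, add_mem (add_mem ha hb) (mul_mem (mul_mem hx hy) r.2), ?_⟩
    rw [hr', hxa, hyb]; ring
  · rintro x hx ⟨a, ha, hxa⟩
    refine ⟨-a, neg_mem ha, ?_⟩
    rw [(hp.pow).neg_pow, hxa]; ring
  · rintro x y hx hy ⟨a, ha, hxa⟩ ⟨b, hb, hyb⟩
    have hpA : (p : Qpbar p) ∈ Aring p d := natCast_mem _ _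
    refine ⟨a * y + x * b + p * (a * b), add_mem (add_mem (mul_mem ha hy) (mul_mem hx hb))
      (mul_mem hpA (mul_mem ha hb)), ?_⟩
    rw [mul_pow, hxa, hyb]; ring

theorem Aring_frob_iter (hp : Odd p) (d : ℕ) {x : Qpbar p} (hx : x ∈ Aring p d) (k : ℕ) :
    ∃ a ∈ Aring p d, x ^ ((p ^ d) ^ k) = x + p * a := by
  induction k with
  | zero => exact ⟨0, zero_mem _, by simp⟩
  | succ k ih =>
    obtain ⟨a, ha, h⟩ := ih
    obtain ⟨b, hb, h'⟩ := Aring_frob hp d (pow_mem hx ((p ^ d) ^ k))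
    refine ⟨a + b, add_mem ha hb, ?_⟩
    rw [pow_succ, pow_mul, h', h]; ring

theorem spectral_coeff_lt {x : Qpbar p} (hx : spectralNorm ℚ_[p] (Qpbar p) x < 1) {i : ℕ}
    (hi : i < (minpoly ℚ_[p] x).natDegree) : ‖(minpoly ℚ_[p] x).coeff i‖ < 1 := by
  have h1 : spectralValueTerms (minpoly ℚ_[p] x) i < 1 :=
    lt_of_le_of_lt (le_ciSup (spectralValueTerms_bddAbove _) i) hx
  rw [spectralValueTerms_of_lt_natDegree _ hi] at h1
  by_contra hc
  push Not at hc
  have h2 : (0 : ℝ) ≤ 1 / ((minpoly ℚ_[p] x).natDegree - i : ℝ) := by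
    have : (i : ℝ) < (minpoly ℚ_[p] x).natDegree := by exact_mod_cast hi
    apply one_div_nonneg.mpr
    linarith
  exact absurd h1 (not_lt.mpr (Real.one_le_rpow hc h2))

theorem Aring_dvd (hp : Odd p) (d : ℕ) (hd : 0 < d) {x : Qpbar p} (hx : x ∈ Aring p d)
    (hlt : spectralNorm ℚ_[p] (Qpbar p) x < 1) : ∃ a ∈ Aring p d, x = p * a := by
  have hpp : p.Prime := Fact.out
  set n := (minpoly ℚ_[p] x).natDegree with hn
  have hxi : IsIntegral ℚ_[p] x := (AlgebraicClosure.isAlgebraic ℚ_[p]).isAlgebraic x |>.isIntegral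
  have h1 : ∃ a ∈ Aring p d, x ^ n = p * a := by
    have hex : ∀ i, ∃ a ∈ Aring p d, i < n →
        algebraMap ℚ_[p] (Qpbar p) ((minpoly ℚ_[p] x).coeff i) * x ^ i = p * a := by
      intro i
      by_cases hi : i < n
      · obtain ⟨b, hb, h⟩ := padic_dvd (spectral_coeff_lt hlt hi)
        refine ⟨_, mul_mem (algebraMap_mem_Aring d hb) (pow_mem hx i), fun _ => ?_⟩
        rw [h]; simp [mul_assoc]
      · exact ⟨0, zero_mem _, fun h => absurd h hi⟩
    choose f hf hf' using hex
    refine ⟨-∑ i ∈ Finset.range n, f i, neg_mem (sum_mem fun i _ => hf i), ?_⟩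
    have h0 := minpoly.aeval ℚ_[p] x
    rw [aeval_eq_sum_range, Finset.sum_range_succ, ← hn] at h0
    have hlead : (minpoly ℚ_[p] x).coeff n = 1 := (minpoly.monic hxi).coeff_natDegree
    rw [hlead, one_smul] at h0
    have h2 : ∑ i ∈ Finset.range n, (minpoly ℚ_[p] x).coeff i • x ^ i
        = p * ∑ i ∈ Finset.range n, f i := by
      rw [Finset.mul_sum]
      refine Finset.sum_congr rfl fun i hi => ?_
      rw [Algebra.smul_def, hf' i (by simpa using hi)]
    rw [h2] at h0
    linear_combination h0
  obtain ⟨a, ha, h⟩ := h1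
  have hq : n ≤ (p ^ d) ^ n :=
    (Nat.lt_pow_self (Nat.one_lt_pow hd.ne' hpp.one_lt)).le
  obtain ⟨b, hb, h'⟩ := Aring_frob_iter hp d hx n
  refine ⟨a * x ^ ((p ^ d) ^ n - n) - b, sub_mem (mul_mem ha (pow_mem hx _)) hb, ?_⟩
  have h3 : x ^ ((p ^ d) ^ n) = x ^ n * x ^ ((p ^ d) ^ n - n) := by
    rw [← pow_add, Nat.add_sub_cancel' hq]
  rw [h3, h] at h'
  linear_combination -h'

theorem Aring_le_one {N : AbsoluteValue (Qpbar p) ℝ} (hN : IsNonarchimedean N)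
    (hNs : ∀ x, N x = spectralNorm ℚ_[p] (Qpbar p) x) (d : ℕ) (hd : 0 < d)
    {x : Qpbar p} (hx : x ∈ Aring p d) : N x ≤ 1 := by
  have hpp : p.Prime := Fact.out
  have hq0 : p ^ d - 1 ≠ 0 := by
    have := Nat.one_lt_pow hd.ne' hpp.one_lt
    omega
  suffices h : Aring p d ≤ abvBall N hN from h hx
  rw [Aring, Subring.closure_le]
  rintro y (⟨c, hc, rfl⟩ | hy)
  · change N _ ≤ 1
    rw [hNs, spectralNorm_extends]; exact hc
  · change N _ ≤ 1
    have hy' : y ^ (p ^ d - 1) = 1 := hy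
    have h1 : N y ^ (p ^ d - 1) = 1 := by rw [← N.map_pow, hy', N.map_one]
    exact (pow_eq_one_iff_of_nonneg (N.nonneg _) hq0).mp h1 |>.le

theorem abv_p {N : AbsoluteValue (Qpbar p) ℝ}
    (hNs : ∀ x, N x = spectralNorm ℚ_[p] (Qpbar p) x) : N (p : Qpbar p) = (p : ℝ)⁻¹ := by
  have : (p : Qpbar p) = algebraMap ℚ_[p] (Qpbar p) p := by simp
  rw [this, hNs, spectralNorm_extends, Padic.norm_p]

theorem Aring_value {N : AbsoluteValue (Qpbar p) ℝ} (hN : IsNonarchimedean N)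
    (hNs : ∀ x, N x = spectralNorm ℚ_[p] (Qpbar p) x) (hp : Odd p) (d : ℕ) (hd : 0 < d)
    (m : ℕ) : ∀ x ∈ Aring p d, (p : ℝ)⁻¹ ^ m < N x → ∃ n : ℕ, N x = (p : ℝ)⁻¹ ^ n := by
  have hpp : p.Prime := Fact.out
  induction m with
  | zero =>
    intro x hx h
    have := Aring_le_one hN hNs d hd hx
    rw [pow_zero] at h
    linarith
  | succ m ih =>
    intro x hx h
    rcases (Aring_le_one hN hNs d hd hx).lt_or_eq with h1 | h1
    · rw [hNs] at h1
      obtain ⟨a, ha, rfl⟩ := Aring_dvd hp d hd hx h1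
      rw [N.map_mul, abv_p hNs] at h ⊢
      have hpos : (0 : ℝ) < (p : ℝ)⁻¹ := by
        have : (0 : ℝ) < p := by exact_mod_cast hpp.pos
        positivity
      rw [pow_succ, mul_comm] at h
      obtain ⟨n, hn⟩ := ih a ha (lt_of_mul_lt_mul_left h hpos.le)
      exact ⟨n + 1, by rw [hn, pow_succ, mul_comm]⟩
    · exact ⟨0, by simpa using h1⟩

theorem Kur_scale (d : ℕ) {x : Qpbar p} (hx : x ∈ Kur p d) :
    ∃ n : ℕ, (p : Qpbar p) ^ n * x ∈ Aring p d := by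
  have hpp : p.Prime := Fact.out
  have hpA : (p : Qpbar p) ∈ Aring p d := natCast_mem _ _
  have hx' : x ∈ Algebra.adjoin ℚ_[p] {x : Qpbar p | x ^ (p ^ d - 1) = 1} := by
    rw [← IntermediateField.adjoin_toSubalgebra]
    exact hx
  refine Algebra.adjoin_induction (p := fun x _ => ∃ n : ℕ, (p : Qpbar p) ^ n * x ∈ Aring p d)
    ?_ ?_ ?_ ?_ hx'
  · intro y hy
    exact ⟨0, by rw [pow_zero, one_mul]; exact Subring.subset_closure (Or.inr hy)⟩
  · intro c
    obtain ⟨n, hn⟩ := pow_unbounded_of_one_lt ‖c‖ (show (1 : ℝ) < p by exact_mod_cast hpp.one_lt)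
    refine ⟨n, ?_⟩
    have : (p : Qpbar p) ^ n * algebraMap ℚ_[p] (Qpbar p) c
        = algebraMap ℚ_[p] (Qpbar p) (p ^ n * c) := by simp
    rw [this]
    apply algebraMap_mem_Aring
    rw [norm_mul, norm_pow, Padic.norm_p, inv_pow]
    have hpos : (0 : ℝ) < (p : ℝ) ^ n := by
      have : (0 : ℝ) < p := by exact_mod_cast hpp.pos
      positivity
    rw [inv_mul_le_iff₀ hpos, mul_one]
    exact hn.le
  · rintro y z _ _ ⟨n, hn⟩ ⟨m, hm⟩
    refine ⟨n + m, ?_⟩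
    have : (p : Qpbar p) ^ (n + m) * (y + z)
        = p ^ m * (p ^ n * y) + p ^ n * (p ^ m * z) := by ring
    rw [this]
    exact add_mem (mul_mem (pow_mem hpA _) hn) (mul_mem (pow_mem hpA _) hm)
  · rintro y z _ _ ⟨n, hn⟩ ⟨m, hm⟩
    refine ⟨n + m, ?_⟩
    have : (p : Qpbar p) ^ (n + m) * (y * z) = (p ^ n * y) * (p ^ m * z) := by ring
    rw [this]
    exact mul_mem hn hm

/-- `K` is unramified: its value group is `p^ℤ`. -/
theorem Kur_value {N : AbsoluteValue (Qpbar p) ℝ} (hN : IsNonarchimedean N)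
    (hNs : ∀ x, N x = spectralNorm ℚ_[p] (Qpbar p) x) (hp : Odd p) (d : ℕ) (hd : 0 < d)
    {x : Qpbar p} (hx : x ∈ Kur p d) (hx0 : x ≠ 0) : ∃ n : ℤ, N x = (p : ℝ)⁻¹ ^ n := by
  have hpp : p.Prime := Fact.out
  have hp0 : (p : Qpbar p) ≠ 0 := by exact_mod_cast hpp.ne_zero
  have hpos : (0 : ℝ) < (p : ℝ)⁻¹ := by
    have : (0 : ℝ) < p := by exact_mod_cast hpp.pos
    positivity
  have hlt : (p : ℝ)⁻¹ < 1 := inv_lt_one_of_one_lt₀ (by exact_mod_cast hpp.one_lt)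
  obtain ⟨n, hn⟩ := Kur_scale d hx
  have hne : (p : Qpbar p) ^ n * x ≠ 0 := mul_ne_zero (pow_ne_zero _ hp0) hx0
  obtain ⟨m, hm⟩ := exists_pow_lt_of_lt_one (N.pos hne) hlt
  obtain ⟨k, hk⟩ := Aring_value hN hNs hp d hd m _ hn hm
  refine ⟨(k : ℤ) - n, ?_⟩
  rw [N.map_mul, N.map_pow, abv_p hNs] at hk
  rw [zpow_sub₀ hpos.ne', zpow_natCast, zpow_natCast, ← hk]
  rw [mul_div_cancel_left₀ _ (pow_ne_zero _ hpos.ne')]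

end Unramified

section Main

variable {p}

/-- `ψ_u` over `K`. -/
noncomputable def psiK (d : ℕ) (u : Kur p d) : (Kur p d)[X] :=
  X * (X + C (u * (p : Kur p d))) ^ (p - 1) + C (p : Kur p d)

theorem psiK_aeval (d : ℕ) (u : Kur p d) (x : Qpbar p) :
    aeval x (psiK d u) = x * (x + u * p) ^ (p - 1) + p := by
  simp [psiK]

theorem psiK_monic_natDegree (d : ℕ) (u : Kur p d) :
    (psiK d u).Monic ∧ (psiK d u).natDegree = p := by
  have hpp : p.Prime := Fact.out
  have h1 : (X * (X + C (u * (p : Kur p d))) ^ (p - 1) : (Kur p d)[X]).Monic :=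
    monic_X.mul ((monic_X_add_C _).pow _)
  have h2 : (X * (X + C (u * (p : Kur p d))) ^ (p - 1) : (Kur p d)[X]).natDegree = p := by
    rw [monic_X.natDegree_mul ((monic_X_add_C _).pow _), natDegree_X,
      (monic_X_add_C _).natDegree_pow, natDegree_X_add_C, mul_one,
      Nat.add_sub_cancel' hpp.one_le]
  have h3 : (C (p : Kur p d)).degree <
      (X * (X + C (u * (p : Kur p d))) ^ (p - 1) : (Kur p d)[X]).degree := by
    apply lt_of_le_of_lt degree_C_le
    rw [degree_eq_natDegree h1.ne_zero, h2]
    exact_mod_cast hpp.pos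
  refine ⟨h1.add_of_left h3, ?_⟩
  rw [psiK, natDegree_add_eq_left_of_degree_lt h3, h2]

theorem minpoly_eq_psiK {N : AbsoluteValue (Qpbar p) ℝ} (hN : IsNonarchimedean N)
    (hNs : ∀ x, N x = spectralNorm ℚ_[p] (Qpbar p) x) (hp : Odd p) (d : ℕ) (hd : 0 < d)
    (u : Kur p d) (hu : N (u : Qpbar p) = 1) {θ : Qpbar p}
    (hθ : θ * (θ + u * p) ^ (p - 1) = -p) : minpoly (Kur p d) θ = psiK d u := by
  have hpp : p.Prime := Fact.out
  have hp0 : (p : Qpbar p) ≠ 0 := by exact_mod_cast hpp.ne_zero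
  have hlt : (p : ℝ)⁻¹ < 1 := inv_lt_one_of_one_lt₀ (by exact_mod_cast hpp.one_lt)
  have hpos : (0 : ℝ) < (p : ℝ)⁻¹ := by
    have : (0 : ℝ) < p := by exact_mod_cast hpp.pos
    positivity
  have hNp : N (p : Qpbar p) < 1 := by rw [abv_p hNs]; exact hlt
  obtain ⟨hm, hdeg⟩ := psiK_monic_natDegree d u
  have hroot : aeval θ (psiK d u) = 0 := by rw [psiK_aeval, hθ]; ring
  have hint : IsIntegral (Kur p d) θ := ⟨psiK d u, hm, hroot⟩
  have hdvd := minpoly.dvd (Kur p d) θ hroot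
  have hgm := minpoly.monic hint
  set g := minpoly (Kur p d) θ with hg
  refine (eq_of_monic_of_dvd_of_natDegree_le hgm hm hdvd ?_).symm
  rw [hdeg]
  have hspl : (g.map (algebraMap (Kur p d) (Qpbar p))).Splits := IsAlgClosed.splits _
  have hc := hspl.coeff_zero_eq_prod_roots_of_monic (hgm.map _)
  have hcard : Multiset.card (g.map (algebraMap (Kur p d) (Qpbar p))).roots = g.natDegree := by
    rw [← hspl.natDegree_eq_card_roots, natDegree_map]
  have hNr : ∀ r ∈ (g.map (algebraMap (Kur p d) (Qpbar p))).roots, N r ^ p = (p : ℝ)⁻¹ := by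
    intro r hr
    have h1 : aeval r g = 0 := by
      have := (mem_roots'.mp hr).2
      rwa [IsRoot.def, eval_map_algebraMap] at this
    have h2 : aeval r (psiK d u) = 0 := by
      obtain ⟨k, hk⟩ := hdvd
      rw [hk, map_mul, h1, zero_mul]
    rw [psiK_aeval] at h2
    rw [(abv_root N hN hpp hNp hu hp0 (eq_neg_of_add_eq_zero_left h2)).2.2.1, abv_p hNs]
  have hcN : N ((g.coeff 0 : Kur p d) : Qpbar p) ^ p = (p : ℝ)⁻¹ ^ g.natDegree := by
    have h1 : ((g.coeff 0 : Kur p d) : Qpbar p)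
        = (g.map (algebraMap (Kur p d) (Qpbar p))).coeff 0 := by rw [coeff_map]; rfl
    rw [h1, hc, N.map_mul, N.map_pow, N.map_neg, N.map_one, one_pow, one_mul, map_multiset_prod,
      ← Multiset.prod_map_pow, ← hcard]
    rw [Multiset.map_congr rfl (g := fun _ => (p : ℝ)⁻¹) (fun r hr => by
      simpa using hNr r hr)]
    simp
  have hc0 : ((g.coeff 0 : Kur p d) : Qpbar p) ≠ 0 := by
    intro h0
    rw [h0, N.map_zero, zero_pow hpp.ne_zero] at hcN
    exact (pow_pos hpos _).ne hcN
  obtain ⟨n, hn⟩ := Kur_value hN hNs hp d hd (g.coeff 0).2 hc0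
  rw [hn, ← zpow_natCast, ← zpow_natCast, ← zpow_mul] at hcN
  have h5 : n * p = g.natDegree := zpow_right_injective₀ hpos hlt.ne hcN
  have h6 : 0 < g.natDegree := minpoly.natDegree_pos hint
  have h7 : (p : ℤ) ∣ g.natDegree := ⟨n, by rw [← h5]; ring⟩
  exact Nat.le_of_dvd h6 (by exact_mod_cast h7)

theorem root_mem {N : AbsoluteValue (Qpbar p) ℝ} (hN : IsNonarchimedean N)
    (hNs : ∀ x, N x = spectralNorm ℚ_[p] (Qpbar p) x) (d : ℕ)
    (γ : Qpbar p) (hγ : γ ^ (p - 1) = -(p : Qpbar p))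
    (v : Qpbar p) (hvK : v ∈ Kur p d) (hNv : N v = 1)
    (u : Qpbar p) (huv : u * v ^ (p - 1) = 1) (huK : u ∈ Kur p d) (hu : N u = 1)
    (ω : Qpbar p) (hω : ω ^ p + u * p * ω = γ)
    (hθ : ω ^ (p - 1) * (ω ^ (p - 1) + u * p) ^ (p - 1) = -p)
    (θ' : Qpbar p) (hθ' : θ' * (θ' + u * p) ^ (p - 1) = -p) :
    θ' ∈ IntermediateField.adjoin (Kur p d) {ω ^ (p - 1)} := by
  have hpp : p.Prime := Fact.out
  have hp1 : 0 < p - 1 := by have := hpp.two_le; omega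
  have hp0 : (p : Qpbar p) ≠ 0 := by exact_mod_cast hpp.ne_zero
  have hlt : (p : ℝ)⁻¹ < 1 := inv_lt_one_of_one_lt₀ (by exact_mod_cast hpp.one_lt)
  have hNp : N (p : Qpbar p) < 1 := by rw [abv_p hNs]; exact hlt
  have hsucc : ∀ x : Qpbar p, x ^ p = x ^ (p - 1) * x := fun x => by
    rw [← pow_succ, Nat.sub_add_cancel hpp.one_le]
  have hγ0 : γ ≠ 0 := by
    rintro rfl
    rw [zero_pow hp1.ne'] at hγ
    exact hp0 (neg_eq_zero.mp hγ.symm)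
  have hω0 : ω ≠ 0 := by
    rintro rfl
    rw [zero_pow hpp.ne_zero] at hω
    exact hγ0 (by rw [← hω]; ring)
  have hv0 : v ≠ 0 := by
    rintro rfl
    simp at hNv
  have hu0 : u ≠ 0 := left_ne_zero_of_mul_eq_one huv
  obtain ⟨-, hNs', hNθp, hNθ1⟩ := abv_root N hN hpp hNp hu hp0 hθ
  obtain ⟨-, -, hNθp', -⟩ := abv_root N hN hpp hNp hu hp0 hθ'
  obtain ⟨θ, hθdef⟩ : ∃ θ, θ = ω ^ (p - 1) := ⟨_, rfl⟩
  rw [← hθdef] at hθ hNs' hNθp hNθ1 ⊢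
  have hθ0 : θ ≠ 0 := by rw [hθdef]; exact pow_ne_zero _ hω0
  obtain ⟨z, hz⟩ := IsAlgClosed.exists_pow_nat_eq θ' hp1
  obtain ⟨ω', hω'1, hω'2⟩ : ∃ ω' : Qpbar p, ω' ^ (p - 1) = θ' ∧ ω' ^ p + u * p * ω' = γ := by
    have h1 : (z * (θ' + u * p)) ^ (p - 1) = γ ^ (p - 1) := by
      rw [mul_pow, hz, hθ', hγ]
    have hf0 : z * (θ' + u * p) ≠ 0 := by
      intro h
      rw [h, zero_pow hp1.ne'] at h1
      exact pow_ne_zero _ hγ0 h1.symm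
    refine ⟨z * (γ / (z * (θ' + u * p))), ?_, ?_⟩
    · rw [mul_pow, div_pow, h1, div_self (pow_ne_zero _ hγ0), mul_one, hz]
    · rw [hsucc, mul_pow, div_pow, h1, div_self (pow_ne_zero _ hγ0), mul_one, hz]
      have hz0 := left_ne_zero_of_mul hf0
      have hs0 := right_ne_zero_of_mul hf0
      field_simp
  obtain ⟨e, he⟩ : ∃ e, e = ω' / ω - 1 := ⟨_, rfl⟩
  have he1 : 1 + e = ω' / ω := by rw [he]; ring
  have hθ'e : θ' = θ * (1 + e) ^ (p - 1) := by
    rw [he1, div_pow, hθdef, hω'1, mul_div_cancel₀ _ (pow_ne_zero _ hω0)]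
  have heq : θ * ((1 + e) ^ p - 1) + u * p * e = 0 := by
    have h1 : θ * (1 + e) ^ p = ω' ^ p / ω := by
      rw [hsucc, ← mul_assoc, ← hθ'e, he1, hsucc ω', hω'1, mul_div_assoc]
    have h2 : θ = ω ^ p / ω := by rw [hsucc, hθdef, mul_div_cancel_right₀ _ hω0]
    rw [mul_sub, h1, mul_one, h2, he]
    field_simp
    linear_combination hω'2 - hω
  have hNeq : N θ' = N θ :=
    (pow_left_inj₀ (N.nonneg _) (N.nonneg _) hpp.ne_zero).mp (hNθp'.trans hNθp.symm)
  have hNe : N e ≤ 1 := by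
    have h1 : N (1 + e) ^ (p - 1) = 1 := by
      have := congrArg N hθ'e
      rw [N.map_mul, hNeq, N.map_pow] at this
      exact (mul_right_eq_self₀.mp this.symm).resolve_right (N.pos hθ0).ne'
    have h2 : N (1 + e) = 1 := (pow_eq_one_iff_of_nonneg (N.nonneg _) hp1.ne').mp h1
    have h3 : e = (1 + e) + (-1) := by ring
    rw [h3]
    refine (hN _ _).trans (max_le h2.le ?_)
    simp
  suffices hmem : e ∈ IntermediateField.adjoin (Kur p d) {θ} by
    have hθm : θ ∈ IntermediateField.adjoin (Kur p d) {θ} := mem_adjoin_simple_self _ _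
    rw [hθ'e]
    exact mul_mem hθm (pow_mem (add_mem (one_mem _) hmem) _)
  rw [← InfiniteGalois.fixedField_fixingSubgroup (IntermediateField.adjoin (Kur p d) {θ}),
    mem_fixedField_iff]
  intro σ hσ
  have hσθ : σ θ = θ := by
    rw [IntermediateField.mem_fixingSubgroup_iff] at hσ
    exact hσ θ (mem_adjoin_simple_self _ _)
  have hσK : ∀ x ∈ Kur p d, σ x = x := fun x hx => σ.commutes ⟨x, hx⟩
  have hσp : σ (p : Qpbar p) = p := map_natCast σ p
  have hσN : ∀ x, N (σ x) = N x := by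
    intro x
    rw [hNs, hNs]
    exact (spectralNorm_eq_of_equiv (σ.restrictScalars ℚ_[p]) x).symm
  by_cases he0 : e = 0
  · rw [he0, map_zero]
  have heσ : θ * ((1 + σ e) ^ p - 1) + u * p * σ e = 0 := by
    have := congrArg σ heq
    simpa [hσθ, hσK u huK] using this
  refine abv_sep N hN hpp hu hNθ1 hp0 hNθp hNe heq heσ ?_
  obtain ⟨s, hs⟩ : ∃ s, s = θ + u * p := ⟨_, rfl⟩
  rw [← hs] at hNs' hθ
  have hs0 : s ≠ 0 := by
    rintro rfl
    rw [N.map_zero] at hNs'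
    exact (N.pos hθ0).ne hNs'
  have hσs : σ s = s := by rw [hs, map_add, map_mul, hσθ, hσK u huK, hσp]
  obtain ⟨y, hy⟩ : ∃ y, y = e * v / s := ⟨_, rfl⟩
  have hey : e = s / v * y := by rw [hy]; field_simp
  obtain ⟨r, hr, hpow⟩ := abv_add_pow N hN hpp (a := 1) (b := e) (by simp) hNe
  have h1 : e * (θ * e ^ (p - 1) + p * θ * r + u * p) = 0 := by
    rw [hpow, hsucc e] at heq
    linear_combination heq + θ * (one_pow (M := Qpbar p) p).symm
  have h2 := (mul_eq_zero.mp h1).resolve_left he0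
  have h3 : e ^ (p - 1) = u * s ^ (p - 1) * y ^ (p - 1) := by
    rw [hey, mul_pow, div_pow, eq_inv_of_mul_eq_one_left huv]
    ring
  have h4 : (p : Qpbar p) * (u * (y ^ (p - 1) - 1) - θ * r) = 0 := by
    rw [h3] at h2
    linear_combination -h2 + u * y ^ (p - 1) * hθ
  have h5 := sub_eq_zero.mp ((mul_eq_zero.mp h4).resolve_left hp0)
  have h6 : N (y ^ (p - 1) - 1) < 1 := by
    have := congrArg N h5
    rw [N.map_mul, hu, one_mul, N.map_mul] at this
    rw [this]
    exact lt_of_le_of_lt (mul_le_of_le_one_right (N.nonneg _) hr) hNθ1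
  have h7 : N y ≤ 1 := by
    have : N (y ^ (p - 1)) ≤ 1 := by
      have h8 : y ^ (p - 1) = (y ^ (p - 1) - 1) + 1 := by ring
      rw [h8]
      exact (hN _ _).trans (max_le h6.le (by simp))
    rw [N.map_pow] at this
    exact (pow_le_one_iff_of_nonneg (N.nonneg _) hp1.ne').mp this
  have h8 : N (y ^ p - y) < 1 := by
    have : y ^ p - y = (y ^ (p - 1) - 1) * y := by rw [hsucc]; ring
    rw [this, N.map_mul]
    exact lt_of_le_of_lt (mul_le_of_le_one_right (N.nonneg _) h7) h6
  obtain ⟨a, ha⟩ := abv_near_nat N hN p hNp h7 h8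
  have h9 : N (σ y - a) < 1 := by
    have : σ y - a = σ (y - a) := by simp
    rw [this, hσN]; exact ha
  have h10 : N (σ y - y) < 1 := by
    have : σ y - y = (σ y - a) + -(y - a) := by ring
    rw [this]
    exact abv_add_lt N hN h9 (by rw [N.map_neg]; exact ha)
  have h11 : σ e - e = s / v * (σ y - y) := by
    rw [hey, map_mul, map_div₀, hσs, hσK v hvK]; ring
  rw [h11, N.map_mul, map_div₀, hNv, div_one, hNs']
  exact mul_lt_of_lt_one_right (N.pos hθ0) h10

end Main

/-- let `v ∈ μ_{q-1}` and `u = v^{1-p}`.  Then `ψ_u(X) = X (X + u p)^{p-1} + p`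
is the minimal polynomial of `ω_u^{p-1}` over `K`; `K(ω_u^{p-1})` is the splitting field of
`ψ_u` over `K`, i.e. `M_u = K(ω_u^{p-1})`; `[M_u : K] = p`; and `M_u` is the unique
intermediate field of `L_u/K` of degree `p` over `K` (where `L_u = K(ω_u)`). -/
theorem statement2 (hp : Odd p) (d : ℕ) (hd : 0 < d)
    (abv : AbsoluteValue (Qpbar p) ℝ)
    (habv : ∀ x : ℚ_[p], abv (algebraMap ℚ_[p] (Qpbar p) x) = ‖x‖)
    (γ : Qpbar p) (hγ : γ ^ (p - 1) = -(p : Qpbar p))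
    (v : Qpbar p) (hv : v ^ (p ^ d - 1) = 1)
    (u : Qpbar p) (hu : u = v ^ ((1 : ℤ) - (p : ℤ))) (huK : u ∈ Kur p d)
    (ω : Qpbar p) (hω : ω ^ p + u * p * ω = γ) :
    (minpoly (Kur p d) (ω ^ (p - 1)) =
      X * (X + C ((⟨u, huK⟩ : Kur p d) * (p : Kur p d))) ^ (p - 1) + C (p : Kur p d)) ∧
    (Mfield p d u = IntermediateField.adjoin (Kur p d) {ω ^ (p - 1)}) ∧
    (Module.finrank (Kur p d) (Mfield p d u) = p) ∧
    (Mfield p d u ≤ IntermediateField.adjoin (Kur p d) {ω}) ∧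
    (∀ F : IntermediateField (Kur p d) (Qpbar p),
      F ≤ IntermediateField.adjoin (Kur p d) {ω} → Module.finrank (Kur p d) F = p →
        F = Mfield p d u) := by
  have hpp : p.Prime := Fact.out
  have hp1 : 0 < p - 1 := by have := hpp.two_le; omega
  have hq0 : p ^ d - 1 ≠ 0 := by
    have := Nat.one_lt_pow hd.ne' hpp.one_lt
    omega
  obtain ⟨N, hN, hNs⟩ := exists_spectralAbv p
  have hNv : N v = 1 := by
    have h1 : N v ^ (p ^ d - 1) = 1 := by rw [← N.map_pow, hv, N.map_one]
    exact (pow_eq_one_iff_of_nonneg (N.nonneg _) hq0).mp h1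
  have hv0 : v ≠ 0 := by
    rintro rfl
    simp at hNv
  have hvK : v ∈ Kur p d := IntermediateField.subset_adjoin _ _ hv
  have huv : u * v ^ (p - 1) = 1 := by
    rw [hu, ← zpow_natCast, ← zpow_add₀ hv0, Nat.cast_sub hpp.one_le]
    simp
  have hNu : N u = 1 := by
    have := congrArg N huv
    rwa [N.map_mul, N.map_pow, hNv, one_pow, mul_one, N.map_one] at this
  have hθ : ω ^ (p - 1) * (ω ^ (p - 1) + u * p) ^ (p - 1) = -p := by
    have h1 : ω * (ω ^ (p - 1) + u * p) = γ := by
      rw [← hω]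
      have h2 : ω ^ p = ω ^ (p - 1) * ω := by
        rw [← pow_succ, Nat.sub_add_cancel hpp.one_le]
      rw [h2]
      ring
    rw [← mul_pow, h1, hγ]
  have hmin : minpoly (Kur p d) (ω ^ (p - 1)) = psiK d ⟨u, huK⟩ :=
    minpoly_eq_psiK hN hNs hp d hd ⟨u, huK⟩ hNu hθ
  obtain ⟨hmon, hdeg⟩ := psiK_monic_natDegree d (⟨u, huK⟩ : Kur p d)
  have hiff : ∀ x : Qpbar p, (psiPoly p u).IsRoot x ↔ x * (x + u * p) ^ (p - 1) = -p := by
    intro x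
    rw [eq_neg_iff_add_eq_zero]
    simp [psiPoly]
  have hM : Mfield p d u = IntermediateField.adjoin (Kur p d) {ω ^ (p - 1)} := by
    apply le_antisymm
    · rw [Mfield, IntermediateField.adjoin_le_iff]
      intro x hx
      exact root_mem hN hNs d γ hγ v hvK hNv u huv huK hNu ω hω hθ x ((hiff x).mp hx)
    · rw [IntermediateField.adjoin_simple_le_iff]
      exact IntermediateField.subset_adjoin _ _ ((hiff _).mpr hθ)
  have hint : IsIntegral (Kur p d) (ω ^ (p - 1)) :=
    (Algebra.IsAlgebraic.isAlgebraic (ω ^ (p - 1))).isIntegral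
  have hintω : IsIntegral (Kur p d) ω := (Algebra.IsAlgebraic.isAlgebraic ω).isIntegral
  have hfin : Module.finrank (Kur p d) (Mfield p d u) = p := by
    rw [hM, IntermediateField.adjoin.finrank hint, hmin, hdeg]
  have hle : Mfield p d u ≤ IntermediateField.adjoin (Kur p d) {ω} := by
    rw [hM, IntermediateField.adjoin_simple_le_iff]
    exact pow_mem (mem_adjoin_simple_self _ _) _
  refine ⟨hmin, hM, hfin, hle, ?_⟩
  intro F hF hFp
  have hLfin : FiniteDimensional (Kur p d) (IntermediateField.adjoin (Kur p d) {ω}) :=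
    IntermediateField.adjoin.finiteDimensional hintω
  have hMfd : FiniteDimensional (Kur p d) (Mfield p d u) :=
    Module.finite_of_finrank_pos (by rw [hfin]; exact hpp.pos)
  have hFfd : FiniteDimensional (Kur p d) F :=
    Module.finite_of_finrank_pos (by rw [hFp]; exact hpp.pos)
  have hLdeg : Module.finrank (Kur p d) (IntermediateField.adjoin (Kur p d) {ω})
      ≤ p * (p - 1) := by
    rw [IntermediateField.adjoin.finrank hintω]
    have h1 : ((psiK d ⟨u, huK⟩).comp (X ^ (p - 1))).natDegree = p * (p - 1) := by
      rw [natDegree_comp, hdeg, natDegree_X_pow]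
    have h2 : (psiK d ⟨u, huK⟩).comp (X ^ (p - 1)) ≠ 0 := by
      intro h0
      rw [h0, natDegree_zero] at h1
      exact (Nat.mul_pos hpp.pos hp1).ne h1
    have h3 : aeval ω ((psiK d ⟨u, huK⟩).comp (X ^ (p - 1))) = 0 := by
      rw [aeval_comp, map_pow, aeval_X, ← hmin, minpoly.aeval]
    rw [← h1]
    exact natDegree_le_of_dvd (minpoly.dvd _ _ h3) h2
  have hnormal : Normal (Kur p d) (Mfield p d u) := by
    have hset : {x : Qpbar p | (psiPoly p u).IsRoot x}
        = (psiK d (⟨u, huK⟩ : Kur p d)).rootSet (Qpbar p) := by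
      ext x
      rw [mem_rootSet, psiK_aeval, ← eq_neg_iff_add_eq_zero]
      exact ⟨fun h => ⟨hmon.ne_zero, (hiff x).mp h⟩, fun h => (hiff x).mpr h.2⟩
    rw [Mfield, hset]
    have := IntermediateField.adjoin_rootSet_isSplittingField
      (K := Kur p d) (L := Qpbar p) (p := psiK d ⟨u, huK⟩) (IsAlgClosed.splits _)
    exact Normal.of_isSplittingField (psiK d ⟨u, huK⟩)
  have hgal : IsGalois (Kur p d) (Mfield p d u) := ⟨⟩
  have hdvd : Module.finrank (Kur p d) (Mfield p d u ⊓ F : IntermediateField _ _) ∣ p := by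
    conv_rhs => rw [← hFp]
    exact IntermediateField.finrank_dvd_of_le_right inf_le_right
  rcases (Nat.dvd_prime hpp).mp hdvd with h1 | h1
  · rw [IntermediateField.finrank_eq_one_iff] at h1
    have h2 := (IntermediateField.LinearDisjoint.of_inf_eq_bot h1).finrank_sup
    have h3 : Module.finrank (Kur p d) (Mfield p d u ⊔ F : IntermediateField _ _) ≤
        Module.finrank (Kur p d) (IntermediateField.adjoin (Kur p d) {ω}) :=
      IntermediateField.finrank_le_of_le_right (sup_le hle hF)
    rw [h2, hfin, hFp] at h3
    have h4 := Nat.le_of_mul_le_mul_left (h3.trans hLdeg) hpp.pos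
    omega
  · have h2 : Mfield p d u ⊓ F = F :=
      IntermediateField.eq_of_le_of_finrank_eq inf_le_right (h1.trans hFp.symm)
    have h3 : Mfield p d u ⊓ F = Mfield p d u :=
      IntermediateField.eq_of_le_of_finrank_eq inf_le_left (h1.trans hfin.symm)
    exact h2.symm.trans h3
end

section
/- Let v ∈ μ_{q−1}. Then the norm group of M_{v^{1−p}}/K is N(M_{v^{1−p}}/K) = {p^m · ζ · exp(p·v^{−p}·z) : m ∈ ℤ, ζ ∈ μ_{q−1}, z ∈ Z}; in other words, N(M_{v^{1−p}}/K) is the internal direct product ⟨p⟩ × μ_{q−1} × exp(p·v^{−p}·Z) inside K^×. -/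
open Polynomial Filter IntermediateField

variable (p : ℕ) [Fact p.Prime]

/-- `IsExpOf p abv y w`: `w` is the value of the `p`-adic exponential series at `y`,
i.e. the partial sums of `∑ yⁿ/n!` converge to `w` w.r.t. the absolute value `abv`. -/
def IsExpOf (abv : AbsoluteValue (Qpbar p) ℝ) (y w : Qpbar p) : Prop :=
  Tendsto (fun N => abv (w - ∑ n ∈ Finset.range N, y ^ n / (Nat.factorial n : Qpbar p)))
    atTop (nhds 0)


namespace S4

lemma abv_eq (abv : AbsoluteValue (Qpbar p) ℝ)
    (habv : ∀ x : ℚ_[p], abv (algebraMap ℚ_[p] (Qpbar p) x) = ‖x‖) (x : Qpbar p) :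
    abv x = ‖x‖ :=
  spectralNorm_unique_field_norm_ext habv x

variable {p}

lemma hp1 : 1 < (p : ℝ) := by exact_mod_cast (Fact.out : p.Prime).one_lt
lemma hp0 : 0 < (p : ℝ) := by exact_mod_cast (Fact.out : p.Prime).pos
lemma hpi1 : (p : ℝ)⁻¹ < 1 := inv_lt_one_of_one_lt₀ hp1
lemma hpi0 : 0 < (p : ℝ)⁻¹ := inv_pos.2 hp0

lemma norm_ext (x : ℚ_[p]) : ‖algebraMap ℚ_[p] (Qpbar p) x‖ = ‖x‖ := PadicAlgCl.norm_extends p x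

lemma norm_p : ‖(p : Qpbar p)‖ = (p : ℝ)⁻¹ := by
  have := norm_ext (p := p) (p : ℚ_[p])
  simpa using this

lemma p_ne : (p : Qpbar p) ≠ 0 := by
  intro h
  have := norm_p (p := p)
  rw [h, norm_zero] at this
  exact hpi0.ne this

lemma add_le {a b : Qpbar p} {r : ℝ} (ha : ‖a‖ ≤ r) (hb : ‖b‖ ≤ r) : ‖a + b‖ ≤ r :=
  (IsUltrametricDist.norm_add_le_max a b).trans (max_le ha hb)

lemma sub_le {a b : Qpbar p} {r : ℝ} (ha : ‖a‖ ≤ r) (hb : ‖b‖ ≤ r) : ‖a - b‖ ≤ r := by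
  rw [sub_eq_add_neg]; exact add_le ha (by rwa [norm_neg])

lemma add_lt {a b : Qpbar p} {r : ℝ} (ha : ‖a‖ < r) (hb : ‖b‖ < r) : ‖a + b‖ < r :=
  (IsUltrametricDist.norm_add_le_max a b).trans_lt (max_lt ha hb)

lemma sub_lt {a b : Qpbar p} {r : ℝ} (ha : ‖a‖ < r) (hb : ‖b‖ < r) : ‖a - b‖ < r := by
  rw [sub_eq_add_neg]; exact add_lt ha (by rwa [norm_neg])

lemma add_eq {a b : Qpbar p} (h : ‖b‖ < ‖a‖) : ‖a + b‖ = ‖a‖ := by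
  rw [IsUltrametricDist.norm_add_eq_max_of_norm_ne_norm h.ne', max_eq_left h.le]

lemma nat_le (n : ℕ) : ‖(n : Qpbar p)‖ ≤ 1 := by
  have := norm_ext (p := p) (n : ℚ_[p])
  rw [map_natCast] at this
  rw [this]; simpa using Padic.norm_int_le_one (p := p) (n : ℤ)

lemma nat_eq_one {n : ℕ} (h : ¬ p ∣ n) : ‖(n : Qpbar p)‖ = 1 := by
  have := norm_ext (p := p) (n : ℚ_[p])
  rw [map_natCast] at this
  rw [this]
  refine le_antisymm (by simpa using Padic.norm_int_le_one (p := p) (n : ℤ)) ?_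
  by_contra hh
  push Not at hh
  have := (Padic.norm_natCast_lt_one_iff (p := p) (n := n)).1 hh
  exact h this

lemma norm_root_one {N : ℕ} (hN : N ≠ 0) {a : Qpbar p} (ha : a ^ N = 1) : ‖a‖ = 1 := by
  have : ‖a‖ ^ N = 1 := by rw [← norm_pow, ha, norm_one]
  exact (pow_eq_one_iff_of_nonneg (norm_nonneg _) hN).1 this

lemma norm_eq_of_minpoly {x y : Qpbar p} (h : minpoly ℚ_[p] x = minpoly ℚ_[p] y) : ‖x‖ = ‖y‖ := by
  rw [← PadicAlgCl.spectralNorm_eq, ← PadicAlgCl.spectralNorm_eq, spectralNorm, spectralNorm, h]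

/-- distinct roots of unity of order prime to `p` are far apart -/
lemma root_sub {N : ℕ} (hN : ¬ p ∣ N) {a b : Qpbar p} (ha : a ^ N = 1) (hb : b ^ N = 1)
    (hab : a ≠ b) : ‖a - b‖ = 1 := by
  have hN0 : N ≠ 0 := by rintro rfl; simp at hN
  have na := norm_root_one hN0 ha
  have nb := norm_root_one hN0 hb
  refine le_antisymm (sub_le na.le nb.le) ?_
  by_contra hlt
  push Not at hlt
  have hb0 : b ≠ 0 := by rintro rfl; simp at nb
  set w := a / b with hw
  have hw1 : w ^ N = 1 := by rw [hw, div_pow, ha, hb, div_one]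
  have hwne : w - 1 ≠ 0 := by
    rw [sub_ne_zero, hw, Ne, div_eq_one_iff_eq hb0]; exact hab
  have hwn : ‖w - 1‖ < 1 := by
    have : w - 1 = (a - b) / b := by rw [hw, sub_div, div_self hb0]
    rw [this, norm_div, nb, div_one]; exact hlt
  have hs : ∑ i ∈ Finset.range N, w ^ i = 0 := by
    have := geom_sum_mul w N
    rw [hw1, sub_self] at this
    exact (mul_eq_zero.1 this).resolve_right hwne
  have hnw : ‖w‖ = 1 := norm_root_one hN0 hw1
  have h2 : ‖∑ i ∈ Finset.range N, (w ^ i - 1)‖ ≤ ‖w - 1‖ := by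
    apply IsUltrametricDist.norm_sum_le_of_forall_le_of_nonneg (norm_nonneg _)
    intro i _
    rw [← mul_geom_sum, norm_mul]
    apply mul_le_of_le_one_right (norm_nonneg _)
    apply IsUltrametricDist.norm_sum_le_of_forall_le_of_nonneg zero_le_one
    intro j _
    rw [norm_pow, hnw, one_pow]
  rw [Finset.sum_sub_distrib, hs] at h2
  simp only [Finset.sum_const, Finset.card_range, nsmul_eq_mul, mul_one, zero_sub, norm_neg] at h2
  rw [nat_eq_one hN] at h2
  linarith

lemma q_ndvd {d : ℕ} (hd : 0 < d) : ¬ p ∣ p ^ d - 1 := by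
  have hp := (Fact.out : p.Prime)
  intro h
  have h1 : p ∣ p ^ d := dvd_pow_self p hd.ne'
  have h2 : 1 ≤ p ^ d := Nat.one_le_pow _ _ hp.pos
  have := (Nat.dvd_sub_iff_right h2 h1).1 h
  exact hp.one_lt.ne' (Nat.dvd_one.1 this)

lemma q_pos {d : ℕ} (hd : 0 < d) : p ^ d - 1 ≠ 0 := by
  intro h; have := q_ndvd (p := p) hd; rw [h] at this; simp at this

lemma exists_lt_of_prod {ι : Type*} {s : Multiset ι} {f : ι → Qpbar p} {r : ℝ} (hr : 0 ≤ r)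
    (h : ‖(s.map f).prod‖ < r ^ (Multiset.card s)) : ∃ i ∈ s, ‖f i‖ < r := by
  by_contra hcon
  push Not at hcon
  revert h
  rw [imp_false, not_lt]
  induction s using Multiset.induction_on with
  | empty => simp
  | cons a s ih =>
    simp only [Multiset.card_cons, Multiset.map_cons, Multiset.prod_cons, norm_mul]
    rw [pow_succ']
    apply mul_le_mul (hcon a (by simp)) (ih fun i hi => hcon i (by simp [hi])) (by positivity)
      (norm_nonneg _)

/-- the ring `ℤ_p[μ_{q-1}]` -/
noncomputable def A (p : ℕ) [Fact p.Prime] (d : ℕ) : Subalgebra ℤ_[p] (Qpbar p) :=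
  Algebra.adjoin ℤ_[p] {x : Qpbar p | x ^ (p ^ d - 1) = 1}

variable {d : ℕ}

lemma A_p : (p : Qpbar p) ∈ A p d := by
  have := (A p d).algebraMap_mem (p : ℤ_[p])
  simpa using this

lemma A_pow (hd : 0 < d) {a : Qpbar p} (ha : a ∈ A p d) :
    ∃ b ∈ A p d, a ^ (p ^ d) = a + p * b := by
  have hpp := (Fact.out : p.Prime)
  induction ha using Algebra.adjoin_induction with
  | mem x hx =>
    refine ⟨0, zero_mem _, ?_⟩
    have : p ^ d = (p ^ d - 1) + 1 := (Nat.sub_add_cancel (Nat.one_le_pow _ _ hpp.pos)).symm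
    rw [this, pow_succ, hx]; simp
  | algebraMap r =>
    have h : ∃ b : ℤ_[p], r ^ (p ^ d) - r = p * b := by
      have : (PadicInt.toZMod (p := p)) (r ^ (p ^ d) - r) = 0 := by
        rw [map_sub, map_pow, ZMod.pow_card_pow, sub_self]
      rw [← RingHom.mem_ker, PadicInt.ker_toZMod, PadicInt.maximalIdeal_eq_span_p,
        Ideal.mem_span_singleton] at this
      exact this
    obtain ⟨b, hb⟩ := h
    refine ⟨algebraMap _ _ b, Subalgebra.algebraMap_mem _ _, ?_⟩
    rw [← map_pow, sub_eq_iff_eq_add.1 hb]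
    simp [add_comm]
  | add x y hx hy ihx ihy =>
    obtain ⟨b, hb, hb'⟩ := ihx
    obtain ⟨c, hc, hc'⟩ := ihy
    obtain ⟨r, hr⟩ := exists_add_pow_prime_pow_eq hpp (⟨x, hx⟩ : A p d) ⟨y, hy⟩ d
    have hr' := congrArg (Subtype.val) hr
    push_cast at hr'
    refine ⟨b + c + x * y * r, add_mem (add_mem hb hc) (mul_mem (mul_mem hx hy) r.2), ?_⟩
    rw [hr', hb', hc']; ring
  | mul x y hx hy ihx ihy =>
    obtain ⟨b, hb, hb'⟩ := ihx
    obtain ⟨c, hc, hc'⟩ := ihy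
    refine ⟨x * c + b * y + p * b * c, ?_, ?_⟩
    · exact add_mem (add_mem (mul_mem hx hc) (mul_mem hb hy)) (mul_mem (mul_mem A_p hb) hc)
    · rw [mul_pow, hb', hc']; ring

lemma A_pow_pow (hd : 0 < d) {a : Qpbar p} (ha : a ∈ A p d) (k : ℕ) :
    ∃ b ∈ A p d, a = a ^ ((p ^ d) ^ k) + p * b := by
  induction k with
  | zero => exact ⟨0, zero_mem _, by simp⟩
  | succ k ih =>
    obtain ⟨b, hb, hb'⟩ := ih
    obtain ⟨c, hc, hc'⟩ := A_pow hd (pow_mem ha ((p ^ d) ^ k))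
    refine ⟨b - c, sub_mem hb hc, ?_⟩
    rw [pow_succ (p ^ d) k, pow_mul, hc']
    rw [mul_sub, add_assoc, add_sub_cancel, ← hb']

lemma coeff_small {c : Qpbar p} (h1 : ‖c‖ < 1) {i : ℕ} (hi : i < (minpoly ℚ_[p] c).natDegree) :
    ‖(minpoly ℚ_[p] c).coeff i‖ < 1 := by
  rw [← PadicAlgCl.spectralNorm_eq, spectralNorm] at h1
  have := (le_ciSup (spectralValueTerms_bddAbove (minpoly ℚ_[p] c)) i).trans_lt h1
  rw [spectralValueTerms_of_lt_natDegree _ hi] at this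
  by_contra hcon
  push Not at hcon
  have h2 : (1 : ℝ) ≤ ‖(minpoly ℚ_[p] c).coeff i‖ ^
      (1 / ((minpoly ℚ_[p] c).natDegree - i : ℝ)) := by
    apply Real.one_le_rpow hcon
    have : (i : ℝ) < (minpoly ℚ_[p] c).natDegree := by exact_mod_cast hi
    apply one_div_nonneg.2; linarith
  linarith

lemma padic_div {x : ℚ_[p]} (h : ‖x‖ < 1) : ∃ b : ℤ_[p], x = p * (b : ℚ_[p]) := by
  obtain ⟨y, rfl⟩ : ∃ y : ℤ_[p], (y : ℚ_[p]) = x := ⟨⟨x, h.le⟩, rfl⟩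
  obtain ⟨b, hb⟩ := (PadicInt.norm_lt_one_iff_dvd y).1 h
  exact ⟨b, by rw [hb]; push_cast; rfl⟩

lemma A_small (hd : 0 < d) {c : Qpbar p} (hc : c ∈ A p d) (h1 : ‖c‖ < 1) :
    ∃ b ∈ A p d, c = p * b := by
  have hpp := (Fact.out : p.Prime)
  set f := minpoly ℚ_[p] c with hf
  have hintg : IsIntegral ℚ_[p] c := Algebra.IsIntegral.isIntegral c
  have hmon : f.Monic := minpoly.monic hintg
  set n := f.natDegree with hn
  have h0 : c ^ n + ∑ i ∈ Finset.range n, algebraMap _ _ (f.coeff i) * c ^ i = 0 := by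
    have := minpoly.aeval ℚ_[p] c
    rw [← hf, aeval_eq_sum_range, Finset.sum_range_succ, ← hn, hmon.coeff_natDegree, one_smul,
      add_comm] at this
    simpa [Algebra.smul_def] using this
  have h2 : ∃ b ∈ A p d, c ^ n = p * b := by
    have h3 : ∀ i ∈ Finset.range n, ∃ g : ℤ_[p], f.coeff i = p * (g : ℚ_[p]) := fun i hi =>
      padic_div (coeff_small h1 (Finset.mem_range.1 hi))
    choose! g hg using h3
    refine ⟨-∑ i ∈ Finset.range n, algebraMap ℤ_[p] _ (g i) * c ^ i, ?_, ?_⟩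
    · exact neg_mem (sum_mem fun i _ => mul_mem (Subalgebra.algebraMap_mem _ _) (pow_mem hc _))
    · rw [eq_neg_of_add_eq_zero_left h0, mul_neg, Finset.mul_sum]
      congr 1
      apply Finset.sum_congr rfl
      intro i hi
      rw [hg i hi, map_mul, map_natCast, mul_assoc]
      rfl
  obtain ⟨b, hb, hb'⟩ := h2
  obtain ⟨e, he, he'⟩ := A_pow_pow hd hc n
  have hle : n ≤ (p ^ d) ^ n := (Nat.lt_pow_self (Nat.one_lt_pow hd.ne' hpp.one_lt)).le
  refine ⟨b * c ^ ((p ^ d) ^ n - n) + e, add_mem (mul_mem hb (pow_mem hc _)) he, ?_⟩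
  rw [he'] 
  nth_rewrite 1 [← Nat.add_sub_cancel' hle]
  rw [pow_add, hb', ← he']; ring

lemma Kur_A {x : Qpbar p} (hx : x ∈ Kur p d) : ∃ N : ℕ, (p : Qpbar p) ^ N * x ∈ A p d := by
  have hx' : x ∈ Algebra.adjoin ℚ_[p] {x : Qpbar p | x ^ (p ^ d - 1) = 1} := by
    rw [← IntermediateField.adjoin_toSubalgebra]
    exact hx
  clear hx
  induction hx' using Algebra.adjoin_induction with
  | mem x hx => exact ⟨0, by rw [pow_zero, one_mul]; exact Algebra.subset_adjoin hx⟩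
  | algebraMap r =>
    obtain ⟨N, hN⟩ : ∃ N : ℕ, ‖(p : ℚ_[p]) ^ N * r‖ ≤ 1 := by
      obtain ⟨N, hN⟩ := pow_unbounded_of_one_lt ‖r‖ (hp1 (p := p))
      refine ⟨N, ?_⟩
      rw [norm_mul, norm_pow, Padic.norm_p, inv_pow, inv_mul_le_iff₀ (pow_pos hp0 _), mul_one]
      exact hN.le
    refine ⟨N, ?_⟩
    have := (A p d).algebraMap_mem ⟨_, hN⟩
    have h2 : algebraMap ℤ_[p] (Qpbar p) ⟨_, hN⟩ = algebraMap ℚ_[p] (Qpbar p) ((p : ℚ_[p]) ^ N * r) := rfl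
    rw [h2] at this
    simpa using this
  | add x y hx hy ihx ihy =>
    obtain ⟨N, hN⟩ := ihx
    obtain ⟨M, hM⟩ := ihy
    refine ⟨N + M, ?_⟩
    have : (p : Qpbar p) ^ (N + M) * (x + y) = p ^ M * (p ^ N * x) + p ^ N * (p ^ M * y) := by ring
    rw [this]
    exact add_mem (mul_mem (pow_mem A_p _) hN) (mul_mem (pow_mem A_p _) hM)
  | mul x y hx hy ihx ihy =>
    obtain ⟨N, hN⟩ := ihx
    obtain ⟨M, hM⟩ := ihy
    refine ⟨N + M, ?_⟩
    have : (p : Qpbar p) ^ (N + M) * (x * y) = (p ^ N * x) * (p ^ M * y) := by ring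
    rw [this]
    exact mul_mem hN hM

lemma mem_A (hd : 0 < d) {x : Qpbar p} (hx : x ∈ Kur p d) (h1 : ‖x‖ ≤ 1) : x ∈ A p d := by
  obtain ⟨N, hN⟩ := Kur_A hx
  induction N with
  | zero => simpa using hN
  | succ N ih =>
    apply ih
    have hlt : ‖(p : Qpbar p) ^ (N + 1) * x‖ < 1 := by
      rw [norm_mul, norm_pow, norm_p]
      calc _ ≤ (p : ℝ)⁻¹ ^ (N + 1) := mul_le_of_le_one_right (by have := hpi0 (p := p); positivity) h1
        _ < 1 := pow_lt_one₀ hpi0.le hpi1 (by simp)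
    obtain ⟨b, hb, hb'⟩ := A_small hd hN hlt
    have : (p : Qpbar p) ^ N * x = b := by
      apply mul_left_cancel₀ p_ne (b := (p : Qpbar p) ^ N * x)
      rw [← hb']; ring
    rwa [this]

lemma A_le {x : Qpbar p} (hd : 0 < d) (hx : x ∈ A p d) : ‖x‖ ≤ 1 := by
  induction hx using Algebra.adjoin_induction with
  | mem x hx => exact (norm_root_one (q_pos hd) hx).le
  | algebraMap r =>
    have : algebraMap ℤ_[p] (Qpbar p) r = algebraMap ℚ_[p] (Qpbar p) r := rfl
    rw [this, norm_ext]; exact r.2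
  | add x y hx hy ihx ihy => exact add_le ihx ihy
  | mul x y hx hy ihx ihy => rw [norm_mul]; exact mul_le_one₀ ihx (norm_nonneg _) ihy

lemma K_small (hd : 0 < d) {x : Qpbar p} (hx : x ∈ Kur p d) (h1 : ‖x‖ < 1) : ‖x‖ ≤ (p : ℝ)⁻¹ := by
  obtain ⟨b, hb, rfl⟩ := A_small hd (mem_A hd hx h1.le) h1
  rw [norm_mul, norm_p]
  exact mul_le_of_le_one_right hpi0.le (A_le hd hb)

lemma q_eq {a : Qpbar p} : a ^ (p ^ d) = a ↔ a = 0 ∨ a ^ (p ^ d - 1) = 1 := by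
  have hpp := (Fact.out : p.Prime)
  have : p ^ d = (p ^ d - 1) + 1 := (Nat.sub_add_cancel (Nat.one_le_pow _ _ hpp.pos)).symm
  rw [this, pow_succ, Nat.add_sub_cancel]
  constructor
  · intro h
    by_cases ha : a = 0
    · exact Or.inl ha
    · right; exact mul_right_cancel₀ ha (by rw [h, one_mul])
  · rintro (rfl | h)
    · simp
    · rw [h, one_mul]

lemma root_mem {a : Qpbar p} (ha : a ^ (p ^ d - 1) = 1) : a ∈ Kur p d :=
  IntermediateField.subset_adjoin _ _ ha

lemma q_mem {a : Qpbar p} (ha : a ^ (p ^ d) = a) : a ∈ Kur p d := by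
  rcases q_eq.1 ha with rfl | h
  · exact zero_mem _
  · exact root_mem h

lemma q_memA {a : Qpbar p} (ha : a ^ (p ^ d) = a) : a ∈ A p d := by
  rcases q_eq.1 ha with rfl | h
  · exact zero_mem _
  · exact Algebra.subset_adjoin h

/-- approximate roots of `X^m - X` are near roots -/
lemma approx_root {m : ℕ} (hm : 1 < m) {x : Qpbar p} (h : ‖x ^ m - x‖ < 1) :
    ∃ t : Qpbar p, t ^ m = t ∧ ‖x - t‖ < 1 := by
  have hmon : (X ^ m - X : (Qpbar p)[X]).Monic := by
    apply monic_X_pow_sub; simpa using hm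
  have hdeg : (X ^ m - X : (Qpbar p)[X]).natDegree = m := FiniteField.X_pow_card_sub_X_natDegree_eq _ hm
  have hspl : (X ^ m - X : (Qpbar p)[X]).Splits := IsAlgClosed.splits _
  have he : (X ^ m - X : (Qpbar p)[X]).eval x =
      ((X ^ m - X : (Qpbar p)[X]).roots.map fun a => x - a).prod := by
    conv_lhs => rw [hspl.eq_prod_roots_of_monic hmon]
    rw [eval_multiset_prod, Multiset.map_map]; simp
  obtain ⟨t, ht, ht'⟩ := exists_lt_of_prod (s := (X ^ m - X : (Qpbar p)[X]).roots)
    (f := fun a => x - a) (r := 1) zero_le_one (by rw [← he]; simpa using h)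
  refine ⟨t, ?_, ht'⟩
  have := (mem_roots'.1 ht).2
  simpa [sub_eq_zero] using this

lemma teich (hd : 0 < d) {x : Qpbar p} (hx : x ∈ Kur p d) (h1 : ‖x‖ ≤ 1) :
    ∃ t : Qpbar p, t ^ (p ^ d) = t ∧ ‖x - t‖ ≤ (p : ℝ)⁻¹ := by
  have hpp := (Fact.out : p.Prime)
  obtain ⟨b, hb, hb'⟩ := A_pow hd (mem_A hd hx h1)
  obtain ⟨t, ht, ht'⟩ := approx_root (m := p ^ d) (Nat.one_lt_pow hd.ne' hpp.one_lt) (x := x) (by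
    rw [hb', add_sub_cancel_left, norm_mul, norm_p]
    exact (mul_le_of_le_one_right hpi0.le (A_le hd hb)).trans_lt hpi1)
  exact ⟨t, ht, K_small hd (sub_mem hx (q_mem ht)) ht'⟩

lemma K_val (hd : 0 < d) {x : Qpbar p} (hx : x ∈ Kur p d) (h0 : x ≠ 0) :
    ∃ m : ℤ, ‖x‖ = (p : ℝ) ^ m := by
  obtain ⟨n, h1, h2⟩ := exists_mem_Ico_zpow (norm_pos_iff.2 h0) (hp1 (p := p))
  refine ⟨n, le_antisymm ?_ h1⟩
  have hy : x * (p : Qpbar p) ^ (n + 1) ∈ Kur p d := mul_mem hx (zpow_mem (_root_.natCast_mem _ _) _)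
  have hpos : (0 : ℝ) < (p : ℝ) ^ (n + 1) := zpow_pos hp0 _
  have := K_small hd hy (by
    rw [norm_mul, norm_zpow, norm_p, inv_zpow, ← div_eq_mul_inv, div_lt_one hpos]; exact h2)
  rw [norm_mul, norm_zpow, norm_p, inv_zpow, ← div_eq_mul_inv, div_le_iff₀ hpos] at this
  rwa [zpow_add_one₀ hp0.ne', mul_comm (_ ^ n), inv_mul_cancel_left₀ hp0.ne'] at this

end S4


namespace S4
variable {p} {d : ℕ}

lemma finite_roots {N : ℕ} (hN : N ≠ 0) : {x : Qpbar p | x ^ N = 1}.Finite := by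
  classical
  apply ((nthRoots N (1 : Qpbar p)).toFinset.finite_toSet).subset
  intro x hx
  simpa [mem_nthRoots (Nat.pos_of_ne_zero hN)] using hx

lemma fd (hd : 0 < d) : FiniteDimensional ℚ_[p] (Kur p d) := by
  have : Finite {x : Qpbar p | x ^ (p ^ d - 1) = 1} := finite_roots (q_pos hd)
  exact IntermediateField.finiteDimensional_adjoin (fun x _ => Algebra.IsIntegral.isIntegral x)

lemma norm_algHom {F : IntermediateField ℚ_[p] (Qpbar p)} (σ : F →ₐ[ℚ_[p]] Qpbar p) (x : F) :
    ‖σ x‖ = ‖(x : Qpbar p)‖ := by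
  apply norm_eq_of_minpoly
  rw [minpoly.algHom_eq σ σ.toRingHom.injective]
  exact (minpoly.algHom_eq F.val F.val.toRingHom.injective x).symm

lemma trace_le {F : IntermediateField ℚ_[p] (Qpbar p)} [FiniteDimensional ℚ_[p] F] (x : F)
    {r : ℝ} (h : ‖(x : Qpbar p)‖ ≤ r) : ‖Algebra.trace ℚ_[p] F x‖ ≤ r := by
  rw [← norm_ext, trace_eq_sum_embeddings (Qpbar p)]
  exact IsUltrametricDist.norm_sum_le_of_forall_le_of_nonneg ((norm_nonneg _).trans h)
    fun σ _ => by rw [norm_algHom]; exact h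

lemma add_pow_p {a b : Qpbar p} (ha : ‖a‖ ≤ 1) (hb : ‖b‖ ≤ 1) :
    ‖(a + b) ^ p - (a ^ p + b ^ p)‖ ≤ (p : ℝ)⁻¹ := by
  rw [add_pow_prime_eq Fact.out, add_sub_cancel_left, norm_mul, norm_mul, norm_mul, norm_p, mul_assoc,
    mul_assoc]
  apply mul_le_of_le_one_right hpi0.le
  apply mul_le_one₀ ha (by positivity)
  apply mul_le_one₀ hb (norm_nonneg _)
  apply IsUltrametricDist.norm_sum_le_of_forall_le_of_nonneg zero_le_one
  intro i _
  rw [norm_mul, norm_mul, norm_pow, norm_pow]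
  exact mul_le_one₀ (mul_le_one₀ (pow_le_one₀ (norm_nonneg _) ha) (by positivity)
    (pow_le_one₀ (norm_nonneg _) hb)) (norm_nonneg _) (nat_le _)

lemma sum_pow_p {ι : Type*} (s : Finset ι) (f : ι → Qpbar p) (h : ∀ i, ‖f i‖ ≤ 1) :
    ‖(∑ i ∈ s, f i) ^ p - ∑ i ∈ s, f i ^ p‖ ≤ (p : ℝ)⁻¹ := by
  classical
  induction s using Finset.induction_on with
  | empty => simp [(Fact.out : p.Prime).ne_zero]
  | insert a s ha ih =>
    rw [Finset.sum_insert ha, Finset.sum_insert ha]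
    have := add_pow_p (h a) (IsUltrametricDist.norm_sum_le_of_forall_le_of_nonneg zero_le_one
      (fun i (_ : i ∈ s) => h i))
    have h2 := add_le this ih
    convert h2 using 2
    ring

lemma padic_pow {x : ℚ_[p]} (h : ‖x‖ ≤ 1) : ‖x ^ p - x‖ ≤ (p : ℝ)⁻¹ := by
  obtain ⟨r, rfl⟩ : ∃ y : ℤ_[p], (y : ℚ_[p]) = x := ⟨⟨x, h⟩, rfl⟩
  have : (PadicInt.toZMod (p := p)) (r ^ p - r) = 0 := by
    rw [map_sub, map_pow, ZMod.pow_card, sub_self]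
  rw [← RingHom.mem_ker, PadicInt.ker_toZMod, PadicInt.maximalIdeal_eq_span_p,
    Ideal.mem_span_singleton] at this
  obtain ⟨b, hb⟩ := this
  have hb' := congrArg (fun z : ℤ_[p] => (z : ℚ_[p])) hb
  push_cast at hb'
  rw [hb', norm_mul, Padic.norm_p]
  exact mul_le_of_le_one_right hpi0.le b.2

lemma trace_pow {F : IntermediateField ℚ_[p] (Qpbar p)} [FiniteDimensional ℚ_[p] F] (y : F)
    (h : ‖(y : Qpbar p)‖ ≤ 1) : ‖Algebra.trace ℚ_[p] F (y ^ p - y)‖ ≤ (p : ℝ)⁻¹ := by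
  have h1 := padic_pow (trace_le y h)
  have h2 := sum_pow_p (Finset.univ) (fun σ : F →ₐ[ℚ_[p]] Qpbar p => σ y)
    (fun σ => by rw [norm_algHom]; exact h)
  rw [← trace_eq_sum_embeddings] at h2
  simp_rw [← map_pow] at h2
  rw [← trace_eq_sum_embeddings, ← map_sub, norm_ext] at h2
  rw [← norm_ext] at h1 h2 ⊢
  have h3 := sub_le h1 h2
  rw [← map_sub] at h3
  rw [map_sub]
  convert h3 using 3
  ring

lemma exists_trace_aux {N : ℕ} (hN : ¬ p ∣ N) {ζ : Qpbar p} (hζ : ζ ^ N = 1)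
    (F : IntermediateField ℚ_[p] (Qpbar p)) (hF : F = ℚ_[p]⟮ζ⟯) :
    ∃ θ : F, ‖(θ : Qpbar p)‖ ≤ 1 ∧ ¬ ‖Algebra.trace ℚ_[p] F θ‖ ≤ (p : ℝ)⁻¹ := by
  subst hF
  have hN0 : N ≠ 0 := by rintro rfl; simp at hN
  by_contra hcon
  push Not at hcon
  have hintg : IsIntegral ℚ_[p] ζ := Algebra.IsIntegral.isIntegral ζ
  set pb := IntermediateField.adjoin.powerBasis hintg with hpb
  have : FiniteDimensional ℚ_[p] ℚ_[p]⟮ζ⟯ := pb.finite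
  have hcard : Fintype.card (ℚ_[p]⟮ζ⟯ →ₐ[ℚ_[p]] Qpbar p) = pb.dim := by
    rw [AlgHom.card, pb.finrank]
  let e : Fin pb.dim ≃ (ℚ_[p]⟮ζ⟯ →ₐ[ℚ_[p]] Qpbar p) := (Fintype.equivFinOfCardEq hcard).symm
  have hd := Algebra.discr_powerBasis_eq_prod ℚ_[p] (Qpbar p) pb e
  have hgen : pb.gen ^ N = 1 := by
    rw [hpb, IntermediateField.adjoin.powerBasis_gen]
    apply Subtype.ext
    simpa using hζ
  have hroot : ∀ i, (e i pb.gen) ^ N = 1 := fun i => by rw [← map_pow, hgen, map_one]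
  have h1 : ‖Algebra.discr ℚ_[p] pb.basis‖ = 1 := by
    rw [← norm_ext, hd, norm_prod]
    apply Finset.prod_eq_one
    intro i _
    rw [norm_prod]
    apply Finset.prod_eq_one
    intro j hj
    rw [norm_pow, root_sub hN (hroot j) (hroot i), one_pow]
    intro hh
    have := pb.algHom_ext hh
    have := e.injective this
    simp [this] at hj
  have h2 : ‖Algebra.discr ℚ_[p] pb.basis‖ ≤ (p : ℝ)⁻¹ := by
    rw [Algebra.discr_def, Matrix.det_apply]
    apply IsUltrametricDist.norm_sum_le_of_forall_le_of_nonneg hpi0.le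
    intro σ _
    rw [Units.smul_def, zsmul_eq_mul, norm_mul]
    have hs : ‖(((Equiv.Perm.sign σ : ℤˣ) : ℤ) : ℚ_[p])‖ ≤ 1 := Padic.norm_int_le_one _
    apply (mul_le_of_le_one_left (norm_nonneg _) hs).trans
    rw [norm_prod]
    have hent : ∀ i j, ‖Algebra.traceMatrix ℚ_[p] pb.basis i j‖ ≤ (p : ℝ)⁻¹ := by
      intro i j
      rw [Algebra.traceMatrix_apply, Algebra.traceForm_apply]
      apply hcon
      have hζn := norm_root_one hN0 hζ
      simp only [pb.basis_eq_pow]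
      have hg : (pb.gen : Qpbar p) = ζ := by
        rw [hpb, IntermediateField.adjoin.powerBasis_gen]; rfl
      rw [MulMemClass.coe_mul, SubmonoidClass.coe_pow, SubmonoidClass.coe_pow, hg, norm_mul,
        norm_pow, norm_pow, hζn, one_pow, one_pow, one_mul]
    have hpos : 0 < pb.dim := pb.dim_pos
    calc _ ≤ ∏ i : Fin pb.dim, (p : ℝ)⁻¹ :=
          Finset.prod_le_prod (fun _ _ => norm_nonneg _) (fun i _ => hent _ _)
      _ = (p : ℝ)⁻¹ ^ pb.dim := by simp
      _ ≤ (p : ℝ)⁻¹ := pow_le_of_le_one hpi0.le hpi1.le hpos.ne'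
  rw [h1] at h2
  exact absurd h2 (not_le.2 hpi1)

lemma exists_trace (hd : 0 < d) :
    ∃ θ : Kur p d, ‖(θ : Qpbar p)‖ ≤ 1 ∧ ¬ ‖Algebra.trace ℚ_[p] (Kur p d) θ‖ ≤ (p : ℝ)⁻¹ := by
  have : NeZero ((p ^ d - 1 : ℕ) : Qpbar p) := ⟨by exact_mod_cast q_pos hd⟩
  have : NeZero (p ^ d - 1) := ⟨q_pos hd⟩
  obtain ⟨ζ, hζ⟩ := HasEnoughRootsOfUnity.exists_primitiveRoot (Qpbar p) (p ^ d - 1)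
  refine exists_trace_aux (q_ndvd hd) hζ.pow_eq_one _ ?_
  apply le_antisymm
  · apply IntermediateField.adjoin_le_iff.2
    intro x hx
    obtain ⟨i, _, hi⟩ := hζ.eq_pow_of_pow_eq_one hx
    rw [← hi]
    exact pow_mem (mem_adjoin_simple_self _ _) _
  · rw [IntermediateField.adjoin_simple_le_iff]
    exact root_mem hζ.pow_eq_one

/-- ring of integers as additive group -/
noncomputable def O (p : ℕ) [Fact p.Prime] (d : ℕ) : AddSubgroup (Qpbar p) where
  carrier := {x | x ∈ Kur p d ∧ ‖x‖ ≤ 1}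
  add_mem' h1 h2 := ⟨add_mem h1.1 h2.1, add_le h1.2 h2.2⟩
  zero_mem' := ⟨zero_mem _, by simp⟩
  neg_mem' h := ⟨neg_mem h.1, by simpa using h.2⟩

noncomputable def I (p : ℕ) [Fact p.Prime] (d : ℕ) : AddSubgroup (O p d) where
  carrier := {x | ‖(x : Qpbar p)‖ < 1}
  add_mem' h1 h2 := add_lt h1 h2
  zero_mem' := by simp
  neg_mem' h := by simpa using h

noncomputable def wp (x : O p d) : O p d :=
  ⟨x ^ p - x, sub_mem (pow_mem x.2.1 _) x.2.1,
    sub_le (by rw [norm_pow]; exact pow_le_one₀ (norm_nonneg _) x.2.2) x.2.2⟩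

noncomputable def wpHom (p : ℕ) [Fact p.Prime] (d : ℕ) : O p d →+ (O p d ⧸ I p d) :=
  AddMonoidHom.mk' (fun x => QuotientAddGroup.mk (wp x)) (by
    intro a b
    rw [← QuotientAddGroup.mk_add, eq_comm, QuotientAddGroup.eq]
    show ‖_‖ < 1
    refine lt_of_le_of_lt ?_ (hpi1 (p := p))
    have h := add_pow_p a.2.2 b.2.2
    have e : ((-(wp a + wp b) + wp (a + b) : O p d) : Qpbar p)
        = ((a : Qpbar p) + b) ^ p - ((a : Qpbar p) ^ p + (b : Qpbar p) ^ p) := by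
      show -(((a : Qpbar p) ^ p - a) + ((b : Qpbar p) ^ p - b))
        + (((a : Qpbar p) + b) ^ p - ((a : Qpbar p) + b)) = _
      ring
    exact (congrArg norm e).le.trans h)

noncomputable def Zs (p : ℕ) [Fact p.Prime] (d : ℕ) (hd : 0 < d) : AddSubgroup (O p d) where
  carrier := {x | ‖Algebra.trace ℚ_[p] (Kur p d) ⟨x, x.2.1⟩‖ ≤ (p : ℝ)⁻¹}
  add_mem' {a b} h1 h2 := by
    have : (⟨((a + b : O p d) : Qpbar p), (a + b).2.1⟩ : Kur p d) = ⟨a, a.2.1⟩ + ⟨b, b.2.1⟩ := rfl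
    simp only [Set.mem_setOf_eq] at h1 h2 ⊢
    rw [this, map_add]
    exact (IsUltrametricDist.norm_add_le_max _ _).trans (max_le h1 h2)
  zero_mem' := by
    have : (⟨((0 : O p d) : Qpbar p), (0 : O p d).2.1⟩ : Kur p d) = 0 := rfl
    simp only [Set.mem_setOf_eq]
    rw [this, map_zero, norm_zero]; exact hpi0.le
  neg_mem' {a} h := by
    have : (⟨((-a : O p d) : Qpbar p), (-a).2.1⟩ : Kur p d) = - ⟨a, a.2.1⟩ := rfl
    simp only [Set.mem_setOf_eq] at h ⊢
    rwa [this, map_neg, norm_neg]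

lemma finite_fix {m : ℕ} (hm : 1 < m) : {t : Qpbar p | t ^ m = t}.Finite ∧
    {t : Qpbar p | t ^ m = t}.ncard ≤ m := by
  classical
  have hdeg : (X ^ m - X : (Qpbar p)[X]).natDegree = m := FiniteField.X_pow_card_sub_X_natDegree_eq _ hm
  have h0 : (X ^ m - X : (Qpbar p)[X]) ≠ 0 := FiniteField.X_pow_card_sub_X_ne_zero _ hm
  have : {t : Qpbar p | t ^ m = t} = ((X ^ m - X : (Qpbar p)[X]).roots.toFinset : Set (Qpbar p)) := by
    ext t
    simp [h0, sub_eq_zero]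
  rw [this]
  refine ⟨Finset.finite_toSet _, ?_⟩
  rw [Set.ncard_coe_finset]
  calc _ ≤ _ := Multiset.toFinset_card_le _
    _ ≤ _ := card_roots' _
    _ = m := hdeg

lemma pfix_qfix {t : Qpbar p} (ht : t ^ p = t) (k : ℕ) : t ^ (p ^ k) = t := by
  induction k with
  | zero => simp
  | succ k ih => rw [pow_succ, pow_mul, ih, ht]

lemma fix_norm {m : ℕ} (hm : 1 < m) {t : Qpbar p} (ht : t ^ m = t) : ‖t‖ ≤ 1 := by
  by_contra h
  push Not at h
  have : ‖t‖ ^ m = ‖t‖ := by rw [← norm_pow, ht]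
  have h2 := pow_lt_pow_right₀ h hm
  rw [this, pow_one] at h2
  exact lt_irrefl _ h2

lemma hpp1 : 1 < p := (Fact.out : p.Prime).one_lt

lemma I_index_ne (hd : 0 < d) : (I p d).index ≠ 0 := by
  have hq : 1 < p ^ d := Nat.one_lt_pow hd.ne' hpp1
  have hfin := (finite_fix (p := p) hq).1
  have : Finite {t : Qpbar p | t ^ (p ^ d) = t} := hfin
  have hsur : Function.Surjective (fun t : {t : Qpbar p | t ^ (p ^ d) = t} =>
      (QuotientAddGroup.mk (⟨t, q_mem t.2, fix_norm hq t.2⟩ : O p d) : O p d ⧸ I p d)) := by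
    intro x
    induction x using QuotientAddGroup.induction_on with
    | H x =>
      obtain ⟨t, ht, ht'⟩ := teich hd x.2.1 x.2.2
      refine ⟨⟨t, ht⟩, ?_⟩
      rw [QuotientAddGroup.eq]
      show ‖_‖ < 1
      refine lt_of_le_of_lt ?_ (hpi1 (p := p))
      refine le_trans (le_of_eq (congrArg norm ?_)) ht'
      show -t + (x : Qpbar p) = x - t
      ring
  have := Finite.of_surjective _ hsur
  exact AddSubgroup.index_ne_zero_of_finite

lemma ker_rel (hd : 0 < d) : (I p d).relIndex (wpHom p d).ker ≤ p := by
  have hfin := (finite_fix (p := p) (hpp1 (p := p)))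
  have : Finite {t : Qpbar p | t ^ p = t} := hfin.1
  have hker : ∀ x : O p d, x ∈ (wpHom p d).ker ↔ ‖(x : Qpbar p) ^ p - x‖ < 1 := by
    intro x
    rw [AddMonoidHom.mem_ker]
    show (QuotientAddGroup.mk (wp x) : O p d ⧸ I p d) = 0 ↔ _
    rw [QuotientAddGroup.eq_zero_iff]
    rfl
  let g : {t : Qpbar p | t ^ p = t} → (wpHom p d).ker := fun t =>
    ⟨⟨t, q_mem (pfix_qfix t.2 d), fix_norm hpp1 t.2⟩, by
      rw [hker]
      have := t.2
      simp only [Set.mem_setOf_eq] at this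
      simp [this]⟩
  have hsur : Function.Surjective (fun t => (QuotientAddGroup.mk (g t) :
      (wpHom p d).ker ⧸ (I p d).addSubgroupOf (wpHom p d).ker)) := by
    intro x
    induction x using QuotientAddGroup.induction_on with
    | H x =>
      obtain ⟨t, ht, ht'⟩ := approx_root hpp1 ((hker x.1).1 x.2)
      refine ⟨⟨t, ht⟩, ?_⟩
      rw [QuotientAddGroup.eq]
      show ‖_‖ < 1
      refine lt_of_eq_of_lt ?_ ht'
      congr 1
      simp [g]; ring
  calc _ = Nat.card ((wpHom p d).ker ⧸ (I p d).addSubgroupOf (wpHom p d).ker) := rfl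
    _ ≤ Nat.card {t : Qpbar p | t ^ p = t} := Nat.card_le_card_of_surjective _ hsur
    _ = {t : Qpbar p | t ^ p = t}.ncard := rfl
    _ ≤ p := hfin.2

lemma hilbert90 (hd : 0 < d) {x : Kur p d} (h1 : ‖(x : Qpbar p)‖ ≤ 1)
    (h2 : ‖Algebra.trace ℚ_[p] (Kur p d) x‖ ≤ (p : ℝ)⁻¹) :
    ∃ y : Kur p d, ‖(y : Qpbar p)‖ ≤ 1 ∧ ‖(x : Qpbar p) - ((y : Qpbar p) ^ p - y)‖ ≤ (p : ℝ)⁻¹ := by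
  have := fd (p := p) hd
  set W : AddSubgroup (O p d) := (wpHom p d).range.comap (QuotientAddGroup.mk' (I p d)) with hW
  have hI0 := I_index_ne (p := p) hd
  have hIle : I p d ≤ (wpHom p d).ker := by
    intro x hx
    have hx' : ‖(x : Qpbar p)‖ < 1 := hx
    rw [AddMonoidHom.mem_ker]
    show (QuotientAddGroup.mk (wp x) : O p d ⧸ I p d) = 0
    rw [QuotientAddGroup.eq_zero_iff]
    show ‖(x : Qpbar p) ^ p - x‖ < 1
    apply sub_lt _ hx'
    rw [norm_pow]
    exact pow_lt_one₀ (norm_nonneg _) hx' (Fact.out : p.Prime).ne_zero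
  have hWi : W.index = (wpHom p d).range.index :=
    AddSubgroup.index_comap_of_surjective _ (QuotientAddGroup.mk'_surjective _)
  have e1 := AddSubgroup.relIndex_mul_index hIle
  have e2 : (wpHom p d).range.index * Nat.card (wpHom p d).range = (I p d).index :=
    AddSubgroup.index_mul_card _
  have e3 : (wpHom p d).ker.index = Nat.card (wpHom p d).range := AddSubgroup.index_ker _
  have hr0 : Nat.card (wpHom p d).range ≠ 0 := by
    intro h; rw [h, mul_zero] at e2; exact hI0 e2.symm
  have hWle : W.index ≤ p := by
    have : W.index = (I p d).relIndex (wpHom p d).ker := by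
      rw [hWi]
      apply Nat.eq_of_mul_eq_mul_right (Nat.pos_of_ne_zero hr0)
      rw [e2, ← e3, e1]
    rw [this]; exact ker_rel hd
  have hW0 : W.index ≠ 0 := by
    intro h; rw [hWi] at h; rw [h, zero_mul] at e2; exact hI0 e2.symm
  have hmemW : ∀ x : O p d, x ∈ W ↔ ∃ y : O p d, ‖(x : Qpbar p) - ((y : Qpbar p) ^ p - y)‖ < 1 := by
    intro x
    rw [hW, AddSubgroup.mem_comap, AddMonoidHom.mem_range]
    apply exists_congr
    intro y
    show (QuotientAddGroup.mk (wp y) : O p d ⧸ I p d) = QuotientAddGroup.mk x ↔ _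
    rw [QuotientAddGroup.eq]
    show ‖_‖ < 1 ↔ _
    simp only [wp, AddSubgroup.coe_add, AddSubgroup.coe_neg]
    rw [neg_add_eq_sub]
  have hWZ : W ≤ Zs p d hd := by
    intro x hx
    obtain ⟨y, hy⟩ := (hmemW x).1 hx
    show ‖Algebra.trace ℚ_[p] (Kur p d) ⟨x, x.2.1⟩‖ ≤ (p : ℝ)⁻¹
    have hy' := K_small hd (sub_mem x.2.1 (sub_mem (pow_mem y.2.1 _) y.2.1)) hy
    set X : Kur p d := ⟨x, x.2.1⟩
    set Y : Kur p d := ⟨y, y.2.1⟩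
    have h3 := trace_le (X - (Y ^ p - Y)) hy'
    have h4 := trace_pow Y y.2.2
    have : X = (X - (Y ^ p - Y)) + (Y ^ p - Y) := by ring
    rw [this, map_add]
    exact (IsUltrametricDist.norm_add_le_max _ _).trans (max_le h3 h4)
  have hZp : p ∣ (Zs p d hd).index := by
    obtain ⟨θ, hθ, hθ'⟩ := exists_trace (p := p) hd
    let θ' : O p d := ⟨θ, θ.2, hθ⟩
    have : addOrderOf (QuotientAddGroup.mk θ' : O p d ⧸ Zs p d hd) = p := by
      apply addOrderOf_eq_prime
      · rw [← QuotientAddGroup.mk_nsmul, QuotientAddGroup.eq_zero_iff]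
        show ‖Algebra.trace ℚ_[p] (Kur p d) _‖ ≤ (p : ℝ)⁻¹
        apply trace_le
        show ‖((p • θ' : O p d) : Qpbar p)‖ ≤ _
        rw [AddSubgroup.coe_nsmul, nsmul_eq_mul, norm_mul, norm_p]
        exact mul_le_of_le_one_right hpi0.le hθ
      · rw [Ne, QuotientAddGroup.eq_zero_iff]
        exact hθ'
    have h := addOrderOf_dvd_natCard (QuotientAddGroup.mk θ' : O p d ⧸ Zs p d hd)
    rw [this] at h
    exact h
  have hrel := AddSubgroup.relIndex_mul_index hWZ
  have hZ0 : (Zs p d hd).index ≠ 0 := by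
    intro h; rw [h, mul_zero] at hrel; exact hW0 hrel.symm
  have hple := Nat.le_of_dvd (Nat.pos_of_ne_zero hZ0) hZp
  have hrel1 : W.relIndex (Zs p d hd) = 1 := by
    have h0 : W.relIndex (Zs p d hd) ≠ 0 := by
      intro h; rw [h, zero_mul] at hrel; exact hW0 hrel.symm
    by_contra h1
    have : 2 ≤ W.relIndex (Zs p d hd) := by omega
    have := Nat.mul_le_mul this hple
    have := hpp1 (p := p)
    omega
  have hle := AddSubgroup.relIndex_eq_one.1 hrel1
  obtain ⟨y, hy⟩ := (hmemW ⟨x, x.2, h1⟩).1 (hle (show (⟨x, x.2, h1⟩ : O p d) ∈ Zs p d hd from h2))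
  exact ⟨⟨y, y.2.1⟩, y.2.2, K_small hd (sub_mem x.2 (sub_mem (pow_mem y.2.1 _) y.2.1)) hy⟩

end S4


namespace S4
variable {p} {d : ℕ}

noncomputable instance instUltraK : IsUltrametricDist (Kur p d) :=
  ⟨fun x y z => IsUltrametricDist.dist_triangle_max (x : Qpbar p) y z⟩

lemma complete (hd : 0 < d) : CompleteSpace (Kur p d) := by
  have := fd (p := p) hd
  exact FiniteDimensional.complete ℚ_[p] (Kur p d)

lemma coe_norm (x : Kur p d) : ‖(x : Qpbar p)‖ = ‖x‖ := rfl

lemma solve (hd : 0 < d) {r c : ℝ} (hr : 0 ≤ r) (hc0 : 0 ≤ c) (hc : c < 1) (G : Kur p d → Kur p d)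
    (hG : ∀ y y' : Kur p d, ‖y‖ ≤ r → ‖y'‖ ≤ r → ‖G y - G y'‖ ≤ c * ‖y - y'‖) (h0 : G 0 = 0)
    (b : Kur p d) (hb : ‖b‖ ≤ r) : ∃ y : Kur p d, ‖y‖ ≤ r ∧ y + G y = b := by
  have := complete (p := p) hd
  set S : Set (Kur p d) := Metric.closedBall 0 r with hS
  have hSc : IsComplete S := Metric.isClosed_closedBall.isComplete
  have hm : ∀ y, y ∈ S ↔ ‖y‖ ≤ r := fun y => by rw [hS, mem_closedBall_zero_iff]
  have hmaps : Set.MapsTo (fun y => b - G y) S S := by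
    intro y hy
    rw [hm] at hy ⊢
    have := hG y 0 hy (by simpa using hr)
    rw [h0, sub_zero, sub_zero] at this
    have h2 : ‖G y‖ ≤ r := this.trans ((mul_le_of_le_one_left (norm_nonneg _) hc.le).trans hy)
    exact sub_le (p := p) hb h2
  have hcon : ContractingWith ⟨c, hc0⟩ (hmaps.restrict _ S S) := by
    refine ⟨by exact_mod_cast hc, LipschitzWith.of_dist_le_mul ?_⟩
    rintro ⟨y, hy⟩ ⟨y', hy'⟩
    rw [hm] at hy hy'
    show dist (b - G y) (b - G y') ≤ c * dist y y'
    rw [dist_eq_norm, dist_eq_norm, sub_sub_sub_cancel_left, norm_sub_rev, ]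
    exact hG y y' hy hy'
  obtain ⟨y, hy, hf, _⟩ := ContractingWith.exists_fixedPoint' hSc hmaps hcon (x := b) ((hm b).2 hb)
    (edist_ne_top _ _)
  refine ⟨y, (hm y).1 hy, ?_⟩
  have : b - G y = y := hf
  rw [sub_eq_iff_eq_add] at this
  exact this.symm

lemma pow_sub_le {y y' : Qpbar p} {r : ℝ} (hy : ‖y‖ ≤ r) (hy' : ‖y'‖ ≤ r) (n : ℕ) :
    ‖y ^ (n + 1) - y' ^ (n + 1)‖ ≤ ‖y - y'‖ * r ^ n := by
  have hr := (norm_nonneg _).trans hy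
  induction n with
  | zero => simp
  | succ n ih =>
    have e : y ^ (n + 1 + 1) - y' ^ (n + 1 + 1)
      = y * (y ^ (n + 1) - y' ^ (n + 1)) + (y - y') * y' ^ (n + 1) := by ring
    rw [e]
    apply add_le
    · rw [norm_mul, pow_succ r, ← mul_assoc, mul_comm]
      exact mul_le_mul ih hy (norm_nonneg _) (by positivity)
    · rw [norm_mul, norm_pow]
      gcongr

lemma term_le {a y y' : Qpbar p} (hy : ‖y‖ ≤ (p : ℝ)⁻¹) (hy' : ‖y'‖ ≤ (p : ℝ)⁻¹) (n : ℕ)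
    (ha : ‖a‖ * (p : ℝ)⁻¹ ^ n ≤ (p : ℝ)⁻¹) :
    ‖a * y ^ (n + 1) - a * y' ^ (n + 1)‖ ≤ (p : ℝ)⁻¹ * ‖y - y'‖ := by
  rw [← mul_sub, norm_mul]
  calc _ ≤ ‖a‖ * (‖y - y'‖ * (p : ℝ)⁻¹ ^ n) := by gcongr; exact pow_sub_le hy hy' n
    _ = (‖a‖ * (p : ℝ)⁻¹ ^ n) * ‖y - y'‖ := by ring
    _ ≤ _ := by gcongr

lemma two_val (hp : Odd p) {n : ℕ} (hn : n ≠ 0) : 2 * padicValNat p n.factorial + 1 ≤ n := by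
  have h := sub_one_mul_padicValNat_factorial (p := p) n
  have hp2 : 2 ≤ p - 1 := by
    have := (Fact.out : p.Prime).two_le
    obtain ⟨k, hk⟩ := hp
    omega
  have hs : 1 ≤ (p.digits n).sum := by
    by_contra hcon
    have h0 : (p.digits n).sum = 0 := by omega
    have h1 : n ≠ 0 := hn
    have hlast := Nat.getLast_digit_ne_zero p hn
    have hmem := List.getLast_mem (Nat.digits_ne_nil_iff_ne_zero.2 hn : p.digits n ≠ [])
    exact hlast (List.sum_eq_zero_iff.1 h0 _ hmem)
  have := Nat.mul_le_mul_right (padicValNat p n.factorial) hp2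
  omega

lemma fac_norm (n : ℕ) : ‖(n.factorial : Qpbar p)‖ = (p : ℝ)⁻¹ ^ padicValNat p n.factorial := by
  have h := norm_ext (p := p) (n.factorial : ℚ_[p])
  rw [map_natCast] at h
  rw [h, Padic.norm_eq_zpow_neg_valuation (by exact_mod_cast n.factorial_ne_zero), Padic.valuation_natCast,
    zpow_neg, zpow_natCast, inv_pow]

lemma fac_term (hp : Odd p) (n : ℕ) :
    ‖((n + 1).factorial : Qpbar p)⁻¹‖ * (p : ℝ)⁻¹ ^ n ≤ (p : ℝ)⁻¹ ^ ((n + 1) / 2) := by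
  have h2 := two_val hp (n := n + 1) (by omega)
  rw [norm_inv, fac_norm]
  set k := padicValNat p (n + 1).factorial
  have e : n = k + (n - k) := by omega
  have hk : (p : ℝ)⁻¹ ^ k ≠ 0 := (pow_pos hpi0 _).ne'
  conv_lhs => rw [e, pow_add, ← mul_assoc, inv_mul_cancel₀ hk, one_mul]
  exact pow_le_pow_of_le_one hpi0.le hpi1.le (by omega)

lemma fac_term' (hp : Odd p) (n : ℕ) (hn : n ≠ 0) :
    ‖((n + 1).factorial : Qpbar p)⁻¹‖ * (p : ℝ)⁻¹ ^ n ≤ (p : ℝ)⁻¹ := by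
  refine (fac_term hp n).trans (pow_le_of_le_one hpi0.le hpi1.le (by omega))

lemma hpi2 : (p : ℝ)⁻¹ * (p : ℝ)⁻¹ = (p : ℝ)⁻¹ ^ 2 := by ring

lemma exp_partial (hp : Odd p) {y : Qpbar p} (hy : ‖y‖ ≤ (p : ℝ)⁻¹) (N : ℕ) :
    ‖∑ n ∈ Finset.range (N + 2), y ^ n / (n.factorial : Qpbar p) - 1 - y‖ ≤ (p : ℝ)⁻¹ ^ 2 := by
  rw [Finset.sum_range_succ', Finset.sum_range_succ']
  have e : ∑ k ∈ Finset.range N, y ^ (k + 1 + 1) / ((k + 1 + 1).factorial : Qpbar p) +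
      y ^ (0 + 1) / ((0 + 1).factorial : Qpbar p) + y ^ 0 / (Nat.factorial 0 : Qpbar p) - 1 - y
      = ∑ k ∈ Finset.range N, y ^ (k + 1 + 1) / ((k + 1 + 1).factorial : Qpbar p) := by
    simp
  rw [e]
  apply IsUltrametricDist.norm_sum_le_of_forall_le_of_nonneg (by positivity)
  intro k _
  have h := term_le (y' := 0) hy (by simp [hpi0.le]) (k + 1) (fac_term' hp (k + 1) (by omega))
  rw [zero_pow (by omega), mul_zero, sub_zero, sub_zero] at h
  rw [div_eq_inv_mul, ← hpi2]
  exact h.trans (by gcongr)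

lemma exp_fwd (hp : Odd p) {y w : Qpbar p} (hy : ‖y‖ ≤ (p : ℝ)⁻¹)
    (h : Tendsto (fun N => ‖w - ∑ n ∈ Finset.range N, y ^ n / (Nat.factorial n : Qpbar p)‖)
    atTop (nhds 0)) : ‖w - 1 - y‖ ≤ (p : ℝ)⁻¹ ^ 2 := by
  have h1 := h.eventually (ge_mem_nhds (pow_pos (hpi0 (p := p)) 2))
  obtain ⟨N, hN⟩ := h1.exists_forall_of_atTop
  have h2 := hN (N + 2) (by omega)
  have h3 := add_le h2 (exp_partial hp hy N)
  convert h3 using 2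
  ring

noncomputable def G (y : Kur p d) : Kur p d :=
  ∑' n : ℕ, ((n + 1 + 1).factorial : Kur p d)⁻¹ * y ^ (n + 1 + 1)

lemma G_summable (hp : Odd p) (hd : 0 < d) {y : Kur p d} (hy : ‖y‖ ≤ (p : ℝ)⁻¹) :
    Summable fun n : ℕ => ((n + 1 + 1).factorial : Kur p d)⁻¹ * y ^ (n + 1 + 1) := by
  have := complete (p := p) hd
  apply NonarchimedeanAddGroup.summable_of_tendsto_cofinite_zero
  rw [Nat.cofinite_eq_atTop]
  have h2 : Tendsto (fun n : ℕ => (p : ℝ)⁻¹ ^ ((n + 2) / 2)) atTop (nhds 0) := by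
    apply (tendsto_pow_atTop_nhds_zero_of_lt_one hpi0.le hpi1).comp
    apply tendsto_atTop_atTop.2
    intro b
    exact ⟨2 * b, fun a ha => by omega⟩
  apply squeeze_zero_norm _ h2
  intro n
  rw [← coe_norm]
  push_cast
  rw [norm_mul, norm_pow, pow_succ]
  calc _ ≤ ‖((n + 1 + 1).factorial : Qpbar p)⁻¹‖ * ((p : ℝ)⁻¹ ^ (n + 1) * 1) := by
        have : ‖y‖ ≤ 1 := hy.trans hpi1.le
        have h3 : ‖(y : Qpbar p)‖ = ‖y‖ := rfl
        rw [h3]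
        gcongr
    _ ≤ _ := by rw [mul_one]; exact fac_term hp (n + 1)

lemma exp_bwd (hp : Odd p) (hd : 0 < d) {w : Qpbar p} (hw : w ∈ Kur p d) (h : ‖w - 1‖ ≤ (p : ℝ)⁻¹) :
    ∃ y : Kur p d, ‖y‖ ≤ (p : ℝ)⁻¹ ∧
    Tendsto (fun N => ‖w - ∑ n ∈ Finset.range N, (y : Qpbar p) ^ n / (Nat.factorial n : Qpbar p)‖)
    atTop (nhds 0) := by
  obtain ⟨y, hy, hy2⟩ := solve hd (r := (p : ℝ)⁻¹) (c := (p : ℝ)⁻¹) hpi0.le hpi0.le hpi1 (G (p := p) (d := d)) (by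
    intro y y' hy hy'
    rw [G, G, ← (G_summable hp hd hy).tsum_sub (G_summable hp hd hy')]
    apply IsUltrametricDist.norm_tsum_le_of_forall_le_of_nonneg
    · exact mul_nonneg hpi0.le (norm_nonneg _)
    intro n
    have h3 := term_le (y := (y : Qpbar p)) (y' := y') hy hy' (n + 1) (fac_term' hp (n + 1) (by omega))
    rw [← coe_norm, ← coe_norm]
    push_cast
    exact h3) (by simp [G]) (⟨w, hw⟩ - 1) (by rw [← coe_norm]; push_cast; exact h)
  refine ⟨y, hy, ?_⟩
  have hs := (G_summable hp hd hy).hasSum.tendsto_sum_nat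
  rw [tendsto_iff_norm_sub_tendsto_zero] at hs
  rw [← tendsto_add_atTop_iff_nat 2]
  refine hs.congr ?_
  intro N
  rw [norm_sub_rev]
  have e : (w - ∑ n ∈ Finset.range (N + 2), (y : Qpbar p) ^ n / (Nat.factorial n : Qpbar p))
    = ((G y - ∑ n ∈ Finset.range N, ((n + 1 + 1).factorial : Kur p d)⁻¹ * y ^ (n + 1 + 1) : Kur p d) : Qpbar p) := by
    have h3 := congrArg (fun z : Kur p d => (z : Qpbar p)) hy2
    push_cast at h3 ⊢
    rw [Finset.sum_range_succ', Finset.sum_range_succ']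
    have : w = y + G y + 1 := by rw [h3]; ring
    rw [this]
    simp only [div_eq_inv_mul]
    simp
    ring
  rw [e]
  rfl

lemma choose_term (hp : Odd p) (n : ℕ) (hn : n < p) (hn1 : n ≠ 0) :
    ‖((p.choose (n + 1) : Qpbar p) / p)‖ * (p : ℝ)⁻¹ ^ n ≤ (p : ℝ)⁻¹ := by
  rcases eq_or_ne (n + 1) p with h | h
  · rw [h, Nat.choose_self, Nat.cast_one, one_div, norm_inv, norm_p]
    have : 2 ≤ n := by
      obtain ⟨k, hk⟩ := hp
      omega
    calc _ ≤ (p : ℝ)⁻¹⁻¹ * (p : ℝ)⁻¹ ^ 2 := by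
          gcongr ?_ * ?_
          exact pow_le_pow_of_le_one hpi0.le hpi1.le this
      _ = _ := by rw [pow_two, inv_mul_cancel_left₀ hpi0.ne']
  · obtain ⟨k, hk⟩ := (Fact.out : p.Prime).dvd_choose_self (k := n + 1) (by omega) (by omega)
    rw [hk, Nat.cast_mul, mul_div_cancel_left₀ _ p_ne]
    calc _ ≤ 1 * (p : ℝ)⁻¹ ^ n := by gcongr; exact nat_le k
      _ ≤ _ := by rw [one_mul]; exact pow_le_of_le_one hpi0.le hpi1.le hn1

lemma pth_root (hp : Odd p) (hd : 0 < d) {w : Qpbar p} (hw : w ∈ Kur p d)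
    (h : ‖w - 1‖ ≤ (p : ℝ)⁻¹ ^ 2) : ∃ y : Kur p d, (y : Qpbar p) ^ p = w ∧ y ≠ 0 := by
  have hpp : (p - 1 + 1) = p := Nat.sub_add_cancel (Fact.out : p.Prime).one_lt.le
  obtain ⟨y, hy, hy2⟩ := solve hd (r := (p : ℝ)⁻¹) (c := (p : ℝ)⁻¹) hpi0.le hpi0.le hpi1
    (fun y : Kur p d => ∑ n ∈ Finset.range (p - 1), ((p.choose (n + 1 + 1) : Kur p d) / p) * y ^ (n + 1 + 1)) (by
    intro y y' hy hy'
    rw [← Finset.sum_sub_distrib]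
    apply IsUltrametricDist.norm_sum_le_of_forall_le_of_nonneg
    · exact mul_nonneg hpi0.le (norm_nonneg _)
    intro n hn
    rw [Finset.mem_range] at hn
    have h3 := term_le (y := (y : Qpbar p)) (y' := y') hy hy' (n + 1) (choose_term hp (n + 1) (by omega) (by omega))
    rw [← coe_norm, ← coe_norm]
    push_cast
    exact h3) (by simp) ((⟨w, hw⟩ - 1) / p) (by
      show ‖(w - 1) / (p : Qpbar p)‖ ≤ _
      rw [norm_div, norm_p, div_le_iff₀ hpi0, hpi2]
      exact h)
  refine ⟨1 + y, ?_, ?_⟩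
  · have h3 := congrArg (fun z : Kur p d => (p : Qpbar p) * (z : Qpbar p)) hy2
    push_cast at h3
    rw [mul_div_cancel₀ _ p_ne, mul_add, Finset.mul_sum] at h3
    push_cast
    have hrange : ∀ f : ℕ → Qpbar p, ∑ k ∈ Finset.range p, f k
        = ∑ k ∈ Finset.range (p - 1), f (k + 1) + f 0 := by
      intro f
      rw [← Finset.sum_range_succ', hpp]
    rw [add_comm, add_pow, Finset.sum_range_succ', hrange]
    rw [← sub_eq_zero]
    rw [← sub_eq_zero] at h3
    rw [← h3]
    simp only [one_pow, mul_one, pow_zero, zero_add, pow_one, Nat.choose_one_right,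
      Nat.choose_zero_right, Nat.cast_one]
    rw [Finset.sum_congr rfl (g := fun n => (p : Qpbar p) * ((p.choose (n + 1 + 1) : Qpbar p) / p * (y : Qpbar p) ^ (n + 1 + 1)))]
    · ring
    · intro n _
      field_simp [p_ne (p := p)]
  · intro h0
    have : ‖(y : Qpbar p)‖ = 1 := by
      have h1 : y = -1 := by rw [eq_neg_iff_add_eq_zero, add_comm]; exact h0
      rw [h1]; simp
    have h2 : ‖(y : Qpbar p)‖ ≤ (p : ℝ)⁻¹ := hy
    rw [this] at h2
    exact absurd h2 (not_le.2 hpi1)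

end S4


namespace S4
variable {p} {d : ℕ}

def IsR (u π : Qpbar p) : Prop := π * (π + u * p) ^ (p - 1) + p = 0

lemma isR_iff {u π : Qpbar p} : (psiPoly p u).IsRoot π ↔ IsR u π := by
  simp [psiPoly, IsR, IsRoot.def]

lemma hpm : p - 1 + 1 = p := Nat.sub_add_cancel (Fact.out : p.Prime).one_lt.le


lemma IsR.norm_gt {u π : Qpbar p} (hu : ‖u‖ = 1) (hπ : IsR u π) : (p : ℝ)⁻¹ < ‖π‖ := by
  by_contra hcon
  push Not at hcon
  have h1 : ‖π + u * p‖ ≤ (p : ℝ)⁻¹ := add_le hcon (by rw [norm_mul, hu, norm_p, one_mul])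
  have h2 : ‖π * (π + u * p) ^ (p - 1)‖ = (p : ℝ)⁻¹ := by
    rw [eq_neg_of_add_eq_zero_left hπ, norm_neg, norm_p]
  have h3 : (p : ℝ)⁻¹ ≤ (p : ℝ)⁻¹ ^ 2 := by
    calc (p : ℝ)⁻¹ = _ := h2.symm
      _ ≤ (p : ℝ)⁻¹ * (p : ℝ)⁻¹ ^ (p - 1) := by rw [norm_mul, norm_pow]; gcongr
      _ ≤ (p : ℝ)⁻¹ * (p : ℝ)⁻¹ := by
        gcongr
        exact pow_le_of_le_one hpi0.le hpi1.le (by have := hpp1 (p := p); omega)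
      _ = _ := hpi2
  have := pow_lt_pow_right_of_lt_one₀ (hpi0 (p := p)) hpi1 (show 1 < 2 by norm_num)
  rw [pow_one] at this
  linarith

lemma IsR.norm_pow {u π : Qpbar p} (hu : ‖u‖ = 1) (hπ : IsR u π) : ‖π‖ ^ p = (p : ℝ)⁻¹ := by
  have h1 := hπ.norm_gt hu
  have h2 : ‖π + u * p‖ = ‖π‖ := add_eq (by rw [norm_mul, hu, norm_p, one_mul]; exact h1)
  have h3 : ‖π * (π + u * p) ^ (p - 1)‖ = (p : ℝ)⁻¹ := by
    rw [eq_neg_of_add_eq_zero_left hπ, norm_neg, norm_p]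
  rw [norm_mul, _root_.norm_pow, h2, ← pow_succ', hpm] at h3
  exact h3

lemma IsR.pos {u π : Qpbar p} (hu : ‖u‖ = 1) (hπ : IsR u π) : 0 < ‖π‖ := hpi0.trans (hπ.norm_gt hu)

lemma IsR.lt_one {u π : Qpbar p} (hu : ‖u‖ = 1) (hπ : IsR u π) : ‖π‖ < 1 := by
  have h := hπ.norm_pow hu
  by_contra hcon
  push Not at hcon
  have := one_le_pow₀ hcon (n := p)
  rw [h] at this
  exact absurd this (not_le.2 hpi1)


lemma add_pow_diff {c s : Qpbar p} (hc : ‖c‖ ≤ 1) (hs : ‖s‖ ≤ 1) (m : ℕ) :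
    ∃ C : Qpbar p, ‖C‖ ≤ 1 ∧ (c + s) ^ m = c ^ m + s * (m * c ^ (m - 1) + s * C) := by
  induction m with
  | zero => exact ⟨0, by simp, by simp⟩
  | succ m ih =>
    obtain ⟨C, hC, h⟩ := ih
    refine ⟨m * c ^ (m - 1) + c * C + s * C, ?_, ?_⟩
    · have hc' : ∀ k : ℕ, ‖c ^ k‖ ≤ 1 := fun k => by
        rw [norm_pow]; exact pow_le_one₀ (norm_nonneg _) hc
      refine add_le (add_le ?_ ?_) ?_ <;> rw [norm_mul]
      · exact mul_le_one₀ (nat_le _) (norm_nonneg _) (hc' _)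
      · exact mul_le_one₀ hc (norm_nonneg _) hC
      · exact mul_le_one₀ hs (norm_nonneg _) hC
    · rw [pow_succ, h, Nat.add_sub_cancel]
      rcases m with _ | m
      · simp; ring
      · push_cast
        ring

/-- key estimate for two roots -/
lemma key (hp : Odd p) {u π s : Qpbar p} (hu : ‖u‖ = 1) (hπ : IsR u π) (hπ' : IsR u (π * (1 + s)))
    (hs0 : s ≠ 0) : ‖s‖ ≤ ‖π‖ ∧ ‖s ^ (p - 1) + u * p / π‖ ≤ ‖π‖ ^ p := by
  have hr0 := hπ.pos hu
  have hr1 := hπ.lt_one hu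
  have hrp := hπ.norm_pow hu
  have hπ0 : π ≠ 0 := norm_pos_iff.1 hr0
  set r := ‖π‖ with hr
  set ε := u * p / π with hε
  have hpp := hpp1 (p := p)
  have hεn : ‖ε‖ = r ^ (p - 1) := by
    rw [hε, norm_div, norm_mul, hu, norm_p, one_mul, ← hrp, div_eq_iff hr0.ne', ← pow_succ, hpm]
  have hεr : ‖ε‖ ≤ r := by
    rw [hεn]; exact pow_le_of_le_one hr0.le hr1.le (by omega)
  have hs1 : ‖1 + s‖ = 1 := by
    have h1 := hπ'.norm_pow hu
    rw [norm_mul, mul_pow, ← hr, hrp] at h1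
    have h2 : ‖1 + s‖ ^ p = 1 := by
      have := hpi0 (p := p)
      field_simp at h1
      simpa using h1
    exact (pow_eq_one_iff_of_nonneg (norm_nonneg _) (by omega)).1 h2
  have hs : ‖s‖ ≤ 1 := by
    have := sub_le hs1.le (norm_one (α := Qpbar p)).le
    rwa [add_sub_cancel_left] at this
  have hc : ‖1 + ε‖ ≤ 1 := add_le norm_one.le (hεr.trans hr1.le)
  have e1 : (1 + s) * (1 + ε + s) ^ (p - 1) = (1 + ε) ^ (p - 1) := by
    have h1 := eq_neg_of_add_eq_zero_left hπ
    have h2 := eq_neg_of_add_eq_zero_left hπ'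
    have hup : u * p = π * ε := by rw [hε]; field_simp
    rw [hup] at h1 h2
    have e2 : π + π * ε = π * (1 + ε) := by ring
    have e3 : π * (1 + s) + π * ε = π * (1 + ε + s) := by ring
    rw [e2, mul_pow] at h1
    rw [e3, mul_pow] at h2
    have h3 : π * π ^ (p - 1) ≠ 0 := mul_ne_zero hπ0 (pow_ne_zero _ hπ0)
    apply mul_left_cancel₀ h3
    calc _ = π * (1 + s) * (π ^ (p - 1) * (1 + ε + s) ^ (p - 1)) := by ring
      _ = _ := by rw [h2, ← h1]; ring
  obtain ⟨B, hB, e2⟩ := add_pow_diff hc hs (p - 1)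
  have e3 := add_pow_prime_eq (Fact.out : p.Prime) (1 + ε) s
  set A := ∑ k ∈ Finset.Ioo 0 p, (1 + ε) ^ (k - 1) * s ^ (p - k - 1) * ((p.choose k / p : ℕ) : Qpbar p) with hA
  have hAn : ‖A‖ ≤ 1 := by
    apply IsUltrametricDist.norm_sum_le_of_forall_le_of_nonneg zero_le_one
    intro k _
    rw [norm_mul, norm_mul, norm_pow, norm_pow]
    exact mul_le_one₀ (mul_le_one₀ (pow_le_one₀ (norm_nonneg _) hc) (by positivity)
      (pow_le_one₀ (norm_nonneg _) hs)) (norm_nonneg _) (nat_le _)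
  set D := ((p - 1 : ℕ) : Qpbar p) * (1 + ε) ^ (p - 1 - 1) + s * B with hD
  have e4 : s ^ (p - 1) + p * (1 + ε) * A = ε * D := by
    apply mul_left_cancel₀ hs0
    have h1 : (1 + ε + s) ^ p - (1 + ε) ^ p = ε * ((1 + ε + s) ^ (p - 1) - (1 + ε) ^ (p - 1)) := by
      have a1 : (1 + ε + s) ^ p = (1 + ε + s) ^ (p - 1) * (1 + ε + s) := by rw [← pow_succ, hpm]
      have a2 : (1 + ε) ^ p = (1 + ε) ^ (p - 1) * (1 + ε) := by rw [← pow_succ, hpm]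
      rw [a1, a2]
      linear_combination e1
    have a3 : s ^ p = s * s ^ (p - 1) := by rw [← pow_succ', hpm]
    rw [e3, e2, a3] at h1
    linear_combination h1
  have hpA : ‖p * (1 + ε) * A‖ ≤ r ^ p := by
    rw [norm_mul, norm_mul, norm_p, hrp, mul_assoc]
    exact mul_le_of_le_one_right hpi0.le (mul_le_one₀ hc (norm_nonneg _) hAn)
  have hcp : ∀ k : ℕ, ‖(1 + ε) ^ k‖ ≤ 1 := fun k => by
    rw [norm_pow]; exact pow_le_one₀ (norm_nonneg _) hc
  have hDn : ‖D‖ ≤ 1 := by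
    apply add_le <;> rw [norm_mul]
    · exact mul_le_one₀ (nat_le _) (norm_nonneg _) (hcp _)
    · exact mul_le_one₀ hs (norm_nonneg _) hB
  have hsr : ‖s‖ ≤ r := by
    have h1 : ‖s ^ (p - 1)‖ ≤ r ^ (p - 1) := by
      rw [eq_sub_of_add_eq e4]
      apply sub_le
      · rw [norm_mul, hεn]; exact mul_le_of_le_one_right (by positivity) hDn
      · exact hpA.trans (pow_le_pow_of_le_one hr0.le hr1.le (by omega))
    rw [norm_pow] at h1
    exact le_of_pow_le_pow_left₀ (by omega) hr0.le h1
  refine ⟨hsr, ?_⟩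
  have hD1 : ‖D + 1‖ ≤ r := by
    have e5 : D + 1 = (p - 1 : ℕ) * ((1 + ε) ^ (p - 1 - 1) - 1) + s * B + p := by
      rw [hD]
      have : (p : Qpbar p) = (p - 1 : ℕ) + 1 := by
        conv_lhs => rw [show (p : Qpbar p) = ((p : ℕ) : Qpbar p) from rfl]
        exact_mod_cast hpm.symm
      rw [this]; ring
    rw [e5]
    apply add_le (add_le _ _)
    · rw [norm_p, ← hrp]; exact pow_le_of_le_one hr0.le hr1.le (by omega)
    · rw [norm_mul]
      obtain ⟨C, hC, e6⟩ := add_pow_diff (norm_one (α := Qpbar p)).le (hεr.trans hr1.le) (p - 1 - 1)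
      rw [e6, one_pow, add_sub_cancel_left, norm_mul]
      refine (mul_le_of_le_one_left (by positivity) (nat_le _)).trans ?_
      refine (mul_le_of_le_one_right (norm_nonneg _) ?_).trans hεr
      apply add_le <;> rw [norm_mul]
      · rw [one_pow, norm_one, mul_one]; exact nat_le _
      · exact mul_le_one₀ (hεr.trans hr1.le) (norm_nonneg _) hC
    · rw [norm_mul]
      exact (mul_le_of_le_one_right (norm_nonneg _) hB).trans hsr
  have e7 : s ^ (p - 1) + ε = ε * (D + 1) - p * (1 + ε) * A := by linear_combination e4
  rw [e7]
  apply sub_le _ hpA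
  rw [norm_mul, hεn]
  calc _ ≤ r ^ (p - 1) * r := by gcongr
    _ = r ^ p := by rw [← pow_succ, hpm]

lemma root_unique (hp : Odd p) {u π s : Qpbar p} (hu : ‖u‖ = 1) (hπ : IsR u π)
    (hπ' : IsR u (π * (1 + s))) (hs : ‖s‖ < ‖π‖) : s = 0 := by
  by_contra h0
  have hr0 := hπ.pos hu
  have hr1 := hπ.lt_one hu
  have hpp := hpp1 (p := p)
  have hεn : ‖u * p / π‖ = ‖π‖ ^ (p - 1) := by
    rw [norm_div, norm_mul, hu, norm_p, one_mul, ← hπ.norm_pow hu, div_eq_iff hr0.ne', ← pow_succ, hpm]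
  have h1 := (key hp hu hπ hπ' h0).2
  have h2 : ‖s ^ (p - 1)‖ < ‖u * p / π‖ := by
    rw [norm_pow, hεn]
    exact pow_lt_pow_left₀ hs (norm_nonneg _) (by omega)
  rw [add_comm, add_eq h2, hεn] at h1
  have := pow_lt_pow_right_of_lt_one₀ hr0 hr1 (show p - 1 < p by omega)
  linarith

lemma root_approx (hp : Odd p) {u v π s : Qpbar p} (hv : ‖v‖ = 1) (huv : u * v ^ p = v) (hπ : IsR u π)
    (hπ' : IsR u (π * (1 + s))) : ∃ t : Qpbar p, t ^ p = t ∧ ‖s - π * v⁻¹ * t‖ < ‖π‖ := by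
  have hu : ‖u‖ = 1 := by
    have := congrArg norm huv
    rwa [norm_mul, norm_pow, hv, one_pow, mul_one] at this
  rcases eq_or_ne s 0 with rfl | hs0
  · exact ⟨0, zero_pow (Fact.out : p.Prime).ne_zero, by simpa using hπ.pos hu⟩
  have hr0 := hπ.pos hu
  have hr1 := hπ.lt_one hu
  have hpp := hpp1 (p := p)
  have hv0 : v ≠ 0 := norm_pos_iff.1 (by rw [hv]; norm_num)
  have hπ0 : π ≠ 0 := norm_pos_iff.1 hr0
  obtain ⟨hs, h1⟩ := key hp hu hπ hπ' hs0
  have hεn : ‖u * p / π‖ = ‖π‖ ^ (p - 1) := by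
    rw [norm_div, norm_mul, hu, norm_p, one_mul, ← hπ.norm_pow hu, div_eq_iff hr0.ne', ← pow_succ, hpm]
  have hεr : ‖u * p / π‖ ≤ ‖π‖ := by
    rw [hεn]; exact pow_le_of_le_one hr0.le hr1.le (by omega)
  set ε := u * p / π with hε
  set Y := s / π with hY
  have hsY : s = π * Y := by rw [hY]; field_simp
  have hYn : ‖Y‖ ≤ 1 := by rw [hY, norm_div]; exact div_le_one_of_le₀ hs hr0.le
  have hεeq : ε = - (u * π ^ (p - 1) * (1 + ε) ^ (p - 1)) := by
    have h2 := eq_neg_of_add_eq_zero_left hπ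
    have hup : u * p = π * ε := by rw [hε]; field_simp
    rw [hup] at h2
    have e2 : π + π * ε = π * (1 + ε) := by ring
    rw [e2, mul_pow] at h2
    apply mul_left_cancel₀ hπ0
    rw [← hup]
    linear_combination u * h2
  obtain ⟨C, hC, e6⟩ := add_pow_diff (norm_one (α := Qpbar p)).le (hεr.trans hr1.le) (p - 1)
  have hc : ‖(1 + ε) ^ (p - 1) - 1‖ ≤ ‖π‖ := by
    rw [e6, one_pow, add_sub_cancel_left, norm_mul]
    refine (mul_le_of_le_one_right (norm_nonneg _) ?_).trans hεr
    apply add_le <;> rw [norm_mul]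
    · rw [one_pow, norm_one, mul_one]; exact nat_le _
    · exact mul_le_one₀ (hεr.trans hr1.le) (norm_nonneg _) hC
  have hYu : ‖Y ^ (p - 1) - u‖ ≤ ‖π‖ := by
    have e : Y ^ (p - 1) - u = (s ^ (p - 1) + ε) / π ^ (p - 1) + u * ((1 + ε) ^ (p - 1) - 1) := by
      rw [hsY, mul_pow]
      have hq : π ^ (p - 1) ≠ 0 := pow_ne_zero _ hπ0
      conv_rhs => rw [add_div, mul_div_cancel_left₀ _ hq]
      have : ε / π ^ (p - 1) = - (u * (1 + ε) ^ (p - 1)) := by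
        rw [div_eq_iff hq]; conv_lhs => rw [hεeq]
        ring
      rw [this]; ring
    rw [e]
    apply add_le
    · rw [norm_div, norm_pow π, div_le_iff₀ (pow_pos hr0 _), ← pow_succ', hpm]
      exact h1
    · rw [norm_mul, hu, one_mul]; exact hc
  obtain ⟨t, ht, ht'⟩ := approx_root (m := p) hpp (x := v * Y) (by
    have e : (v * Y) ^ p - v * Y = v ^ p * (Y * (Y ^ (p - 1) - u)) := by
      have : Y ^ p = Y * Y ^ (p - 1) := by rw [← pow_succ', hpm]
      rw [mul_pow, this]
      linear_combination Y * huv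
    rw [e, norm_mul, norm_pow, hv, one_pow, one_mul, norm_mul]
    exact (mul_le_of_le_one_left (norm_nonneg _) hYn).trans_lt (hYu.trans_lt hr1))
  refine ⟨t, ht, ?_⟩
  have e : s - π * v⁻¹ * t = π * (v⁻¹ * (v * Y - t)) := by
    rw [hsY]; field_simp
  rw [e, norm_mul, norm_mul, norm_inv, hv, inv_one, one_mul]
  exact mul_lt_of_lt_one_right hr0 ht'

lemma norm_aut (σ : Qpbar p ≃ₐ[Kur p d] Qpbar p) (x : Qpbar p) : ‖σ x‖ = ‖x‖ := by
  apply norm_eq_of_minpoly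
  exact minpoly.algEquiv_eq (σ.restrictScalars ℚ_[p]) x

lemma isGaloisK : IsGalois (Kur p d) (Qpbar p) := by
  have : Algebra.IsAlgebraic (Kur p d) (Qpbar p) := Algebra.IsAlgebraic.tower_top (K := ℚ_[p]) _
  have : Normal (Kur p d) (Qpbar p) := Normal.tower_top_of_normal ℚ_[p] _ _
  exact ⟨⟩

lemma roots_adjoin (hp : Odd p) {u v π π' : Qpbar p} (hv : v ^ (p ^ d - 1) = 1) (hd : 0 < d)
    (huv : u * v ^ p = v) (hπ : IsR u π) (hπ' : IsR u π') :
    π' ∈ (Kur p d)⟮π⟯ := by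
  have hvn := norm_root_one (q_pos hd) hv
  have hu : ‖u‖ = 1 := by
    have := congrArg norm huv
    rwa [norm_mul, norm_pow, hvn, one_pow, mul_one] at this
  have hr0 := hπ.pos hu
  have hr1 := hπ.lt_one hu
  have hpp := hpp1 (p := p)
  have hv0 : v ≠ 0 := norm_pos_iff.1 (by rw [hvn]; norm_num)
  have hvK : v ∈ Kur p d := root_mem hv
  have huK : u ∈ Kur p d := by
    have : u = v * (v ^ p)⁻¹ := by
      rw [eq_mul_inv_iff_mul_eq₀ (pow_ne_zero _ hv0)]; exact huv
    rw [this]; exact mul_mem hvK (inv_mem (pow_mem hvK _))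
  have hπ0 : π ≠ 0 := norm_pos_iff.1 hr0
  obtain ⟨s, rfl⟩ : ∃ s, π' = π * (1 + s) := ⟨π' / π - 1, by field_simp; ring⟩
  obtain ⟨t, ht, hst⟩ := root_approx hp hvn huv hπ hπ'
  have htK : t ∈ Kur p d := q_mem (pfix_qfix ht d)
  have := isGaloisK (p := p) (d := d)
  rw [← InfiniteGalois.fixedField_fixingSubgroup (Kur p d)⟮π⟯, IntermediateField.mem_fixedField_iff]
  intro σ hσ
  have hσπ : σ π = π := by
    rw [IntermediateField.mem_fixingSubgroup_iff] at hσ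
    exact hσ π (mem_adjoin_simple_self _ _)
  have hσK : ∀ x : Qpbar p, x ∈ Kur p d → σ x = x := fun x hx => σ.commutes ⟨x, hx⟩
  have h1 : ‖σ s - s‖ < ‖π‖ := by
    have h2 := norm_aut σ (s - π * v⁻¹ * t)
    rw [map_sub, map_mul, map_mul, map_inv₀, hσK v hvK, hσK t htK, hσπ] at h2
    have h3 := sub_lt (h2.trans_lt hst) hst
    rwa [sub_sub_sub_cancel_right] at h3
  have hnorm : ‖1 + s‖ = 1 := by
    have h1 := hπ'.norm_pow hu
    rw [norm_mul, mul_pow, hπ.norm_pow hu] at h1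
    have h2 : ‖1 + s‖ ^ p = 1 := by
      have := hpi0 (p := p)
      field_simp at h1
      simpa using h1
    exact (pow_eq_one_iff_of_nonneg (norm_nonneg _) (by omega)).1 h2
  have hs1 : 1 + s ≠ 0 := norm_pos_iff.1 (by rw [hnorm]; norm_num)
  have hR : IsR u (σ (π * (1 + s))) := by
    have h4 := congrArg σ hπ'
    rw [map_add, map_mul, map_pow, map_add, map_mul σ u, hσK u huK, map_natCast, map_zero] at h4
    exact h4
  have e : σ (π * (1 + s)) = π * (1 + s) * (1 + (σ s - s) / (1 + s)) := by
    rw [map_mul, map_add, map_one, hσπ]; field_simp; ring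
  rw [e] at hR
  have h5 := root_unique hp hu hπ' hR (by
    rw [norm_div, norm_mul, hnorm, mul_one, div_one]; exact h1)
  show σ (π * (1 + s)) = _
  rw [e, h5]; ring

end S4


namespace S4
variable {p} {d : ℕ}

lemma psi_gen {F : Type*} [Field F] (a b : F) : (X * (X + C a) ^ (p - 1) + C b : F[X]).Monic ∧
    (X * (X + C a) ^ (p - 1) + C b : F[X]).natDegree = p := by
  have hm : (X * (X + C a) ^ (p - 1) : F[X]).Monic := monic_X.mul ((monic_X_add_C a).pow _)
  have hn : (X * (X + C a) ^ (p - 1) : F[X]).natDegree = p := by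
    rw [monic_X.natDegree_mul ((monic_X_add_C a).pow _), (monic_X_add_C a).natDegree_pow,
      natDegree_X, natDegree_X_add_C, mul_one, add_comm, hpm]
  refine ⟨hm.add_of_left ?_, by rw [natDegree_add_C, hn]⟩
  refine degree_C_le.trans_lt ?_
  rw [degree_eq_natDegree hm.ne_zero, hn]
  exact_mod_cast (Fact.out : p.Prime).pos

lemma exists_root (u : Qpbar p) : ∃ π, IsR u π := by
  obtain ⟨x, hx⟩ := IsAlgClosed.exists_root (psiPoly p u) (by
    obtain ⟨h1, h2⟩ := psi_gen (p := p) (u * p) (p : Qpbar p)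
    intro h
    have := natDegree_eq_of_degree_eq_some (n := 0) h
    rw [psiPoly, h2] at this
    exact (Fact.out : p.Prime).ne_zero this)
  exact ⟨x, isR_iff.1 hx⟩

lemma term_val (hd : 0 < d) {u π : Qpbar p} (hu : ‖u‖ = 1) (hπ : IsR u π) (a : Kur p d) (ha : a ≠ 0) (i : ℕ) :
    ∃ m : ℤ, ‖(a : Qpbar p) * π ^ i‖ = ‖π‖ ^ (p * m + i) := by
  have hr0 := hπ.pos hu
  obtain ⟨m, hm⟩ := K_val hd a.2 (by simpa using ha)
  refine ⟨-m, ?_⟩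
  have hpr : (p : ℝ) = ‖π‖ ^ (-(p : ℤ)) := by
    rw [zpow_neg, zpow_natCast, hπ.norm_pow hu, inv_inv]
  rw [norm_mul, norm_pow, hm, zpow_add₀ hr0.ne', zpow_natCast]
  congr 1
  conv_lhs => rw [hpr]
  rw [← zpow_mul]
  congr 1
  ring

lemma term_ne (hd : 0 < d) {u π : Qpbar p} (hu : ‖u‖ = 1) (hπ : IsR u π) {a b : Kur p d} (ha : a ≠ 0)
    (hb : b ≠ 0) {i j : ℕ} (hi : i < p) (hj : j < p) (hij : i ≠ j) :
    ‖(a : Qpbar p) * π ^ i‖ ≠ ‖(b : Qpbar p) * π ^ j‖ := by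
  have hr0 := hπ.pos hu
  have hr1 := hπ.lt_one hu
  obtain ⟨m, hm⟩ := term_val hd hu hπ a ha i
  obtain ⟨n, hn⟩ := term_val hd hu hπ b hb j
  rw [hm, hn]
  intro h
  have := zpow_right_injective₀ hr0 hr1.ne h
  have h2 : (p : ℤ) ∣ (i : ℤ) - j := ⟨n - m, by linear_combination this⟩
  have h3 := Int.eq_zero_of_abs_lt_dvd h2 (by rw [abs_lt]; constructor <;> omega)
  omega

lemma sum_norm (hd : 0 < d) {u π : Qpbar p} (hu : ‖u‖ = 1) (hπ : IsR u π) (a : ℕ → Kur p d) {j₀ : ℕ}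
    (hj₀ : j₀ < p) (ha₀ : a j₀ ≠ 0) : ∃ j < p, a j ≠ 0 ∧
      ‖∑ i ∈ Finset.range p, (a i : Qpbar p) * π ^ i‖ = ‖(a j : Qpbar p) * π ^ j‖ ∧
      ∀ i < p, i ≠ j → ‖(a i : Qpbar p) * π ^ i‖ < ‖(a j : Qpbar p) * π ^ j‖ := by
  have hr0 := hπ.pos hu
  have hπ0 : π ≠ 0 := norm_pos_iff.1 hr0
  obtain ⟨j, hj, hmax⟩ := Finset.exists_max_image (Finset.range p) (fun i => ‖(a i : Qpbar p) * π ^ i‖)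
    ⟨j₀, Finset.mem_range.2 hj₀⟩
  rw [Finset.mem_range] at hj
  have hpos : 0 < ‖(a j : Qpbar p) * π ^ j‖ := by
    refine lt_of_lt_of_le ?_ (hmax j₀ (Finset.mem_range.2 hj₀))
    rw [norm_pos_iff]
    exact mul_ne_zero (by simpa using ha₀) (pow_ne_zero _ hπ0)
  have haj : a j ≠ 0 := by
    intro h; rw [h] at hpos; simp at hpos
  have hlt : ∀ i < p, i ≠ j → ‖(a i : Qpbar p) * π ^ i‖ < ‖(a j : Qpbar p) * π ^ j‖ := by
    intro i hi hij
    by_cases hai : a i = 0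
    · rw [hai]; simpa using hpos
    exact lt_of_le_of_ne (hmax i (Finset.mem_range.2 hi)) (term_ne hd hu hπ hai haj hi hj hij)
  refine ⟨j, hj, haj, ?_, hlt⟩
  rw [← Finset.add_sum_erase _ _ (Finset.mem_range.2 hj)]
  apply add_eq
  rcases (Finset.range p |>.erase j).eq_empty_or_nonempty with he | he
  · rw [he]; simpa using hpos
  · obtain ⟨i, hi, hle⟩ := IsUltrametricDist.exists_norm_finset_sum_le_of_nonempty he (fun i => (a i : Qpbar p) * π ^ i)
    rw [Finset.mem_erase, Finset.mem_range] at hi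
    exact hle.trans_lt (hlt i hi.2 hi.1)

lemma psiK_root {u π : Qpbar p} (huK : u ∈ Kur p d) (hπ : IsR u π) :
    aeval π (X * (X + C ((⟨u, huK⟩ : Kur p d) * (p : Kur p d))) ^ (p - 1) + C (p : Kur p d)) = 0 := by
  simp only [map_add, map_mul, map_pow, aeval_X, aeval_C]
  exact hπ

lemma int_π {π : Qpbar p} : IsIntegral (Kur p d) π := by
  have : Algebra.IsAlgebraic (Kur p d) (Qpbar p) := Algebra.IsAlgebraic.tower_top (K := ℚ_[p]) _
  exact Algebra.IsIntegral.isIntegral π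

lemma rep {u π x : Qpbar p} (huK : u ∈ Kur p d) (hπ : IsR u π) (hx : x ∈ (Kur p d)⟮π⟯) :
    ∃ a : ℕ → Kur p d, x = ∑ i ∈ Finset.range p, (a i : Qpbar p) * π ^ i := by
  have h1 : x ∈ Algebra.adjoin (Kur p d) {π} := by
    rw [← IntermediateField.adjoin_simple_toSubalgebra_of_isAlgebraic (int_π (p := p) (d := d) (π := π)).isAlgebraic]
    exact hx
  rw [Algebra.adjoin_singleton_eq_range_aeval] at h1
  obtain ⟨f, hf⟩ := h1
  obtain ⟨hm, hn⟩ := psi_gen (p := p) ((⟨u, huK⟩ : Kur p d) * (p : Kur p d)) (p : Kur p d)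
  have h0 := psiK_root huK hπ
  set ψ := (X * (X + C ((⟨u, huK⟩ : Kur p d) * (p : Kur p d))) ^ (p - 1) + C (p : Kur p d)) with hψ
  refine ⟨fun i => (f %ₘ ψ).coeff i, ?_⟩
  have hlt : (f %ₘ ψ).natDegree < p := by
    conv_rhs => rw [← hn]
    exact natDegree_modByMonic_lt f hm (by
      intro h; rw [h, natDegree_one] at hn; exact (Fact.out : p.Prime).ne_zero hn.symm)
  have h2 := aeval_modByMonic_eq_self_of_root (p := f) h0
  rw [← hf]
  show aeval π f = _
  rw [← h2, aeval_eq_sum_range' hlt]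
  rfl

lemma L_val (hd : 0 < d) {u π x : Qpbar p} (huK : u ∈ Kur p d) (hu : ‖u‖ = 1) (hπ : IsR u π)
    (hx : x ∈ (Kur p d)⟮π⟯) (h0 : x ≠ 0) : ∃ n : ℤ, ‖x‖ = ‖π‖ ^ n := by
  obtain ⟨a, ha⟩ := rep huK hπ hx
  obtain ⟨j₀, hj, hj'⟩ : ∃ j < p, a j ≠ 0 := by
    by_contra hcon
    push Not at hcon
    apply h0
    rw [ha]
    apply Finset.sum_eq_zero
    intro i hi
    rw [hcon i (Finset.mem_range.1 hi)]; simp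
  obtain ⟨j, _, haj, hn, _⟩ := sum_norm hd hu hπ a hj hj'
  obtain ⟨m, hm⟩ := term_val hd hu hπ (a j) haj j
  exact ⟨_, by rw [ha, hn, hm]⟩

lemma L_small (hd : 0 < d) {u π x : Qpbar p} (huK : u ∈ Kur p d) (hu : ‖u‖ = 1) (hπ : IsR u π)
    (hx : x ∈ (Kur p d)⟮π⟯) (h : ‖x‖ < 1) : ‖x‖ ≤ ‖π‖ := by
  by_cases h0 : x = 0
  · rw [h0, norm_zero]; exact norm_nonneg _
  obtain ⟨n, hn⟩ := L_val hd huK hu hπ hx h0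
  have hr0 := hπ.pos hu
  have hr1 := hπ.lt_one hu
  rw [hn] at h ⊢
  have h2 : 0 < n := by
    by_contra hcon
    push Not at hcon
    exact absurd h (not_lt.2 (one_le_zpow_of_nonpos₀ hr0 hr1.le hcon))
  calc _ ≤ ‖π‖ ^ (1 : ℤ) := zpow_le_zpow_right_of_le_one₀ hr0 hr1.le (by omega)
    _ = _ := zpow_one _

lemma L_approx (hd : 0 < d) {u π x : Qpbar p} (huK : u ∈ Kur p d) (hu : ‖u‖ = 1) (hπ : IsR u π)
    (hx : x ∈ (Kur p d)⟮π⟯) (h : ‖x‖ ≤ 1) : ∃ b : Kur p d, ‖(b : Qpbar p)‖ ≤ 1 ∧ ‖x - b‖ ≤ ‖π‖ := by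
  rcases h.lt_or_eq with h1 | h1
  · exact ⟨0, by simp, by simpa using L_small hd huK hu hπ hx h1⟩
  obtain ⟨a, ha⟩ := rep huK hπ hx
  obtain ⟨j₀, hj, hj'⟩ : ∃ j < p, a j ≠ 0 := by
    by_contra hcon
    push Not at hcon
    have : x = 0 := by
      rw [ha]
      apply Finset.sum_eq_zero
      intro i hi
      rw [hcon i (Finset.mem_range.1 hi)]; simp
    rw [this] at h1; simp at h1
  obtain ⟨j, hj, haj, hn, hlt⟩ := sum_norm hd hu hπ a hj hj'
  rw [← ha, h1] at hn
  have hj0 : j = 0 := by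
    by_contra hne
    have := term_ne hd hu hπ haj one_ne_zero hj (Fact.out : p.Prime).pos hne
    apply this
    rw [← hn]; simp
  subst hj0
  refine ⟨a 0, by simpa using hn.symm.le, ?_⟩
  apply L_small hd huK hu hπ
  · exact sub_mem hx ((Kur p d)⟮π⟯.algebraMap_mem (a 0))
  · have h0 : (0 : ℕ) ∈ Finset.range p := Finset.mem_range.2 hj
    rw [ha, ← Finset.add_sum_erase _ _ h0, pow_zero, mul_one, add_sub_cancel_left]
    rcases (Finset.range p |>.erase 0).eq_empty_or_nonempty with he | he
    · rw [he]; simp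
    · obtain ⟨i, hi, hle⟩ := IsUltrametricDist.exists_norm_finset_sum_le_of_nonempty he (fun i => (a i : Qpbar p) * π ^ i)
      rw [Finset.mem_erase, Finset.mem_range] at hi
      have := hlt i hi.2 hi.1
      rw [← hn] at this
      exact hle.trans_lt this

lemma finrankL (hd : 0 < d) {u π : Qpbar p} (huK : u ∈ Kur p d) (hu : ‖u‖ = 1) (hπ : IsR u π) :
    Module.finrank (Kur p d) (Kur p d)⟮π⟯ = p := by
  rw [IntermediateField.adjoin.finrank (int_π (p := p) (d := d) (π := π))]
  obtain ⟨hm, hn⟩ := psi_gen (p := p) ((⟨u, huK⟩ : Kur p d) * (p : Kur p d)) (p : Kur p d)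
  have h0 := psiK_root huK hπ
  apply le_antisymm
  · exact (natDegree_le_natDegree (minpoly.min _ _ hm h0)).trans hn.le
  · by_contra hcon
    push Not at hcon
    have h1 := minpoly.aeval (Kur p d) π
    have hmon := minpoly.monic (int_π (p := p) (d := d) (π := π))
    rw [aeval_eq_sum_range' hcon] at h1
    obtain ⟨j, _, haj, hh, _⟩ := sum_norm hd hu hπ (fun i => (minpoly (Kur p d) π).coeff i) hcon (by
      show (minpoly (Kur p d) π).coeff _ ≠ 0
      rw [hmon.coeff_natDegree]; exact one_ne_zero)
    have h2 : ∑ i ∈ Finset.range p, (((minpoly (Kur p d) π).coeff i : Kur p d) : Qpbar p) * π ^ i = 0 := h1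
    rw [h2, norm_zero, eq_comm, norm_eq_zero] at hh
    have hπ0 : π ≠ 0 := norm_pos_iff.1 (hπ.pos hu)
    exact mul_ne_zero (by simpa using haj) (pow_ne_zero _ hπ0) hh

lemma norm_emb {L : IntermediateField (Kur p d) (Qpbar p)} (σ : L →ₐ[Kur p d] Qpbar p) (x : L) :
    ‖σ x‖ = ‖(x : Qpbar p)‖ := by
  apply norm_eq_of_minpoly
  have h1 := minpoly.algHom_eq (σ.restrictScalars ℚ_[p]) σ.toRingHom.injective x
  have h2 := minpoly.algHom_eq (L.val.restrictScalars ℚ_[p]) L.val.toRingHom.injective x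
  exact h1.trans h2.symm

/-- the generator -/
noncomputable def gen (d : ℕ) (π : Qpbar p) : (Kur p d)⟮π⟯ := ⟨π, mem_adjoin_simple_self _ _⟩

noncomputable instance fdL (π : Qpbar p) : FiniteDimensional (Kur p d) (Kur p d)⟮π⟯ :=
  IntermediateField.adjoin.finiteDimensional int_π

lemma psi_prod (hd : 0 < d) {u π : Qpbar p} (huK : u ∈ Kur p d) (hu : ‖u‖ = 1) (hπ : IsR u π) (z : Qpbar p) :
    ∏ σ : (Kur p d)⟮π⟯ →ₐ[Kur p d] Qpbar p, (z - σ (gen d π)) = z * (z + u * p) ^ (p - 1) + p := by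
  obtain ⟨hm, hn⟩ := psi_gen (p := p) (u * p) (p : Qpbar p)
  set P : (Qpbar p)[X] := ∏ σ : (Kur p d)⟮π⟯ →ₐ[Kur p d] Qpbar p, (X - C (σ (gen d π))) with hP
  have hPm : P.Monic := monic_prod_of_monic _ _ fun σ _ => monic_X_sub_C _
  have hcard : Fintype.card ((Kur p d)⟮π⟯ →ₐ[Kur p d] Qpbar p) = p := by
    rw [AlgHom.card, finrankL hd huK hu hπ]
  have hPn : P.natDegree = p := by
    rw [hP, natDegree_prod_of_monic _ _ fun σ _ => monic_X_sub_C _]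
    simp [hcard]
  have hinj : Function.Injective fun σ : (Kur p d)⟮π⟯ →ₐ[Kur p d] Qpbar p => σ (gen d π) := by
    intro σ τ h
    apply (adjoin.powerBasis (int_π (p := p) (d := d) (π := π))).algHom_ext
    rw [adjoin.powerBasis_gen]
    exact h
  have hdvd : P ∣ X * (X + C (u * (p : Qpbar p))) ^ (p - 1) + C (p : Qpbar p) := by
    apply Finset.prod_dvd_of_coprime
    · intro σ _ τ _ hστ
      exact pairwise_coprime_X_sub_C hinj hστ
    · intro σ _
      rw [dvd_iff_isRoot]
      have hg : gen d π * (gen d π + algebraMap (Kur p d) _ (⟨u, huK⟩ * p)) ^ (p - 1)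
          + algebraMap (Kur p d) _ (p : Kur p d) = 0 := by
        apply Subtype.ext
        exact hπ
      have h2 := congrArg σ hg
      simp only [map_add, map_mul, map_pow, AlgHom.commutes, map_zero] at h2
      simp only [IsRoot.def, eval_add, eval_mul, eval_X, eval_pow, eval_C]
      exact h2
  have := eq_of_monic_of_dvd_of_natDegree_le hPm hm hdvd (by rw [hn, hPn])
  have h3 := congrArg (eval z) this
  simp only [eval_add, eval_mul, eval_X, eval_pow, eval_C, hP, eval_prod, eval_sub] at h3
  exact h3.symm

end S4


namespace S4
variable {p} {d : ℕ}

lemma cardEmb (hd : 0 < d) {u π : Qpbar p} (huK : u ∈ Kur p d) (hu : ‖u‖ = 1) (hπ : IsR u π) :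
    Fintype.card ((Kur p d)⟮π⟯ →ₐ[Kur p d] Qpbar p) = p := by
  rw [AlgHom.card, finrankL hd huK hu hπ]

lemma prod_lin_eq (hd : 0 < d) {u π : Qpbar p} (huK : u ∈ Kur p d) (hu : ‖u‖ = 1) (hπ : IsR u π)
    (x : Qpbar p) : ∏ σ : (Kur p d)⟮π⟯ →ₐ[Kur p d] Qpbar p, (1 - x * σ (gen d π))
      = (1 + u * p * x) ^ (p - 1) + p * x ^ p := by
  rcases eq_or_ne x 0 with rfl | hx
  · simp [(Fact.out : p.Prime).ne_zero]
  · have h1 : ∀ σ : (Kur p d)⟮π⟯ →ₐ[Kur p d] Qpbar p,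
        1 - x * σ (gen d π) = x * (x⁻¹ - σ (gen d π)) := by
      intro σ; field_simp
    simp_rw [h1]
    rw [Finset.prod_mul_distrib, psi_prod hd huK hu hπ, Finset.prod_const, Finset.card_univ,
      cardEmb hd huK hu hπ, mul_add]
    have h2 : x ^ p = x ^ (p - 1) * x := by rw [← pow_succ, hpm]
    have h3 : x ^ p * (x⁻¹ * (x⁻¹ + u * p) ^ (p - 1)) = (x * (x⁻¹ + u * p)) ^ (p - 1) := by
      rw [h2, mul_pow]; field_simp
    rw [h3]
    congr 1
    · congr 1; field_simp
    · ring

lemma prod_lin (hd : 0 < d) {u π : Qpbar p} (huK : u ∈ Kur p d) (hu : ‖u‖ = 1) (hπ : IsR u π)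
    {x : Qpbar p} (hx : ‖x‖ ≤ 1) :
    ‖∏ σ : (Kur p d)⟮π⟯ →ₐ[Kur p d] Qpbar p, (1 - x * σ (gen d π)) - 1 - p * (x ^ p - u * x)‖
      ≤ (p : ℝ)⁻¹ ^ 2 := by
  have hs : ‖u * p * x‖ ≤ (p : ℝ)⁻¹ := by
    rw [norm_mul, norm_mul, hu, norm_p, one_mul]; exact mul_le_of_le_one_right hpi0.le hx
  obtain ⟨C, hC, e⟩ := add_pow_diff (norm_one (α := Qpbar p)).le (hs.trans hpi1.le) (p - 1)
  have hpc : (p : Qpbar p) = (p - 1 : ℕ) + 1 := by exact_mod_cast hpm.symm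
  rw [prod_lin_eq hd huK hu hπ, e]
  simp only [one_pow, mul_one]
  have e2 : 1 + u * p * x * (((p - 1 : ℕ) : Qpbar p) + u * p * x * C) + p * x ^ p - 1 - p * (x ^ p - u * x)
      = (u * p * x) * p + (u * p * x) * (u * p * x * C) := by
    linear_combination (-(u * p * x)) * hpc
  rw [e2, ← hpi2]
  apply add_le <;> rw [norm_mul]
  · rw [norm_p]; gcongr
  · gcongr
    rw [norm_mul]
    exact (mul_le_of_le_one_right (norm_nonneg _) hC).trans hs

lemma prod_approx {ι : Type*} (s : Finset ι) (f g : ι → Qpbar p) (hg : ∀ i ∈ s, ‖g i‖ ≤ 1)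
    (h : ∀ i ∈ s, ‖f i - 1 - p * g i‖ ≤ (p : ℝ)⁻¹ ^ 2) :
    ‖∏ i ∈ s, f i - 1 - p * ∑ i ∈ s, g i‖ ≤ (p : ℝ)⁻¹ ^ 2 := by
  classical
  induction s using Finset.induction_on with
  | empty => simp
  | insert a s ha ih =>
    rw [Finset.prod_insert ha, Finset.sum_insert ha]
    have ih' := ih (fun i hi => hg i (Finset.mem_insert_of_mem hi)) (fun i hi => h i (Finset.mem_insert_of_mem hi))
    have h1 := h a (Finset.mem_insert_self _ _)
    have g1 := hg a (Finset.mem_insert_self _ _)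
    have gS : ‖∑ i ∈ s, g i‖ ≤ 1 := IsUltrametricDist.norm_sum_le_of_forall_le_of_nonneg zero_le_one
      (fun i hi => hg i (Finset.mem_insert_of_mem hi))
    set P := ∏ i ∈ s, f i
    set S := ∑ i ∈ s, g i
    have hp2 : (p : ℝ)⁻¹ ^ 2 ≤ 1 := pow_le_one₀ hpi0.le hpi1.le
    have hpS : ‖p * S‖ ≤ (p : ℝ)⁻¹ := by
      rw [norm_mul, norm_p]; exact mul_le_of_le_one_right hpi0.le gS
    have hpg : ‖p * g a‖ ≤ (p : ℝ)⁻¹ := by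
      rw [norm_mul, norm_p]; exact mul_le_of_le_one_right hpi0.le g1
    have hP : ‖P‖ ≤ 1 := by
      have : P = (P - 1 - p * S) + (1 + p * S) := by ring
      rw [this]
      exact add_le (ih'.trans hp2) (add_le norm_one.le (hpS.trans hpi1.le))
    have e : f a * P - 1 - p * (g a + S) = (f a - 1 - p * g a) * P + ((1 + p * g a) * (P - 1 - p * S) + p * g a * (p * S)) := by
      ring
    rw [e]
    refine add_le ?_ (add_le ?_ ?_) <;> rw [norm_mul]
    · exact (mul_le_of_le_one_right (norm_nonneg _) hP).trans h1
    · exact (mul_le_of_le_one_left (norm_nonneg _) (add_le norm_one.le (hpg.trans hpi1.le))).trans ih'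
    · rw [← hpi2]; exact mul_le_mul hpg hpS (norm_nonneg _) hpi0.le

lemma sum_roots {k : ℕ} {ζ : Qpbar p} (hk : 0 < k) (hζ : IsPrimitiveRoot ζ k) {m : ℕ} (hm : ¬ k ∣ m) :
    ∑ η ∈ nthRootsFinset k (1 : Qpbar p), η ^ m = 0 := by
  have hζ0 : ζ ≠ 0 := hζ.ne_zero hk.ne'
  have h1 : ∑ η ∈ nthRootsFinset k (1 : Qpbar p), η ^ m
      = ∑ η ∈ nthRootsFinset k (1 : Qpbar p), (ζ * η) ^ m := by
    symm
    apply Finset.sum_nbij' (fun η => ζ * η) (fun η => ζ⁻¹ * η)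
    · intro η hη
      rw [mem_nthRootsFinset hk] at hη ⊢
      rw [mul_pow, hη, hζ.pow_eq_one, one_mul]
    · intro η hη
      rw [mem_nthRootsFinset hk] at hη ⊢
      rw [mul_pow, hη, inv_pow, hζ.pow_eq_one, inv_one, one_mul]
    · intro η _; exact inv_mul_cancel_left₀ hζ0 η
    · intro η _; exact mul_inv_cancel_left₀ hζ0 η
    · intro η _; rfl
  simp_rw [mul_pow] at h1
  rw [← Finset.mul_sum] at h1
  have h2 : ζ ^ m ≠ 1 := fun h => hm ((hζ.pow_eq_one_iff_dvd m).1 h)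
  have h3 : (1 - ζ ^ m) * ∑ η ∈ nthRootsFinset k (1 : Qpbar p), η ^ m = 0 := by
    linear_combination h1
  rcases mul_eq_zero.1 h3 with h | h
  · exact absurd (sub_eq_zero.1 h).symm h2
  · exact h

lemma prod_pow (hd : 0 < d) {u π : Qpbar p} (huK : u ∈ Kur p d) (hu : ‖u‖ = 1) (hπ : IsR u π)
    {b : Qpbar p} (hb : ‖b‖ ≤ 1) {k : ℕ} (hk : 2 ≤ k) :
    ‖∏ σ : (Kur p d)⟮π⟯ →ₐ[Kur p d] Qpbar p, (1 + b * σ (gen d π) ^ k) - 1‖ ≤ (p : ℝ)⁻¹ ^ 2 := by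
  have hk0 : 0 < k := by omega
  have : NeZero (k : Qpbar p) := ⟨by exact_mod_cast hk0.ne'⟩
  have : NeZero k := ⟨hk0.ne'⟩
  obtain ⟨ζ, hζ⟩ := HasEnoughRootsOfUnity.exists_primitiveRoot (Qpbar p) k
  obtain ⟨c, hc⟩ := IsAlgClosed.exists_pow_nat_eq (-b) hk0
  have hcn : ‖c‖ ≤ 1 := by
    by_contra hcon
    push Not at hcon
    have h1 := one_lt_pow₀ hcon hk0.ne'
    rw [← norm_pow, hc, norm_neg] at h1
    linarith
  have h1 : ∀ σ : (Kur p d)⟮π⟯ →ₐ[Kur p d] Qpbar p, 1 + b * σ (gen d π) ^ k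
      = ∏ η ∈ nthRootsFinset k (1 : Qpbar p), (1 - (η * c) * σ (gen d π)) := by
    intro σ
    have := hζ.pow_sub_pow_eq_prod_sub_mul 1 (c * σ (gen d π)) hk0
    rw [one_pow, mul_pow, hc] at this
    simp_rw [mul_assoc]
    rw [← this]; ring
  simp_rw [h1]
  rw [Finset.prod_comm]
  have hη : ∀ η ∈ nthRootsFinset k (1 : Qpbar p), ‖η * c‖ ≤ 1 := by
    intro η hη
    rw [mem_nthRootsFinset hk0] at hη
    rw [norm_mul, norm_root_one hk0.ne' hη, one_mul]; exact hcn
  have h2 := prod_approx (nthRootsFinset k (1 : Qpbar p))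
    (fun η => ∏ σ : (Kur p d)⟮π⟯ →ₐ[Kur p d] Qpbar p, (1 - (η * c) * σ (gen d π)))
    (fun η => (η * c) ^ p - u * (η * c)) (fun η h => sub_le
      (by rw [norm_pow]; exact pow_le_one₀ (norm_nonneg _) (hη η h))
      (by rw [norm_mul, hu, one_mul]; exact hη η h))
    (fun η h => prod_lin hd huK hu hπ (hη η h))
  have hS : ∑ η ∈ nthRootsFinset k (1 : Qpbar p), ((η * c) ^ p - u * (η * c))
      = c ^ p * ∑ η ∈ nthRootsFinset k (1 : Qpbar p), η ^ p := by
    have h3 := sum_roots hk0 hζ (m := 1) (by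
      intro h; have := Nat.le_of_dvd one_pos h; omega)
    simp only [pow_one] at h3
    rw [Finset.sum_sub_distrib, ← Finset.mul_sum, ← Finset.sum_mul, h3, zero_mul, mul_zero, sub_zero,
      Finset.mul_sum]
    apply Finset.sum_congr rfl
    intro η _; ring
  have hSn : ‖∑ η ∈ nthRootsFinset k (1 : Qpbar p), η ^ p‖ ≤ (p : ℝ)⁻¹ := by
    by_cases hkp : k ∣ p
    · have hkp' : k = p := ((Nat.dvd_prime Fact.out).1 hkp).resolve_left (by omega)
      have h4 : ∑ η ∈ nthRootsFinset k (1 : Qpbar p), η ^ p = p := by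
        rw [Finset.sum_congr rfl (g := fun _ => (1 : Qpbar p))]
        · rw [Finset.sum_const, hζ.card_nthRootsFinset, nsmul_eq_mul, mul_one, hkp']
        · intro η h
          rw [mem_nthRootsFinset hk0] at h
          exact (congrArg (fun n : ℕ => η ^ n) hkp').symm.trans h
      rw [h4, norm_p]
    · rw [sum_roots hk0 hζ hkp, norm_zero]; exact hpi0.le
  rw [hS] at h2
  have h5 : ‖(p : Qpbar p) * (c ^ p * ∑ η ∈ nthRootsFinset k (1 : Qpbar p), η ^ p)‖ ≤ (p : ℝ)⁻¹ ^ 2 := by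
    rw [norm_mul, norm_mul, norm_p, norm_pow, ← hpi2]
    gcongr
    exact (mul_le_of_le_one_left (norm_nonneg _) (pow_le_one₀ (norm_nonneg _) hcn)).trans hSn
  have h6 := add_le h2 h5
  rwa [sub_add_cancel] at h6

lemma prod_near_one {ι : Type*} (s : Finset ι) (f : ι → Qpbar p) {r : ℝ} (hr : 0 ≤ r) (hr1 : r ≤ 1)
    (h : ∀ i, ‖f i - 1‖ ≤ r) : ‖∏ i ∈ s, f i - 1‖ ≤ r := by
  classical
  induction s using Finset.induction_on with
  | empty => simpa using hr
  | insert a s ha ih =>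
    rw [Finset.prod_insert ha]
    have e : f a * ∏ i ∈ s, f i - 1 = (f a - 1) * (∏ i ∈ s, f i - 1) + ((f a - 1) + (∏ i ∈ s, f i - 1)) := by
      ring
    rw [e]
    refine add_le ?_ (add_le (h a) ih)
    rw [norm_mul]
    exact (mul_le_of_le_one_left (norm_nonneg _) ((h a).trans hr1)).trans ih

lemma prod_unit (hd : 0 < d) {u π : Qpbar p} (huK : u ∈ Kur p d) (hu : ‖u‖ = 1) (hπ : IsR u π)
    (j : ℕ) : ∀ (k : ℕ), 2 ≤ k → 2 * p ≤ k + j → ∀ x : (Kur p d)⟮π⟯, ‖(x : Qpbar p) - 1‖ ≤ ‖π‖ ^ k →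
    ‖∏ σ : (Kur p d)⟮π⟯ →ₐ[Kur p d] Qpbar p, σ x - 1‖ ≤ (p : ℝ)⁻¹ ^ 2 := by
  have hr0 := hπ.pos hu
  have hr1 := hπ.lt_one hu
  have hπ0 : π ≠ 0 := norm_pos_iff.1 hr0
  induction j with
  | zero =>
    intro k hk hkj x hx
    apply prod_near_one _ _ (by positivity) (pow_le_one₀ hpi0.le hpi1.le)
    intro σ
    have h1 := norm_emb σ (x - 1)
    rw [map_sub, map_one] at h1
    rw [h1]
    refine hx.trans ?_
    rw [← hπ.norm_pow hu, ← pow_mul]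
    exact pow_le_pow_of_le_one hr0.le hr1.le (by omega)
  | succ j ih =>
    intro k hk hkj x hx
    have hzL : ((x : Qpbar p) - 1) / π ^ k ∈ (Kur p d)⟮π⟯ :=
      div_mem (sub_mem x.2 (one_mem _)) (pow_mem (mem_adjoin_simple_self _ _) _)
    obtain ⟨b, hb, hb2⟩ := L_approx hd huK hu hπ hzL (by
      rw [norm_div, norm_pow]; exact div_le_one_of_le₀ hx (by positivity))
    set y : (Kur p d)⟮π⟯ := 1 + algebraMap (Kur p d) _ b * gen d π ^ k with hy
    have hyc : (y : Qpbar p) = 1 + b * π ^ k := rfl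
    have hyn : ‖(y : Qpbar p)‖ = 1 := by
      rw [hyc, add_eq, norm_one]
      rw [norm_one, norm_mul, norm_pow]
      exact (mul_le_of_le_one_left (by positivity) hb).trans_lt (pow_lt_one₀ hr0.le hr1 (by omega))
    have hy0 : y ≠ 0 := by
      intro h; rw [h] at hyn; simp at hyn
    have hxy : ‖((x / y : (Kur p d)⟮π⟯) : Qpbar p) - 1‖ ≤ ‖π‖ ^ (k + 1) := by
      have hy0' : (y : Qpbar p) ≠ 0 := by simpa using hy0
      have e : ((x / y : (Kur p d)⟮π⟯) : Qpbar p) - 1 = π ^ k * ((((x : Qpbar p) - 1) / π ^ k) - b) / y := by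
        have e1 : ((x / y : (Kur p d)⟮π⟯) : Qpbar p) = (x : Qpbar p) / y := rfl
        rw [e1, div_sub_one hy0', mul_sub, mul_div_cancel₀ _ (pow_ne_zero _ hπ0), hyc]
        congr 1; ring
      rw [e, norm_div, hyn, div_one, norm_mul, norm_pow, pow_succ]
      gcongr
    have h1 := ih (k + 1) (by omega) (by omega) (x / y) hxy
    have h2 := prod_pow hd huK hu hπ hb hk
    have h3 : ∀ σ : (Kur p d)⟮π⟯ →ₐ[Kur p d] Qpbar p, σ x = σ (x / y) * (1 + b * σ (gen d π) ^ k) := by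
      intro σ
      have : x = (x / y) * y := (div_mul_cancel₀ x hy0).symm
      conv_lhs => rw [this, map_mul, hy, map_add, map_one, map_mul, AlgHom.commutes, map_pow]
      rfl
    simp_rw [h3]
    rw [Finset.prod_mul_distrib]
    set P := ∏ σ : (Kur p d)⟮π⟯ →ₐ[Kur p d] Qpbar p, σ (x / y)
    set Q := ∏ σ : (Kur p d)⟮π⟯ →ₐ[Kur p d] Qpbar p, (1 + b * σ (gen d π) ^ k)
    have e : P * Q - 1 = (P - 1) * (Q - 1) + ((P - 1) + (Q - 1)) := by ring
    rw [e]
    refine add_le ?_ (add_le h1 h2)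
    rw [norm_mul]
    exact (mul_le_of_le_one_left (norm_nonneg _) (h1.trans (pow_le_one₀ hpi0.le hpi1.le))).trans h2

end S4


namespace S4
variable {p} {d : ℕ}

lemma norm_prod {π : Qpbar p} (x : (Kur p d)⟮π⟯) :
    ((Algebra.norm (Kur p d) x : Kur p d) : Qpbar p) = ∏ σ : (Kur p d)⟮π⟯ →ₐ[Kur p d] Qpbar p, σ x :=
  Algebra.norm_eq_prod_embeddings (Kur p d) (Qpbar p) x

lemma norm_gen (hd : 0 < d) {u π : Qpbar p} (huK : u ∈ Kur p d) (hu : ‖u‖ = 1) (hπ : IsR u π) :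
    Algebra.norm (Kur p d) (-gen d π) = (p : Kur p d) := by
  apply Subtype.ext
  rw [norm_prod]
  have := psi_prod hd huK hu hπ 0
  rw [zero_mul, zero_add] at this
  simp only [map_neg]
  simp only [zero_sub] at this
  rw [this]; rfl

lemma norm_gen_zpow (hd : 0 < d) {u π : Qpbar p} (huK : u ∈ Kur p d) (hu : ‖u‖ = 1) (hπ : IsR u π)
    (n : ℤ) : Algebra.norm (Kur p d) ((-gen d π) ^ n) = (p : Kur p d) ^ n := by
  rw [← norm_gen hd huK hu hπ]
  refine map_zpow' _ (fun x => ?_) _ _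
  by_cases hx : x = 0
  · rw [hx, inv_zero, Algebra.norm_zero, inv_zero]
  · apply eq_inv_of_mul_eq_one_left
    rw [← map_mul, inv_mul_cancel₀ hx, map_one]

lemma norm_alg (hd : 0 < d) {u π : Qpbar p} (huK : u ∈ Kur p d) (hu : ‖u‖ = 1) (hπ : IsR u π) (a : Kur p d) :
    Algebra.norm (Kur p d) (algebraMap (Kur p d) (Kur p d)⟮π⟯ a) = a ^ p := by
  rw [Algebra.norm_algebraMap]
  exact congrArg (fun n : ℕ => a ^ n) (finrankL hd huK hu hπ)

lemma norm_lin (hp : Odd p) (hd : 0 < d) {u π : Qpbar p} (huK : u ∈ Kur p d) (hu : ‖u‖ = 1) (hπ : IsR u π)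
    (a : Kur p d) (ha : ‖(a : Qpbar p)‖ ≤ 1) :
    ‖((Algebra.norm (Kur p d) (1 + algebraMap (Kur p d) _ a * gen d π) : Kur p d) : Qpbar p) - 1
      + p * ((a : Qpbar p) ^ p - u * a)‖ ≤ (p : ℝ)⁻¹ ^ 2 := by
  have h := prod_lin hd huK hu hπ (x := -(a : Qpbar p)) (by rwa [norm_neg])
  rw [norm_prod]
  have e : ∀ σ : (Kur p d)⟮π⟯ →ₐ[Kur p d] Qpbar p, σ (1 + algebraMap (Kur p d) _ a * gen d π)
      = 1 - (-(a : Qpbar p)) * σ (gen d π) := by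
    intro σ
    rw [map_add, map_one, map_mul, AlgHom.commutes]
    change 1 + (a : Qpbar p) * _ = _
    ring
  simp only [e]
  rw [hp.neg_pow] at h
  convert h using 2
  ring

lemma fwd (hp : Odd p) (hd : 0 < d) {u π : Qpbar p} (huK : u ∈ Kur p d) (hu : ‖u‖ = 1) (hπ : IsR u π)
    (x : (Kur p d)⟮π⟯) (hx : x ≠ 0) : ∃ (n : ℤ) (ζ a w : Kur p d), (ζ : Qpbar p) ^ (p ^ d - 1) = 1 ∧
      ‖(a : Qpbar p)‖ ≤ 1 ∧ ‖(w : Qpbar p) - 1 + p * ((a : Qpbar p) ^ p - u * a)‖ ≤ (p : ℝ)⁻¹ ^ 2 ∧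
      Algebra.norm (Kur p d) x = (p : Kur p d) ^ n * ζ * w := by
  have hr0 := hπ.pos hu
  have hr1 := hπ.lt_one hu
  have hpi := hpi0 (p := p)
  have hpi' := hpi1 (p := p)
  have hπ0 : π ≠ 0 := norm_pos_iff.1 hr0
  have hg0 : -gen d π ≠ 0 := neg_ne_zero.2 (fun h => hπ0 (congrArg Subtype.val h))
  have hx0 : (x : Qpbar p) ≠ 0 := fun h => hx (Subtype.ext h)
  obtain ⟨n, hn⟩ := L_val hd huK hu hπ x.2 hx0
  set z : (Kur p d)⟮π⟯ := x / (-gen d π) ^ n with hz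
  have hxz : x = (-gen d π) ^ n * z := by rw [hz]; field_simp
  have hzn : ‖(z : Qpbar p)‖ = 1 := by
    have : (z : Qpbar p) = x / (-π) ^ n := by
      rw [hz]; push_cast; rfl
    rw [this, norm_div, norm_zpow, norm_neg, hn]
    exact div_self (zpow_pos hr0 n).ne'
  obtain ⟨b, hb, hzb⟩ := L_approx hd huK hu hπ z.2 hzn.le
  obtain ⟨t, ht, hbt⟩ := teich hd b.2 hb
  have hzt : ‖(z : Qpbar p) - t‖ ≤ ‖π‖ := by
    have := add_le hzb (hbt.trans (hπ.norm_gt hu).le)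
    rwa [sub_add_sub_cancel] at this
  have htn : ‖t‖ = 1 := by
    have := add_eq (a := (z : Qpbar p)) (b := -(z - t)) (by rw [norm_neg, hzn]; exact hzt.trans_lt hr1)
    rwa [hzn, show (z : Qpbar p) + -(z - t) = t by ring] at this
  have ht0 : t ≠ 0 := norm_pos_iff.1 (by rw [htn]; norm_num)
  have ht1 := (q_eq.1 ht).resolve_left ht0
  set ζ : Kur p d := ⟨t, root_mem ht1⟩ with hζ
  have hζ0 : ζ ≠ 0 := fun h => ht0 (congrArg Subtype.val h)
  set ζL : (Kur p d)⟮π⟯ := algebraMap (Kur p d) _ ζ with hζL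
  have hζL0 : ζL ≠ 0 := by rw [hζL]; simpa using hζ0
  set z1 : (Kur p d)⟮π⟯ := z / ζL with hz1
  have hz1c : (z1 : Qpbar p) = z / t := by rw [hz1]; push_cast; rfl
  have hz1n : ‖(z1 : Qpbar p) - 1‖ ≤ ‖π‖ := by
    rw [hz1c, div_sub_one ht0, norm_div, htn, div_one]; exact hzt
  have hyL : ((z1 : Qpbar p) - 1) / π ∈ (Kur p d)⟮π⟯ :=
    div_mem (sub_mem z1.2 (one_mem _)) (gen d π).2
  obtain ⟨a, ha, hya⟩ := L_approx hd huK hu hπ hyL (by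
    rw [norm_div]; exact div_le_one_of_le₀ hz1n hr0.le)
  set A : (Kur p d)⟮π⟯ := 1 + algebraMap (Kur p d) _ a * gen d π with hA
  have hAc : (A : Qpbar p) = 1 + a * π := rfl
  have hAn : ‖(A : Qpbar p)‖ = 1 := by
    rw [hAc, add_eq, norm_one]
    rw [norm_one, norm_mul]
    exact (mul_le_of_le_one_left (norm_nonneg _) ha).trans_lt hr1
  have hA0c : (A : Qpbar p) ≠ 0 := norm_pos_iff.1 (by rw [hAn]; norm_num)
  have hA0 : A ≠ 0 := fun h => hA0c (congrArg Subtype.val h)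
  set B : (Kur p d)⟮π⟯ := z1 / A with hB
  have hBc : (B : Qpbar p) = z1 / A := by rw [hB]; push_cast; rfl
  have hBn : ‖(B : Qpbar p) - 1‖ ≤ ‖π‖ ^ 2 := by
    rw [hBc, div_sub_one hA0c, norm_div, hAn, div_one, hAc]
    have : (z1 : Qpbar p) - (1 + a * π) = π * ((z1 - 1) / π - a) := by field_simp; ring
    rw [this, norm_mul, pow_two]
    gcongr
  have hNB := prod_unit hd huK hu hπ (2 * p) 2 le_rfl (by omega) B hBn
  rw [← norm_prod] at hNB
  have hNA := norm_lin hp hd huK hu hπ a ha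
  have hxe : x = (-gen d π) ^ n * ζL * (A * B) := by
    rw [hxz, hB, hz1]; field_simp
  refine ⟨n, ζ ^ p, a, Algebra.norm (Kur p d) A * Algebra.norm (Kur p d) B, ?_, ha, ?_, ?_⟩
  · push_cast
    rw [← pow_mul, mul_comm, pow_mul]
    change (t ^ (p ^ d - 1)) ^ p = 1
    rw [ht1, one_pow]
  · have hNAn : ‖((Algebra.norm (Kur p d) A : Kur p d) : Qpbar p)‖ ≤ 1 := by
      rw [norm_prod, _root_.norm_prod]
      simp [norm_emb, hAn]
    have : (((Algebra.norm (Kur p d) A * Algebra.norm (Kur p d) B : Kur p d) : Kur p d) : Qpbar p) - 1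
        + p * ((a : Qpbar p) ^ p - u * a) = (((Algebra.norm (Kur p d) A : Kur p d) : Qpbar p) - 1
        + p * ((a : Qpbar p) ^ p - u * a)) + ((Algebra.norm (Kur p d) A : Kur p d) : Qpbar p) *
        (((Algebra.norm (Kur p d) B : Kur p d) : Qpbar p) - 1) := by
      push_cast; ring
    rw [this]
    refine add_le hNA ?_
    rw [norm_mul]
    exact (mul_le_of_le_one_left (norm_nonneg _) hNAn).trans hNB
  · conv_lhs => rw [hxe]
    rw [map_mul, map_mul, map_mul, norm_gen_zpow hd huK hu hπ, norm_alg hd huK hu hπ]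

lemma bwd (hp : Odd p) (hd : 0 < d) {u π : Qpbar p} (huK : u ∈ Kur p d) (hu : ‖u‖ = 1) (hπ : IsR u π)
    (n : ℤ) (ζ a w : Kur p d) (hζ : (ζ : Qpbar p) ^ (p ^ d - 1) = 1)
    (ha : ‖(a : Qpbar p)‖ ≤ 1)
    (hw : ‖(w : Qpbar p) - 1 + p * ((a : Qpbar p) ^ p - u * a)‖ ≤ (p : ℝ)⁻¹ ^ 2) :
    ∃ x : (Kur p d)⟮π⟯, x ≠ 0 ∧ Algebra.norm (Kur p d) x = (p : Kur p d) ^ n * ζ * w := by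
  have hr0 := hπ.pos hu
  have hr1 := hπ.lt_one hu
  have hpi := hpi0 (p := p)
  have hpi' := hpi1 (p := p)
  have hπ0 : π ≠ 0 := norm_pos_iff.1 hr0
  have hg0 : -gen d π ≠ 0 := neg_ne_zero.2 (fun h => hπ0 (congrArg Subtype.val h))
  have hζ0 : ζ ≠ 0 := by
    rintro rfl
    have := norm_root_one (q_pos hd) hζ
    simp at this
  set A : (Kur p d)⟮π⟯ := 1 + algebraMap (Kur p d) _ a * gen d π with hA
  have hAc : (A : Qpbar p) = 1 + a * π := rfl
  have hAn : ‖(A : Qpbar p)‖ = 1 := by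
    rw [hAc, add_eq, norm_one]
    rw [norm_one, norm_mul]
    exact (mul_le_of_le_one_left (norm_nonneg _) ha).trans_lt hr1
  have hA0c : (A : Qpbar p) ≠ 0 := norm_pos_iff.1 (by rw [hAn]; norm_num)
  have hA0 : A ≠ 0 := fun h => hA0c (congrArg Subtype.val h)
  have hNA := norm_lin hp hd huK hu hπ a ha
  rw [← hA] at hNA
  have hNAn : ‖((Algebra.norm (Kur p d) A : Kur p d) : Qpbar p)‖ = 1 := by
    rw [norm_prod, _root_.norm_prod]
    simp [norm_emb, hAn]
  set W : Kur p d := Algebra.norm (Kur p d) A with hW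
  have hW0c : (W : Qpbar p) ≠ 0 := norm_pos_iff.1 (by rw [hNAn]; norm_num)
  have hW0 : W ≠ 0 := fun h => hW0c (congrArg Subtype.val h)
  obtain ⟨s, hs, hs0⟩ := pth_root hp hd (w := (w : Qpbar p) / W) (div_mem w.2 W.2) (by
    rw [div_sub_one hW0c, norm_div, hNAn, div_one]
    have := sub_le hw hNA
    rwa [show ((w : Qpbar p) - 1 + p * ((a : Qpbar p) ^ p - u * a)) - ((W : Qpbar p) - 1
      + p * ((a : Qpbar p) ^ p - u * a)) = (w : Qpbar p) - W by ring] at this)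
  have hs' : s ^ p = w / W := Subtype.ext (by push_cast; exact hs)
  have hz : (ζ ^ p ^ (d - 1)) ^ p = ζ := by
    apply Subtype.ext
    push_cast
    rw [← pow_mul, ← pow_succ, Nat.sub_add_cancel hd]
    exact q_eq.2 (Or.inr hζ)
  refine ⟨(-gen d π) ^ n * algebraMap (Kur p d) _ (ζ ^ p ^ (d - 1)) * (algebraMap (Kur p d) _ s * A), ?_, ?_⟩
  · refine mul_ne_zero (mul_ne_zero (zpow_ne_zero _ hg0) ?_) (mul_ne_zero ?_ hA0)
    · rw [ne_eq, map_eq_zero]; exact pow_ne_zero _ hζ0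
    · rw [ne_eq, map_eq_zero]; exact hs0
  · rw [map_mul, map_mul, map_mul, norm_gen_zpow hd huK hu hπ, norm_alg hd huK hu hπ,
      norm_alg hd huK hu hπ, hz, hs', ← hW, div_mul_cancel₀ _ hW0]

end S4


namespace S4
variable {p} {d : ℕ}

lemma to_exp (hp : Odd p) (hd : 0 < d) {u v : Qpbar p} (hv : v ^ (p ^ d - 1) = 1) (huv : u * v ^ p = v)
    (a w : Kur p d) (ha : ‖(a : Qpbar p)‖ ≤ 1)
    (hw : ‖(w : Qpbar p) - 1 + p * ((a : Qpbar p) ^ p - u * a)‖ ≤ (p : ℝ)⁻¹ ^ 2) :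
    ∃ z : Kur p d, ‖(z : Qpbar p)‖ ≤ 1 ∧ ‖Algebra.trace ℚ_[p] (Kur p d) z‖ ≤ (p : ℝ)⁻¹ ∧
      Tendsto (fun N => ‖(w : Qpbar p) - ∑ n ∈ Finset.range N,
        ((p : Qpbar p) * (v ^ p)⁻¹ * z) ^ n / (Nat.factorial n : Qpbar p)‖) atTop (nhds 0) := by
  have hfd := fd (p := p) hd
  have hvn := norm_root_one (q_pos hd) hv
  have hu : ‖u‖ = 1 := by
    have := congrArg norm huv
    rwa [norm_mul, norm_pow, hvn, one_pow, mul_one] at this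
  have hv0 : v ≠ 0 := norm_pos_iff.1 (by rw [hvn]; norm_num)
  have hvK : v ∈ Kur p d := root_mem hv
  have hp0' := p_ne (p := p)
  have hpi := hpi0 (p := p)
  have hpi' := hpi1 (p := p)
  have h1 : ‖(p : Qpbar p) * ((a : Qpbar p) ^ p - u * a)‖ ≤ (p : ℝ)⁻¹ := by
    rw [norm_mul, norm_p]
    refine mul_le_of_le_one_right hpi.le (sub_le ?_ ?_)
    · rw [norm_pow]; exact pow_le_one₀ (norm_nonneg _) ha
    · rw [norm_mul, hu, one_mul]; exact ha
  have h2 : ‖(w : Qpbar p) - 1‖ ≤ (p : ℝ)⁻¹ := by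
    have := sub_le (hw.trans (pow_le_of_le_one hpi.le hpi'.le two_ne_zero)) h1
    rwa [add_sub_cancel_right] at this
  obtain ⟨Y, hY, hYt⟩ := exp_bwd hp hd w.2 h2
  have h3 := exp_fwd hp hY hYt
  set V : Kur p d := ⟨v, hvK⟩ with hV
  set z : Kur p d := Y * V ^ p / (p : Kur p d) with hz
  have hzc : (z : Qpbar p) = Y * v ^ p / p := by rw [hz]; push_cast; rfl
  have hzY : (p : Qpbar p) * (v ^ p)⁻¹ * z = Y := by
    rw [hzc]; field_simp
  set b : Kur p d := V * a with hb
  have hbc : (b : Qpbar p) = v * a := rfl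
  have hbn : ‖(b : Qpbar p)‖ ≤ 1 := by rw [hbc, norm_mul, hvn, one_mul]; exact ha
  have h4 : ‖((z + (b ^ p - b) : Kur p d) : Qpbar p)‖ ≤ (p : ℝ)⁻¹ := by
    have e : ((z + (b ^ p - b) : Kur p d) : Qpbar p) = v ^ p * (((w : Qpbar p) - 1 + p * ((a : Qpbar p) ^ p - u * a))
        - ((w : Qpbar p) - 1 - Y)) / p := by
      push_cast
      rw [hzc, hbc, eq_div_iff hp0']
      have : (Y : Qpbar p) * v ^ p / p * p = Y * v ^ p := by field_simp
      linear_combination this + p * (a : Qpbar p) * huv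
    have h5 := sub_le hw h3
    rw [e, norm_div, norm_mul, norm_pow, hvn, one_pow, one_mul, norm_p, div_le_iff₀ hpi, hpi2]
    exact h5
  refine ⟨z, ?_, ?_, ?_⟩
  · rw [hzc, norm_div, norm_mul, norm_pow, hvn, one_pow, mul_one, norm_p]
    exact div_le_one_of_le₀ hY hpi.le
  · have h5 := trace_le _ h4
    have h6 := trace_pow b hbn
    have e : Algebra.trace ℚ_[p] (Kur p d) z = Algebra.trace ℚ_[p] (Kur p d) (z + (b ^ p - b))
        - Algebra.trace ℚ_[p] (Kur p d) (b ^ p - b) := by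
      rw [← map_sub, add_sub_cancel_right]
    rw [e, sub_eq_add_neg]
    refine (IsUltrametricDist.norm_add_le_max _ _).trans (max_le h5 ?_)
    rw [norm_neg]; exact h6
  · rw [hzY]; exact hYt

lemma of_exp (hp : Odd p) (hd : 0 < d) {u v : Qpbar p} (hv : v ^ (p ^ d - 1) = 1) (huv : u * v ^ p = v)
    (z w : Kur p d) (hz : ‖(z : Qpbar p)‖ ≤ 1) (ht : ‖Algebra.trace ℚ_[p] (Kur p d) z‖ ≤ (p : ℝ)⁻¹)
    (hw : Tendsto (fun N => ‖(w : Qpbar p) - ∑ n ∈ Finset.range N,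
        ((p : Qpbar p) * (v ^ p)⁻¹ * z) ^ n / (Nat.factorial n : Qpbar p)‖) atTop (nhds 0)) :
    ∃ a : Kur p d, ‖(a : Qpbar p)‖ ≤ 1 ∧
      ‖(w : Qpbar p) - 1 + p * ((a : Qpbar p) ^ p - u * a)‖ ≤ (p : ℝ)⁻¹ ^ 2 := by
  have hvn := norm_root_one (q_pos hd) hv
  have hv0 : v ≠ 0 := norm_pos_iff.1 (by rw [hvn]; norm_num)
  have hvK : v ∈ Kur p d := root_mem hv
  have hpi := hpi0 (p := p)
  have h3 := exp_fwd hp (by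
    rw [norm_mul, norm_mul, norm_inv, norm_pow, hvn, one_pow, inv_one, mul_one, norm_p]
    exact mul_le_of_le_one_right hpi.le hz) hw
  obtain ⟨t, ht1, ht2⟩ := hilbert90 hd (x := -z) (by push_cast; rwa [norm_neg]) (by rwa [map_neg, norm_neg])
  set V : Kur p d := ⟨v, hvK⟩ with hV
  have hac : ((V⁻¹ * t : Kur p d) : Qpbar p) = v⁻¹ * t := rfl
  refine ⟨V⁻¹ * t, ?_, ?_⟩
  · rw [hac, norm_mul, norm_inv, hvn, inv_one, one_mul]; exact ht1
  · rw [hac]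
    push_cast at ht2
    have huv' : u = v * (v ^ p)⁻¹ := by
      rw [eq_mul_inv_iff_mul_eq₀ (pow_ne_zero _ hv0)]; exact huv
    have e : (w : Qpbar p) - 1 + p * ((v⁻¹ * (t : Qpbar p)) ^ p - u * (v⁻¹ * t))
      = ((w : Qpbar p) - 1 - p * (v ^ p)⁻¹ * z) - p * (v ^ p)⁻¹ * (-(z : Qpbar p) - ((t : Qpbar p) ^ p - t)) := by
      rw [huv', mul_pow, inv_pow]
      field_simp
      ring
    rw [e]
    refine sub_le h3 ?_
    rw [norm_mul, norm_mul, norm_inv, norm_pow, hvn, one_pow, inv_one, mul_one, norm_p, ← hpi2]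
    gcongr

lemma main (hp : Odd p) (hd : 0 < d) {u v π : Qpbar p} (hv : v ^ (p ^ d - 1) = 1) (huv : u * v ^ p = v)
    (huK : u ∈ Kur p d) (hu : ‖u‖ = 1) (hπ : IsR u π) (y : Kur p d) :
    (∃ x : (Kur p d)⟮π⟯, x ≠ 0 ∧ Algebra.norm (Kur p d) x = y) ↔
    ∃ (m : ℤ) (ζ z w : Kur p d), (ζ : Qpbar p) ^ (p ^ d - 1) = 1 ∧
      ‖(z : Qpbar p)‖ ≤ 1 ∧ ‖Algebra.trace ℚ_[p] (Kur p d) z‖ ≤ (p : ℝ)⁻¹ ∧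
      Tendsto (fun N => ‖(w : Qpbar p) - ∑ n ∈ Finset.range N,
        ((p : Qpbar p) * (v ^ p)⁻¹ * z) ^ n / (Nat.factorial n : Qpbar p)‖) atTop (nhds 0) ∧
      y = (p : Kur p d) ^ m * ζ * w := by
  constructor
  · rintro ⟨x, hx, rfl⟩
    obtain ⟨n, ζ, a, w, h1, h2, h3, h4⟩ := fwd hp hd huK hu hπ x hx
    obtain ⟨z, hz1, hz2, hz3⟩ := to_exp hp hd hv huv a w h2 h3
    exact ⟨n, ζ, z, w, h1, hz1, hz2, hz3, h4⟩
  · rintro ⟨n, ζ, z, w, h1, hz1, hz2, hz3, rfl⟩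
    obtain ⟨a, h2, h3⟩ := of_exp hp hd hv huv z w hz1 hz2 hz3
    exact bwd hp hd huK hu hπ n ζ a w h1 h2 h3

end S4

/-- for `v ∈ μ_{q-1}`, the norm group of `M_{v^{1-p}}/K` is
`N(M_{v^{1-p}}/K) = ⟨p⟩ × μ_{q-1} × exp(p v^{-p} Z)`, i.e. it consists exactly of the
elements `p^m · ζ · exp(p v^{-p} z)` with `m ∈ ℤ`, `ζ ∈ μ_{q-1}` and `z ∈ Z`, where
`Z = {x ∈ O_K : Tr_{K/ℚ_p}(x) ∈ p ℤ_p}`. -/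
theorem statement4 (hp : Odd p) (d : ℕ) (hd : 0 < d)
    (abv : AbsoluteValue (Qpbar p) ℝ)
    (habv : ∀ x : ℚ_[p], abv (algebraMap ℚ_[p] (Qpbar p) x) = ‖x‖)
    (v : Qpbar p) (hv : v ^ (p ^ d - 1) = 1)
    (u : Qpbar p) (hu : u = v ^ ((1 : ℤ) - (p : ℤ)))
    [FiniteDimensional (Kur p d) (Mfield p d u)] :
    {y : Kur p d | ∃ x : Mfield p d u, x ≠ 0 ∧ Algebra.norm (Kur p d) x = y} =
    {y : Kur p d | ∃ (m : ℤ) (ζ z w : Kur p d),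
      (ζ : Qpbar p) ^ (p ^ d - 1) = 1 ∧
      abv ↑z ≤ 1 ∧ ‖Algebra.trace ℚ_[p] (Kur p d) z‖ ≤ (p : ℝ)⁻¹ ∧
      IsExpOf p abv ((p : Qpbar p) * (v ^ p)⁻¹ * ↑z) ↑w ∧
      y = (p : Kur p d) ^ m * ζ * w} := by
  have hvn := S4.norm_root_one (S4.q_pos hd) hv
  have hv0 : v ≠ 0 := norm_pos_iff.1 (by rw [hvn]; norm_num)
  have hvK : v ∈ Kur p d := S4.root_mem hv
  have huv' : u = v * (v ^ p)⁻¹ := by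
    rw [hu, zpow_sub₀ hv0, zpow_one, zpow_natCast, div_eq_mul_inv]
  have huv : u * v ^ p = v := by
    rw [huv', inv_mul_cancel_right₀ (pow_ne_zero _ hv0)]
  have hun : ‖u‖ = 1 := by
    have := congrArg norm huv
    rwa [norm_mul, norm_pow, hvn, one_pow, mul_one] at this
  have huK : u ∈ Kur p d := by
    rw [huv']; exact mul_mem hvK (inv_mem (pow_mem hvK _))
  obtain ⟨π, hπ⟩ := S4.exists_root u
  have hM : Mfield p d u = (Kur p d)⟮π⟯ := by
    apply le_antisymm
    · rw [Mfield, IntermediateField.adjoin_le_iff]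
      intro x hx
      exact S4.roots_adjoin hp hv hd huv hπ (S4.isR_iff.1 hx)
    · rw [IntermediateField.adjoin_simple_le_iff]
      exact IntermediateField.subset_adjoin _ _ (S4.isR_iff.2 hπ)
  have key : ∀ (L : IntermediateField (Kur p d) (Qpbar p)), L = (Kur p d)⟮π⟯ → ∀ y : Kur p d,
      ((∃ x : L, x ≠ 0 ∧ Algebra.norm (Kur p d) x = y) ↔
        ∃ x : (Kur p d)⟮π⟯, x ≠ 0 ∧ Algebra.norm (Kur p d) x = y) := by
    rintro L rfl y; rfl
  ext y
  have h := (key _ hM y).trans (S4.main hp hd hv huv huK hun hπ y)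
  simp only [Set.mem_ofPred_eq, IsExpOf, S4.abv_eq p abv habv]
  exact h
end
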